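/- Fix positive integers a, b, c with gcd(a,b,c) = 1. The form f(x,y,z) = a·t_x + b·t_y + c·t_z (x, y, z ∈ ℕ) is asymptotically universal if and only if −bc R a′, −ac R b′, and −ab R c′. -/

import Mathlib

/-- The `k`-th triangular number. -/
def triangular (k : ℕ) : ℕ := k * (k + 1) / 2

/-- The odd part `m'` of `m`, i.e. `m = 2^(v₂ m) * m'` with `m'` odd. -/
def oddPart (m : ℕ) : ℕ := m / 2 ^ (m.factorization 2)

/-- `d R m` : the Legendre symbol `(d/p)` equals `1` for every prime `p ∣ m`. -/
def isQR (d : ℤ) (m : ℕ) : Prop :=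
  ∀ p : ℕ, (hp : p.Prime) → p ∣ m → @legendreSym p ⟨hp⟩ d = 1

/-- A solvability predicate is asymptotically universal if its exceptional set
has asymptotic density zero. -/
def AsympUniversal (sol : ℕ → Prop) : Prop :=
  Filter.Tendsto (fun N : ℕ => ({n : ℕ | n < N ∧ ¬ sol n}.ncard : ℝ) / N)
    Filter.atTop (nhds 0)

namespace TernaryTriangular

open Finset

lemma eight_mul_triangular_add_one (k : ℕ) :
    8 * (triangular k : ℤ) + 1 = (2 * k + 1) ^ 2 := by
  have h : 2 * triangular k = k * (k + 1) :=
    Nat.mul_div_cancel' (Nat.even_mul_succ_self k).two_dvd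
  have h' : 2 * (triangular k : ℤ) = k * (k + 1) := by exact_mod_cast h
  linear_combination 4 * h'

lemma prime_dvd_oddPart_iff {m p : ℕ} (hm : 0 < m) (hp : p.Prime) :
    p ∣ oddPart m ↔ p ≠ 2 ∧ p ∣ m := by
  constructor
  · intro h
    refine ⟨?_, h.trans (Nat.ordCompl_dvd m 2)⟩
    rintro rfl
    exact Nat.not_dvd_ordCompl Nat.prime_two hm.ne' h
  · rintro ⟨h2, h⟩
    have := Nat.ordProj_mul_ordCompl_eq_self m 2
    rw [← this] at h
    rcases hp.dvd_mul.1 h with h | h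
    · exact absurd ((Nat.prime_dvd_prime_iff_eq hp Nat.prime_two).1 (hp.dvd_of_dvd_pow h)) h2
    · exact h

/-! ### Necessity of the local conditions -/

lemma not_asympUniversal_of_residue_class {sol : ℕ → Prop} {q : ℕ} (hq : 0 < q) (n₀ : ℕ)
    (h : ∀ n, n ≡ n₀ [MOD q] → ¬ sol n) : ¬ AsympUniversal sol := by
  intro hs
  have hlt : ∀ᶠ N : ℕ in Filter.atTop,
      ({n : ℕ | n < N ∧ ¬ sol n}.ncard : ℝ) / N < 1 / q :=
    hs.eventually_lt_const (by positivity)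
  obtain ⟨N₀, hN₀⟩ := Filter.eventually_atTop.1 hlt
  have hN : N₀ ≤ q * (N₀ + 1) := by nlinarith
  have hspec := hN₀ _ hN
  have hfin : {n : ℕ | n < q * (N₀ + 1) ∧ ¬ sol n}.Finite :=
    (Set.finite_lt_nat _).subset fun n hn => hn.1
  have hcard : N₀ + 1 ≤ {n : ℕ | n < q * (N₀ + 1) ∧ ¬ sol n}.ncard := by
    have hinj : Function.Injective fun i : ℕ => n₀ % q + q * i := by
      intro i j hij
      exact Nat.eq_of_mul_eq_mul_left hq (Nat.add_left_cancel hij)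
    calc N₀ + 1 = (((range (N₀ + 1)).image fun i : ℕ => n₀ % q + q * i : Finset ℕ) :
          Set ℕ).ncard := by
          rw [Set.ncard_coe_finset, card_image_of_injective _ hinj, card_range]
      _ ≤ _ := by
          refine Set.ncard_le_ncard ?_ hfin
          intro n hn
          simp only [coe_image, coe_range, Set.mem_image, Set.mem_Iio] at hn
          obtain ⟨i, hi, rfl⟩ := hn
          refine ⟨?_, h _ ?_⟩
          · have := Nat.mod_lt n₀ hq
            nlinarith
          · simp [Nat.ModEq]
  rw [div_lt_div_iff₀ (by positivity) (by positivity)] at hspec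
  have : ((N₀ + 1 : ℕ) : ℝ) * q ≤
      ({n : ℕ | n < q * (N₀ + 1) ∧ ¬ sol n}.ncard : ℝ) * q := by
    gcongr
  push_cast at *
  linarith

lemma exists_not_mul_sq {p : ℕ} [Fact p.Prime] (hp : p ≠ 2) (k : ZMod p) :
    ∃ s : ZMod p, ∀ x : ZMod p, k * x ^ 2 ≠ s := by
  by_contra! hcon
  have hsurj : Function.Surjective fun x : ZMod p => k * x ^ 2 := hcon
  have hinj := Finite.injective_iff_surjective.2 hsurj
  have : (1 : ZMod p) = -1 := hinj (by simp)
  have : Fact (2 < p) := ⟨lt_of_le_of_ne (Fact.out : p.Prime).two_le hp.symm⟩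
  exact ZMod.neg_one_ne_one (by assumption : (1 : ZMod p) = -1).symm

lemma exists_not_quadratic {a b c : ℤ} {p : ℕ} [Fact p.Prime] (hp : p ≠ 2)
    (ha : (p : ℤ) ∣ a)
    (hleg : legendreSym p (-(b * c)) ≠ 1) :
    ∃ m₀ : ℤ, ∀ m : ℤ, m ≡ m₀ [ZMOD p ^ 2] → ∀ x y z : ℤ,
      a * x ^ 2 + b * y ^ 2 + c * z ^ 2 ≠ m := by
  have hpp : Prime (p : ℤ) := Nat.prime_iff_prime_int.1 Fact.out
  have key : ∀ b c : ℤ, (p : ℤ) ∣ b → ∃ m₀ : ℤ, ∀ m : ℤ, m ≡ m₀ [ZMOD p ^ 2] →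
      ∀ x y z : ℤ, a * x ^ 2 + b * y ^ 2 + c * z ^ 2 ≠ m := by
    intro b c hb
    obtain ⟨s, hs⟩ := exists_not_mul_sq hp (c : ZMod p)
    obtain ⟨m₀, rfl⟩ := ZMod.intCast_surjective s
    refine ⟨m₀, ?_⟩
    rintro m hm x y z rfl
    refine hs z ?_
    have h1 := (ZMod.intCast_eq_intCast_iff _ _ p).2
      (hm.of_dvd (Dvd.intro_left _ (pow_two (p : ℤ)).symm))
    have ha' : (a : ZMod p) = 0 := (ZMod.intCast_zmod_eq_zero_iff_dvd _ _).2 ha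
    have hb' : (b : ZMod p) = 0 := (ZMod.intCast_zmod_eq_zero_iff_dvd _ _).2 hb
    rw [← h1]
    push_cast
    rw [ha', hb']
    ring
  by_cases hb : (p : ℤ) ∣ b
  · exact key b c hb
  by_cases hc : (p : ℤ) ∣ c
  · obtain ⟨m₀, hm₀⟩ := key c b hc
    refine ⟨m₀, fun m hm x y z h => hm₀ m hm x z y ?_⟩
    linarith
  have hb' : (b : ZMod p) ≠ 0 := fun h => hb ((ZMod.intCast_zmod_eq_zero_iff_dvd _ _).1 h)
  have hc' : (c : ZMod p) ≠ 0 := fun h => hc ((ZMod.intCast_zmod_eq_zero_iff_dvd _ _).1 h)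
  have hne : ((-(b * c) : ℤ) : ZMod p) ≠ 0 := by push_cast; simp [hb', hc']
  have hnsq : ¬ IsSquare ((-(b * c) : ℤ) : ZMod p) :=
    fun h => hleg ((legendreSym.eq_one_iff p hne).2 h)
  have haniso : ∀ y z : ℤ, (p : ℤ) ∣ b * y ^ 2 + c * z ^ 2 → (p : ℤ) ∣ y ∧ (p : ℤ) ∣ z := by
    intro y z h
    have h0 : (b : ZMod p) * y ^ 2 + c * z ^ 2 = 0 := by
      have := (ZMod.intCast_zmod_eq_zero_iff_dvd _ p).2 h
      push_cast at this
      exact this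
    have hz : (z : ZMod p) = 0 := by
      by_contra hz
      refine hnsq ⟨b * y / z, ?_⟩
      field_simp
      push_cast
      linear_combination (-(b : ZMod p)) * h0
    have hy : (y : ZMod p) = 0 := by
      rw [hz] at h0
      simpa [hb'] using h0
    exact ⟨(ZMod.intCast_zmod_eq_zero_iff_dvd _ _).1 hy,
      (ZMod.intCast_zmod_eq_zero_iff_dvd _ _).1 hz⟩
  obtain ⟨a', rfl⟩ := ha
  obtain ⟨s, hs⟩ := exists_not_mul_sq hp (a' : ZMod p)
  obtain ⟨s, rfl⟩ := ZMod.intCast_surjective s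
  refine ⟨p * s, ?_⟩
  rintro m hm x y z rfl
  have hdvd : (p : ℤ) ^ 2 ∣ p * s - (p * a' * x ^ 2 + b * y ^ 2 + c * z ^ 2) := hm.dvd
  have hyz : (p : ℤ) ∣ b * y ^ 2 + c * z ^ 2 := by
    have h1 : (p : ℤ) ∣ p * s - (p * a' * x ^ 2 + b * y ^ 2 + c * z ^ 2) :=
      (Dvd.intro_left _ (pow_two (p : ℤ)).symm).trans hdvd
    have h2 : (p : ℤ) ∣ p * (s - a' * x ^ 2) := dvd_mul_right _ _
    have := dvd_sub h2 h1
    ring_nf at this ⊢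
    exact this
  obtain ⟨⟨y, rfl⟩, ⟨z, rfl⟩⟩ := haniso y z hyz
  refine hs x ?_
  have h3 : (p : ℤ) * p ∣ p * (s - a' * x ^ 2) := by
    have h4 : (p : ℤ) ^ 2 ∣ p ^ 2 * (b * y ^ 2 + c * z ^ 2) := dvd_mul_right _ _
    have := dvd_add hdvd h4
    rw [← pow_two]
    ring_nf at this ⊢
    exact this
  have h5 : (p : ℤ) ∣ s - a' * x ^ 2 := (mul_dvd_mul_iff_left hpp.ne_zero).1 h3
  have := (ZMod.intCast_zmod_eq_zero_iff_dvd _ p).2 h5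
  push_cast at this
  linear_combination -this

lemma exists_missed_residue_class {a b c p : ℕ} (hp : p.Prime) (hp2 : p ≠ 2) (ha : p ∣ a)
    (hleg : @legendreSym p ⟨hp⟩ (-((b : ℤ) * c)) ≠ 1) :
    ∃ q > 0, ∃ n₀ : ℕ, ∀ n, n ≡ n₀ [MOD q] → ¬ ∃ x y z : ℕ,
      a * triangular x + b * triangular y + c * triangular z = n := by
  have : Fact p.Prime := ⟨hp⟩
  obtain ⟨m₀, hm₀⟩ := exists_not_quadratic hp2 (Int.natCast_dvd_natCast.2 ha) hleg
  have hcop : IsCoprime (8 : ℤ) ((p : ℤ) ^ 2) := by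
    have : Nat.Coprime (2 ^ 3) (p ^ 2) :=
      Nat.Coprime.pow _ _ ((Nat.coprime_primes Nat.prime_two hp).2 hp2.symm)
    exact_mod_cast Nat.isCoprime_iff_coprime.2 this
  obtain ⟨i, j, hij⟩ := hcop
  have hq : (0 : ℤ) < (p : ℤ) ^ 2 := by have := hp.pos; positivity
  refine ⟨p ^ 2, by have := hp.pos; positivity,
    ((i * (m₀ - (a + b + c))) % (p : ℤ) ^ 2).toNat, ?_⟩
  rintro n hn ⟨x, y, z, hxyz⟩
  have hn' : (n : ℤ) ≡ i * (m₀ - (a + b + c)) [ZMOD p ^ 2] := by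
    have h := (Int.natCast_modEq_iff).2 hn
    rw [Int.toNat_of_nonneg (Int.emod_nonneg _ hq.ne')] at h
    push_cast at h
    exact h.trans (Int.mod_modEq _ _)
  refine hm₀ (8 * n + (a + b + c)) ?_ (2 * x + 1) (2 * y + 1) (2 * z + 1) ?_
  · have h1 := (hn'.mul_left 8).add_right ((a : ℤ) + b + c)
    refine h1.trans (Int.modEq_iff_dvd.2 ⟨j * (m₀ - (a + b + c)), ?_⟩)
    linear_combination (-(m₀ - ((a : ℤ) + b + c))) * hij
  · rw [← eight_mul_triangular_add_one, ← eight_mul_triangular_add_one,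
      ← eight_mul_triangular_add_one, ← hxyz]
    push_cast
    ring

/-! ### The associated integral form -/

/-- The polynomial `2·x² + x`; over `ℤ` its values are exactly the triangular numbers. -/
def hexagonal {R : Type*} [CommRing R] (x : R) : R := 2 * x ^ 2 + x

/-- The form `a·(2·x² + x) + b·(2·y² + y) + c·(2·z² + z)` over a commutative ring. -/
def ternaryForm {R : Type*} [CommRing R] (a b c : ℕ) (v : R × R × R) : R :=
  a * hexagonal v.1 + b * hexagonal v.2.1 + c * hexagonal v.2.2

lemma map_hexagonal {R S : Type*} [CommRing R] [CommRing S] (φ : R →+* S) (x : R) :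
    φ (hexagonal x) = hexagonal (φ x) := by
  simp only [hexagonal, map_add, map_mul, map_pow, map_ofNat]

lemma map_ternaryForm {R S : Type*} [CommRing R] [CommRing S] (φ : R →+* S) (a b c : ℕ)
    (v : R × R × R) :
    φ (ternaryForm a b c v) = ternaryForm a b c (φ v.1, φ v.2.1, φ v.2.2) := by
  simp [ternaryForm, map_hexagonal]

/-- The number of representations of `r` by `ternaryForm a b c` over a finite ring. -/
def numSol {R : Type*} [CommRing R] [Fintype R] [DecidableEq R] (a b c : ℕ) (r : R) : ℕ :=
  #{v : R × R × R | ternaryForm a b c v = r}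

/-- A point modulo which the gradient of `ternaryForm a b c` vanishes. -/
def IsSingular {R : Type*} [CommRing R] (a b c : ℕ) (v : R × R × R) : Prop :=
  a * (4 * v.1 + 1) = 0 ∧ b * (4 * v.2.1 + 1) = 0 ∧ c * (4 * v.2.2 + 1) = 0

instance {R : Type*} [CommRing R] [DecidableEq R] (a b c : ℕ) :
    DecidablePred (IsSingular (R := R) a b c) :=
  fun _ => inferInstanceAs (Decidable (_ ∧ _ ∧ _))

/-- The number of nonsingular representations of `r` over a finite ring. -/
def numNonsing {R : Type*} [CommRing R] [Fintype R] [DecidableEq R] (a b c : ℕ) (r : R) : ℕ :=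
  #{v : R × R × R | ternaryForm a b c v = r ∧ ¬ IsSingular a b c v}

lemma numNonsing_le_numSol {R : Type*} [CommRing R] [Fintype R] [DecidableEq R]
    (a b c : ℕ) (r : R) : numNonsing a b c r ≤ numSol a b c r :=
  card_le_card fun v hv => by
    simp only [mem_filter] at hv ⊢
    exact ⟨hv.1, hv.2.1⟩

lemma numSol_ringEquiv {R S : Type*} [CommRing R] [Fintype R] [DecidableEq R]
    [CommRing S] [Fintype S] [DecidableEq S] (e : R ≃+* S) (a b c : ℕ) (r : R) :
    numSol a b c (e r) = numSol a b c r := by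
  symm
  refine card_equiv (e.toEquiv.prodCongr (e.toEquiv.prodCongr e.toEquiv)) fun _ => ?_
  simp only [mem_filter, mem_univ, true_and]
  have := map_ternaryForm e.toRingHom a b c ‹R × R × R›
  constructor
  · rintro rfl
    exact this.symm
  · intro h
    exact e.injective (this.trans h)

lemma numSol_pi {ι : Type*} [Fintype ι] [DecidableEq ι] {R : ι → Type*}
    [∀ i, CommRing (R i)] [∀ i, Fintype (R i)] [∀ i, DecidableEq (R i)]
    (a b c : ℕ) (r : ∀ i, R i) : numSol a b c r = ∏ i, numSol a b c (r i) := by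
  simp only [numSol]
  rw [← Fintype.card_piFinset]
  refine card_bij' (fun v _ i => (v.1 i, v.2.1 i, v.2.2 i))
    (fun w _ => (fun i => (w i).1, fun i => (w i).2.1, fun i => (w i).2.2)) ?_ ?_ ?_ ?_
  · intro v hv
    simp only [mem_filter, mem_univ, true_and, Fintype.mem_piFinset] at hv ⊢
    intro i
    simpa [ternaryForm, hexagonal] using congrFun hv i
  · intro w hw
    simp only [mem_filter, mem_univ, true_and, Fintype.mem_piFinset] at hw ⊢
    funext i
    simpa [ternaryForm, hexagonal] using hw i
  · intros; rfl
  · intros; rfl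

/-! ### Lifting nonsingular solutions -/

lemma exists_lift_hexagonal {R S : Type*} [CommRing R] [Fintype R] [DecidableEq R]
    [Field S] [DecidableEq S] (π : R →+* S) (hloc : ∀ x, π x ≠ 0 → IsUnit x)
    {K : ℕ} (hK : ∀ s, #{x | π x = s} = K) (α : ℕ) (m : R) (s : S)
    (hs : (α : S) * (4 * s + 1) ≠ 0) (hm : α * hexagonal s = π m) :
    ∃ x, π x = s ∧ α * hexagonal x = m := by
  have hmaps : ∀ x ∈ ({x | π x = s} : Finset R), α * hexagonal x ∈
      ({y | π y = π m} : Finset R) := by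
    intro x hx
    simp only [mem_filter, mem_univ, true_and] at hx ⊢
    rw [map_mul, map_natCast, map_hexagonal, hx, hm]
  have hinj : Set.InjOn (fun x : R => (α : R) * hexagonal x) ({x | π x = s} : Finset R) := by
    intro x hx y hy hxy
    simp only [mem_coe, mem_filter, mem_univ, true_and] at hx hy
    have hu : IsUnit ((α : R) * (2 * (x + y) + 1)) := by
      apply hloc
      rw [map_mul, map_add, map_mul, map_add, hx, hy, map_natCast, map_one, map_ofNat]
      convert hs using 2
      ring
    have h0 : ((α : R) * (2 * (x + y) + 1)) * (x - y) = 0 := by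
      simp only [hexagonal] at hxy
      linear_combination hxy
    exact sub_eq_zero.1 ((hu.mul_right_eq_zero).1 h0)
  have himage : ({x | π x = s} : Finset R).image (fun x => (α : R) * hexagonal x) =
      ({y | π y = π m} : Finset R) :=
    eq_of_subset_of_card_le (image_subset_iff.2 hmaps)
      (by rw [card_image_of_injOn hinj, hK, hK])
  have hmem : m ∈ ({x | π x = s} : Finset R).image (fun x => (α : R) * hexagonal x) := by
    rw [himage]; simp
  simpa using hmem

lemma sq_le_card_lifts {R S : Type*} [CommRing R] [Fintype R] [DecidableEq R]
    [Field S] [DecidableEq S] (π : R →+* S) (hloc : ∀ x, π x ≠ 0 → IsUnit x)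
    {K : ℕ} (hK : ∀ s, #{x | π x = s} = K) (a b c : ℕ) (r : R) (s : S × S × S)
    (hs : ternaryForm a b c s = π r) (hns : ¬ IsSingular a b c s) :
    K ^ 2 ≤ #{v : R × R × R | ternaryForm a b c v = r ∧ (π v.1, π v.2.1, π v.2.2) = s} := by
  obtain ⟨s₁, s₂, s₃⟩ := s
  simp only [ternaryForm] at hs
  have hcard : ∀ s t : S, K ^ 2 = #(({x | π x = s} : Finset R) ×ˢ ({x | π x = t} : Finset R)) := by
    intro s t
    rw [card_product, hK, hK, pow_two]
  simp only [IsSingular, not_and_or] at hns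
  rcases hns with h | h | h
  · have hex : ∀ y z : R, π y = s₂ → π z = s₃ →
        ∃ x, π x = s₁ ∧ a * hexagonal x = r - b * hexagonal y - c * hexagonal z := by
      intro y z hy hz
      refine exists_lift_hexagonal π hloc hK a _ s₁ h ?_
      simp only [map_sub, map_mul, map_natCast, map_hexagonal, hy, hz]
      linear_combination hs
    choose! g hg using hex
    rw [hcard s₂ s₃]
    refine card_le_card_of_injOn (fun p => (g p.1 p.2, p.1, p.2)) ?_ ?_
    · rintro ⟨y, z⟩ hp
      simp only [mem_coe, mem_product, mem_filter, mem_univ, true_and] at hp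
      obtain ⟨h1, h2⟩ := hg y z hp.1 hp.2
      simp only [mem_coe, mem_filter, mem_univ, true_and, h1, hp.1, hp.2, and_true]
      simp only [ternaryForm, h2]
      ring
    · rintro ⟨y, z⟩ - ⟨y', z'⟩ - h
      simp only [Prod.mk.injEq] at h ⊢
      exact h.2
  · have hex : ∀ x z : R, π x = s₁ → π z = s₃ →
        ∃ y, π y = s₂ ∧ b * hexagonal y = r - a * hexagonal x - c * hexagonal z := by
      intro y z hy hz
      refine exists_lift_hexagonal π hloc hK b _ s₂ h ?_
      simp only [map_sub, map_mul, map_natCast, map_hexagonal, hy, hz]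
      linear_combination hs
    choose! g hg using hex
    rw [hcard s₁ s₃]
    refine card_le_card_of_injOn (fun p => (p.1, g p.1 p.2, p.2)) ?_ ?_
    · rintro ⟨y, z⟩ hp
      simp only [mem_coe, mem_product, mem_filter, mem_univ, true_and] at hp
      obtain ⟨h1, h2⟩ := hg y z hp.1 hp.2
      simp only [mem_coe, mem_filter, mem_univ, true_and, h1, hp.1, hp.2, and_true]
      simp only [ternaryForm, h2]
      ring
    · rintro ⟨y, z⟩ - ⟨y', z'⟩ - h
      simp only [Prod.mk.injEq] at h ⊢
      exact ⟨h.1, h.2.2⟩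
  · have hex : ∀ x y : R, π x = s₁ → π y = s₂ →
        ∃ z, π z = s₃ ∧ c * hexagonal z = r - a * hexagonal x - b * hexagonal y := by
      intro y z hy hz
      refine exists_lift_hexagonal π hloc hK c _ s₃ h ?_
      simp only [map_sub, map_mul, map_natCast, map_hexagonal, hy, hz]
      linear_combination hs
    choose! g hg using hex
    rw [hcard s₁ s₂]
    refine card_le_card_of_injOn (fun p => (p.1, p.2, g p.1 p.2)) ?_ ?_
    · rintro ⟨y, z⟩ hp
      simp only [mem_coe, mem_product, mem_filter, mem_univ, true_and] at hp
      obtain ⟨h1, h2⟩ := hg y z hp.1 hp.2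
      simp only [mem_coe, mem_filter, mem_univ, true_and, h1, hp.1, hp.2, and_true]
      simp only [ternaryForm, h2]
      ring
    · rintro ⟨y, z⟩ - ⟨y', z'⟩ - h
      simp only [Prod.mk.injEq] at h ⊢
      exact ⟨h.1, h.2.1⟩

lemma sq_mul_numNonsing_le_numSol {R S : Type*} [CommRing R] [Fintype R] [DecidableEq R]
    [Field S] [Fintype S] [DecidableEq S] (π : R →+* S) (hloc : ∀ x, π x ≠ 0 → IsUnit x)
    {K : ℕ} (hK : ∀ s, #{x | π x = s} = K) (a b c : ℕ) (r : R) :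
    K ^ 2 * numNonsing a b c (π r) ≤ numSol a b c r := by
  have hmaps : ∀ v ∈ ({v | ternaryForm a b c v = r} : Finset (R × R × R)),
      (π v.1, π v.2.1, π v.2.2) ∈ (univ : Finset (S × S × S)) := fun _ _ => mem_univ _
  rw [numSol, card_eq_sum_card_fiberwise hmaps, numNonsing, card_eq_sum_ones, mul_sum, mul_one]
  refine (sum_le_sum fun s hs => ?_).trans (sum_le_univ_sum_of_nonneg fun _ => Nat.zero_le _)
  rw [mem_filter] at hs
  rw [filter_filter]
  exact sq_le_card_lifts π hloc hK a b c r s hs.2.1 hs.2.2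

/-! ### Local representations modulo a prime -/

lemma card_linear_solutions_le {F : Type*} [Field F] [Fintype F] [DecidableEq F]
    (α β γ h : F) (hne : ¬ (α = 0 ∧ β = 0 ∧ γ = 0)) :
    #{v : F × F × F | α * v.1 + β * v.2.1 + γ * v.2.2 = h} ≤ Fintype.card F ^ 2 := by
  have hcard : Fintype.card F ^ 2 = #(univ : Finset (F × F)) := by
    rw [card_univ, Fintype.card_prod, pow_two]
  rw [hcard]
  simp only [not_and_or] at hne
  rcases hne with h0 | h0 | h0
  · refine card_le_card_of_injOn (fun v => (v.2.1, v.2.2)) (fun _ _ => mem_univ _) ?_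
    rintro ⟨x, y, z⟩ hv ⟨x', y', z'⟩ hv' hvv
    simp only [mem_coe, mem_filter, mem_univ, true_and, Prod.mk.injEq] at hv hv' hvv ⊢
    obtain ⟨rfl, rfl⟩ := hvv
    exact ⟨mul_left_cancel₀ h0 (by linear_combination hv - hv'), rfl, rfl⟩
  · refine card_le_card_of_injOn (fun v => (v.1, v.2.2)) (fun _ _ => mem_univ _) ?_
    rintro ⟨x, y, z⟩ hv ⟨x', y', z'⟩ hv' hvv
    simp only [mem_coe, mem_filter, mem_univ, true_and, Prod.mk.injEq] at hv hv' hvv ⊢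
    obtain ⟨rfl, rfl⟩ := hvv
    exact ⟨rfl, mul_left_cancel₀ h0 (by linear_combination hv - hv'), rfl⟩
  · refine card_le_card_of_injOn (fun v => (v.1, v.2.1)) (fun _ _ => mem_univ _) ?_
    rintro ⟨x, y, z⟩ hv ⟨x', y', z'⟩ hv' hvv
    simp only [mem_coe, mem_filter, mem_univ, true_and, Prod.mk.injEq] at hv hv' hvv ⊢
    obtain ⟨rfl, rfl⟩ := hvv
    exact ⟨rfl, rfl, mul_left_cancel₀ h0 (by linear_combination hv - hv')⟩

lemma sum_card_fiber_sq {α β : Type*} [DecidableEq α] [DecidableEq β] (s : Finset α)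
    (t : Finset β) (f : α → β) (hf : ∀ x ∈ s, f x ∈ t) :
    ∑ b ∈ t, #{x ∈ s | f x = b} ^ 2 = #{p ∈ s ×ˢ s | f p.1 = f p.2} := by
  have hmaps : ∀ p ∈ ({p ∈ s ×ˢ s | f p.1 = f p.2} : Finset (α × α)), f p.1 ∈ t := by
    intro p hp
    simp only [mem_filter, mem_product] at hp
    exact hf _ hp.1.1
  rw [card_eq_sum_card_fiberwise hmaps]
  refine sum_congr rfl fun b _ => ?_
  rw [pow_two, ← card_product]
  congr 1
  ext p
  simp only [mem_filter, mem_product]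
  constructor
  · rintro ⟨⟨h1, h2⟩, h3, h4⟩
    exact ⟨⟨⟨h1, h3⟩, h2.trans h4.symm⟩, h2⟩
  · rintro ⟨⟨⟨h1, h3⟩, h2⟩, h4⟩
    exact ⟨⟨h1, h4⟩, h3, h2.symm.trans h4⟩

section FiniteField

variable {F : Type*} [Field F] [Fintype F] [DecidableEq F]

lemma sum_numSol_sq_le (a b c : ℕ) (h2 : (2 : F) ≠ 0) (ha : (a : F) ≠ 0) (hb : (b : F) ≠ 0)
    (hc : (c : F) ≠ 0) :
    ∑ r : F, numSol a b c r ^ 2 ≤ Fintype.card F ^ 5 + Fintype.card F ^ 3 := by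
  have h4 : (4 : F) ≠ 0 := by
    have : (4 : F) = 2 * 2 := by norm_num
    rw [this]; exact mul_ne_zero h2 h2
  simp only [numSol]
  rw [sum_card_fiber_sq univ univ (ternaryForm (R := F) a b c) fun _ _ => mem_univ _]
  have hmaps : ∀ p ∈ ({p ∈ (univ : Finset (F × F × F)) ×ˢ univ |
      ternaryForm a b c p.1 = ternaryForm a b c p.2} : Finset _),
      p.1 - p.2 ∈ (univ : Finset (F × F × F)) := fun _ _ => mem_univ _
  rw [card_eq_sum_card_fiberwise hmaps]
  have hcard3 : Fintype.card (F × F × F) = Fintype.card F ^ 3 := by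
    rw [Fintype.card_prod, Fintype.card_prod]; ring
  have hfib : ∀ u : F × F × F, #{p ∈ ({p ∈ (univ : Finset (F × F × F)) ×ˢ univ |
      ternaryForm a b c p.1 = ternaryForm a b c p.2} : Finset _) | p.1 - p.2 = u} ≤
      Fintype.card F ^ 2 + if u = 0 then Fintype.card F ^ 3 else 0 := by
    rintro ⟨u₁, u₂, u₃⟩
    split_ifs with hu
    · refine le_add_left ?_
      rw [← hcard3, ← card_univ]
      refine card_le_card_of_injOn (fun p => p.2) (fun _ _ => mem_univ _) ?_
      rintro ⟨p, q⟩ hp ⟨p', q'⟩ hp' hpp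
      simp only [mem_coe, mem_filter, hu, sub_eq_zero] at hp hp' hpp
      rw [hp.2, hp'.2, hpp]
    · rw [add_zero]
      refine le_trans ?_ (card_linear_solutions_le (4 * (a * u₁)) (4 * (b * u₂)) (4 * (c * u₃))
        (-(a * u₁ * (2 * u₁ + 1) + b * u₂ * (2 * u₂ + 1) + c * u₃ * (2 * u₃ + 1))) ?_)
      · refine card_le_card_of_injOn (fun p => p.2) ?_ ?_
        · rintro ⟨⟨x, y, z⟩, x', y', z'⟩ hp
          simp only [mem_coe, mem_filter, mem_univ, mem_product, true_and, Prod.mk_sub_mk,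
            Prod.mk.injEq] at hp ⊢
          simp only [ternaryForm, hexagonal] at hp
          obtain ⟨hp, rfl, rfl, rfl⟩ := hp
          linear_combination hp
        · rintro ⟨p, q⟩ hp ⟨p', q'⟩ hp' hpp
          simp only [mem_coe, mem_filter] at hp hp' hpp
          subst hpp
          rw [sub_eq_iff_eq_add.1 hp.2, sub_eq_iff_eq_add.1 hp'.2]
      · rintro ⟨h1, h2, h3⟩
        simp only [mul_eq_zero, h4, ha, hb, hc, false_or] at h1 h2 h3
        exact hu (by simp [h1, h2, h3])
  refine (sum_le_sum fun u _ => hfib u).trans ?_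
  rw [sum_add_distrib, sum_const, card_univ, hcard3, sum_ite_eq']
  simp only [mem_univ, if_true, smul_eq_mul]
  apply le_of_eq; ring

lemma sum_numNonsing_ge (a b c : ℕ) (h2 : (2 : F) ≠ 0) (ha : (a : F) ≠ 0) (hb : (b : F) ≠ 0)
    (hc : (c : F) ≠ 0) :
    Fintype.card F ^ 3 ≤ ∑ r : F, numNonsing a b c r + 1 := by
  have h4 : (4 : F) ≠ 0 := by
    have : (4 : F) = 2 * 2 := by norm_num
    rw [this]; exact mul_ne_zero h2 h2
  have hcard3 : Fintype.card (F × F × F) = Fintype.card F ^ 3 := by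
    rw [Fintype.card_prod, Fintype.card_prod]; ring
  have hmaps : ∀ v ∈ ({v | ¬ IsSingular a b c v} : Finset (F × F × F)),
      ternaryForm a b c v ∈ (univ : Finset F) := fun _ _ => mem_univ _
  have h1 := card_eq_sum_card_fiberwise hmaps
  have h3 : ∑ r : F, numNonsing a b c r = #{v : F × F × F | ¬ IsSingular a b c v} := by
    rw [h1]
    refine sum_congr rfl fun r _ => ?_
    rw [numNonsing, filter_filter]
    congr 1
    ext v
    simp [and_comm]
  rw [h3, ← hcard3, ← card_univ,
    ← card_filter_add_card_filter_not (s := univ) (IsSingular (R := F) a b c), add_comm]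
  refine Nat.add_le_add_left (card_le_one.2 ?_) _
  rintro ⟨x, y, z⟩ hv ⟨x', y', z'⟩ hv'
  simp only [mem_filter, mem_univ, true_and, IsSingular, mul_eq_zero, ha, hb, hc, false_or]
    at hv hv'
  refine Prod.ext ?_ (Prod.ext ?_ ?_)
  · exact mul_left_cancel₀ h4 (by linear_combination hv.1 - hv'.1)
  · exact mul_left_cancel₀ h4 (by linear_combination hv.2.1 - hv'.2.1)
  · exact mul_left_cancel₀ h4 (by linear_combination hv.2.2 - hv'.2.2)

end FiniteField

/-! ### Existence of nonsingular solutions modulo a prime -/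

lemma exists_diagonal_of_ne_zero {F : Type*} [Field F] [Fintype F] (h2 : ringChar F ≠ 2)
    {A B C : F} (hA : A ≠ 0) (hB : B ≠ 0) (hC : C ≠ 0) (m : F) :
    ∃ X Y Z : F, A * X ^ 2 + B * Y ^ 2 + C * Z ^ 2 = m ∧ ¬ (A * X = 0 ∧ B * Y = 0 ∧ C * Z = 0) := by
  open Polynomial in
  obtain ⟨X, Y, h⟩ := FiniteField.exists_root_sum_quadratic
    (f := Polynomial.C A * X ^ 2 + Polynomial.C 0 * X + Polynomial.C 0)
    (g := Polynomial.C B * X ^ 2 + Polynomial.C 0 * X + Polynomial.C (C - m))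
    (degree_quadratic hA) (degree_quadratic hB) (FiniteField.odd_card_of_char_ne_two h2)
  refine ⟨X, Y, 1, ?_, fun h => hC (by simpa using h.2.2)⟩
  simp only [Polynomial.eval_add, Polynomial.eval_mul, Polynomial.eval_C, Polynomial.eval_pow,
    Polynomial.eval_X] at h
  linear_combination h

lemma exists_diagonal_of_neg_mul_eq_sq {F : Type*} [Field F] (h2 : (2 : F) ≠ 0)
    {A B s : F} (hA : A ≠ 0) (hB : B ≠ 0) (hs : -(A * B) = s ^ 2) (m : F) :
    ∃ X Y : F, A * X ^ 2 + B * Y ^ 2 = m ∧ ¬ (A * X = 0 ∧ B * Y = 0) := by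
  have hs0 : s ≠ 0 := by
    rintro rfl
    simp [hA, hB] at hs
  have hB' : B = -s ^ 2 / A := by
    field_simp
    linear_combination -hs
  refine ⟨(m / A + 1) / 2, (m / A - 1) * A / (2 * s), ?_, ?_⟩
  · rw [hB']
    field_simp
    ring
  · rintro ⟨h1, h3⟩
    simp only [mul_eq_zero, div_eq_zero_iff, hA, hB, hs0, h2, or_false, false_or] at h1 h3
    exact h2 (by linear_combination h1 - h3)

lemma numNonsing_pos_of_diagonal {F : Type*} [Field F] [Fintype F] [DecidableEq F]
    (h2 : (2 : F) ≠ 0) {a b c : ℕ} {r : F}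
    (h : ∃ X Y Z : F, a * X ^ 2 + b * Y ^ 2 + c * Z ^ 2 = 8 * r + a + b + c ∧
      ¬ (a * X = 0 ∧ b * Y = 0 ∧ c * Z = 0)) : 0 < numNonsing a b c r := by
  have h4 : (4 : F) = 2 * 2 := by norm_num
  have h8 : (8 : F) = 2 * 2 * 2 := by norm_num
  obtain ⟨X, Y, Z, h, hns⟩ := h
  have hx : ∀ X : F, 4 * ((X - 1) / 4) + 1 = X := by
    intro X
    rw [h4]
    field_simp
    ring
  have h80 : (8 : F) ≠ 0 := by rw [h8]; simp [h2]
  refine card_pos.2 ⟨((X - 1) / 4, (Y - 1) / 4, (Z - 1) / 4), ?_⟩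
  simp only [mem_filter, mem_univ, true_and]
  refine ⟨?_, by simpa only [IsSingular, hx] using hns⟩
  refine mul_left_cancel₀ h80 ?_
  have hhex : ∀ X : F, 8 * hexagonal ((X - 1) / 4) + 1 = X ^ 2 := by
    intro X
    simp only [hexagonal]
    linear_combination (4 * ((X - 1) / 4) + 1 + X) * hx X
  simp only [ternaryForm]
  linear_combination a * hhex X + b * hhex Y + c * hhex Z + h

/-- The local conditions at a prime `p` under which every residue class modulo `p` has a
nonsingular representation. -/
structure LocallySolvable (a b c p : ℕ) : Prop where
  not_dvd_all : ¬ (p ∣ a ∧ p ∣ b ∧ p ∣ c)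
  left : p ≠ 2 → p ∣ a → ∃ s : ZMod p, -((b : ZMod p) * c) = s ^ 2 ∧ s ≠ 0
  middle : p ≠ 2 → p ∣ b → ∃ s : ZMod p, -((a : ZMod p) * c) = s ^ 2 ∧ s ≠ 0
  right : p ≠ 2 → p ∣ c → ∃ s : ZMod p, -((a : ZMod p) * b) = s ^ 2 ∧ s ≠ 0

lemma exists_sq_of_isQR {m p : ℕ} (hm : 0 < m) (hp : p.Prime) {d : ℤ} (h : isQR d (oddPart m))
    (hp2 : p ≠ 2) (hpm : p ∣ m) : ∃ s : ZMod p, (d : ZMod p) = s ^ 2 ∧ s ≠ 0 := by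
  have := Fact.mk hp
  have h1 : legendreSym p d = 1 := h p hp ((prime_dvd_oddPart_iff hm hp).2 ⟨hp2, hpm⟩)
  have h0 : (d : ZMod p) ≠ 0 := by
    intro h0
    rw [(legendreSym.eq_zero_iff p d).2 h0] at h1
    exact zero_ne_one h1
  obtain ⟨s, hs⟩ := (legendreSym.eq_one_iff p h0).1 h1
  refine ⟨s, by rw [hs, pow_two], ?_⟩
  rintro rfl
  exact h0 (by simpa using hs)

lemma locallySolvable_of_isQR {a b c : ℕ} (ha : 0 < a) (hb : 0 < b) (hc : 0 < c)
    (hgcd : Nat.gcd a (Nat.gcd b c) = 1) (hA : isQR (-((b : ℤ) * c)) (oddPart a))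
    (hB : isQR (-((a : ℤ) * c)) (oddPart b)) (hC : isQR (-((a : ℤ) * b)) (oddPart c))
    {p : ℕ} (hp : p.Prime) : LocallySolvable a b c p where
  not_dvd_all := by
    rintro ⟨h1, h2, h3⟩
    have := Nat.dvd_gcd h1 (Nat.dvd_gcd h2 h3)
    rw [hgcd] at this
    exact hp.one_lt.ne' (Nat.dvd_one.1 this)
  left h2 h := by simpa using exists_sq_of_isQR ha hp hA h2 h
  middle h2 h := by simpa using exists_sq_of_isQR hb hp hB h2 h
  right h2 h := by simpa using exists_sq_of_isQR hc hp hC h2 h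

lemma exists_nonsing_zmod_two : ∀ A B C r : ZMod 2, ¬ (A = 0 ∧ B = 0 ∧ C = 0) →
    ∃ x y z : ZMod 2, (A * (2 * x ^ 2 + x) + B * (2 * y ^ 2 + y) + C * (2 * z ^ 2 + z) = r) ∧
      ¬ (A * (4 * x + 1) = 0 ∧ B * (4 * y + 1) = 0 ∧ C * (4 * z + 1) = 0) := by
  decide

lemma numNonsing_pos {a b c p : ℕ} [hp : Fact p.Prime] (h : LocallySolvable a b c p)
    (r : ZMod p) : 0 < numNonsing a b c r := by
  have hzero : ∀ m : ℕ, (m : ZMod p) = 0 ↔ p ∣ m := fun m => ZMod.natCast_eq_zero_iff m p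
  by_cases hp2 : p = 2
  · subst hp2
    obtain ⟨x, y, z, h1, h2⟩ := exists_nonsing_zmod_two a b c r (by
      simp only [hzero]
      exact h.not_dvd_all)
    refine card_pos.2 ⟨(x, y, z), ?_⟩
    simp only [mem_filter, mem_univ, true_and]
    exact ⟨h1, h2⟩
  · have h2 : (2 : ZMod p) ≠ 0 := by
      intro h0
      have : ((2 : ℕ) : ZMod p) = 0 := by exact_mod_cast h0
      rw [hzero] at this
      exact hp2 ((Nat.prime_dvd_prime_iff_eq hp.out Nat.prime_two).1 this)
    have hmul : ∀ {x y s : ZMod p}, -(x * y) = s ^ 2 → s ≠ 0 → x ≠ 0 ∧ y ≠ 0 := by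
      intro x y s h hs
      constructor <;> rintro rfl <;> exact hs (by simpa using h.symm)
    apply numNonsing_pos_of_diagonal h2
    by_cases ha : p ∣ a
    · obtain ⟨s, hs, hs0⟩ := h.left hp2 ha
      obtain ⟨Y, Z, h1, h3⟩ := exists_diagonal_of_neg_mul_eq_sq h2 (hmul hs hs0).1 (hmul hs hs0).2
        hs (8 * r + a + b + c)
      refine ⟨0, Y, Z, by linear_combination h1, fun h => h3 h.2⟩
    by_cases hb : p ∣ b
    · obtain ⟨s, hs, hs0⟩ := h.middle hp2 hb
      obtain ⟨X, Z, h1, h3⟩ := exists_diagonal_of_neg_mul_eq_sq h2 (hmul hs hs0).1 (hmul hs hs0).2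
        hs (8 * r + a + b + c)
      refine ⟨X, 0, Z, by linear_combination h1, fun h => h3 ⟨h.1, h.2.2⟩⟩
    by_cases hc : p ∣ c
    · obtain ⟨s, hs, hs0⟩ := h.right hp2 hc
      obtain ⟨X, Y, h1, h3⟩ := exists_diagonal_of_neg_mul_eq_sq h2 (hmul hs hs0).1 (hmul hs hs0).2
        hs (8 * r + a + b + c)
      refine ⟨X, Y, 0, by linear_combination h1, fun h => h3 ⟨h.1, h.2.1⟩⟩
    · exact exists_diagonal_of_ne_zero (by rwa [ZMod.ringChar_zmod_n])
        (by rwa [Ne, hzero]) (by rwa [Ne, hzero]) (by rwa [Ne, hzero]) _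

/-! ### A second moment bound for products of independent functions -/

lemma one_sub_sum_le_prod {ι : Type*} (s : Finset ι) (x δ : ι → ℝ)
    (hδ : ∀ i ∈ s, 0 ≤ δ i ∧ δ i ≤ 1) (hx : ∀ i ∈ s, 1 - δ i ≤ x i) :
    1 - ∑ i ∈ s, δ i ≤ ∏ i ∈ s, x i := by
  classical
  induction s using Finset.induction_on with
  | empty => simp
  | insert i s hi ih =>
    rw [sum_insert hi, prod_insert hi]
    have ih' := ih (fun j hj => hδ j (mem_insert_of_mem hj)) fun j hj => hx j (mem_insert_of_mem hj)
    have hi0 := hδ i (mem_insert_self i s)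
    have hxi := hx i (mem_insert_self i s)
    have hP : 0 ≤ ∏ j ∈ s, x j := prod_nonneg fun j hj => by
      linarith [hx j (mem_insert_of_mem hj), (hδ j (mem_insert_of_mem hj)).2]
    have hS : 0 ≤ ∑ j ∈ s, δ j := sum_nonneg fun j hj => (hδ j (mem_insert_of_mem hj)).1
    nlinarith [mul_nonneg hi0.1 hS, mul_le_mul_of_nonneg_right hxi hP,
      mul_le_mul_of_nonneg_left ih' (sub_nonneg.2 hi0.2)]

lemma prod_le_exp_sum {ι : Type*} (s : Finset ι) (x δ : ι → ℝ)
    (hx0 : ∀ i ∈ s, 0 ≤ x i) (hx : ∀ i ∈ s, x i ≤ 1 + δ i) :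
    ∏ i ∈ s, x i ≤ Real.exp (∑ i ∈ s, δ i) := by
  rw [Real.exp_sum]
  exact prod_le_prod hx0 fun i hi => (hx i hi).trans (by linarith [Real.add_one_le_exp (δ i)])

/-- If the factors `g i` have mean close to `1` and second moment close to `1`, then the
product `∏ i, g i (x i)` is rarely smaller than `1 / 2`. -/
lemma card_prod_lt_half_le {ι : Type*} [Fintype ι] [DecidableEq ι] {X : ι → Type*}
    [∀ i, Fintype (X i)] [∀ i, DecidableEq (X i)] (g : ∀ i, X i → ℝ) (δ : ι → ℝ)
    (hδ : ∀ i, 0 ≤ δ i ∧ δ i ≤ 1)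
    (h1 : ∀ i, (1 - δ i) * Fintype.card (X i) ≤ ∑ x, g i x)
    (h2 : ∀ i, ∑ x, g i x ^ 2 ≤ (1 + δ i) * Fintype.card (X i)) (hs : ∑ i, δ i ≤ 1) :
    (#{x : ∀ i, X i | ∏ i, g i (x i) < 1 / 2} : ℝ) ≤
      16 * (∑ i, δ i) * ∏ i, (Fintype.card (X i) : ℝ) := by
  by_cases hX : ∀ i, 0 < Fintype.card (X i)
  swap
  · push Not at hX
    obtain ⟨i, hi⟩ := hX
    have he : IsEmpty (X i) := Fintype.card_eq_zero_iff.1 (by omega)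
    have he' : IsEmpty (∀ i, X i) := ⟨fun f => he.elim (f i)⟩
    have : ({x : ∀ i, X i | ∏ i, g i (x i) < 1 / 2} : Finset _) = ∅ := eq_empty_of_isEmpty _
    rw [this, card_empty, Nat.cast_zero]
    exact mul_nonneg (mul_nonneg (by norm_num) (sum_nonneg fun i _ => (hδ i).1))
      (prod_nonneg fun _ _ => by positivity)
  have hX' : ∀ i, (0 : ℝ) < Fintype.card (X i) := fun i => by exact_mod_cast hX i
  set V : ℝ := ∏ i, (Fintype.card (X i) : ℝ) with hV
  have hV0 : 0 < V := prod_pos fun i _ => hX' i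
  set s := ∑ i, δ i with hs_def
  have hs0 : 0 ≤ s := sum_nonneg fun i _ => (hδ i).1
  have hM1 : (1 - s) * V ≤ ∑ x : ∀ i, X i, ∏ i, g i (x i) := by
    rw [← Fintype.prod_sum]
    have : ∏ i, ∑ j, g i j = (∏ i, (∑ j, g i j) / Fintype.card (X i)) * V := by
      rw [hV, ← prod_mul_distrib]
      exact prod_congr rfl fun i _ => (div_mul_cancel₀ _ (hX' i).ne').symm
    rw [this]
    refine mul_le_mul_of_nonneg_right (one_sub_sum_le_prod univ _ δ (fun i _ => hδ i) ?_) hV0.le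
    intro i _
    rw [le_div_iff₀ (hX' i)]
    exact h1 i
  have hM2 : ∑ x : ∀ i, X i, (∏ i, g i (x i)) ^ 2 ≤ Real.exp s * V := by
    simp_rw [← prod_pow]
    rw [← Fintype.prod_sum (fun i x => g i x ^ 2)]
    have : ∏ i, ∑ j, g i j ^ 2 = (∏ i, (∑ j, g i j ^ 2) / Fintype.card (X i)) * V := by
      rw [hV, ← prod_mul_distrib]
      exact prod_congr rfl fun i _ => (div_mul_cancel₀ _ (hX' i).ne').symm
    rw [this]
    refine mul_le_mul_of_nonneg_right (prod_le_exp_sum univ _ δ ?_ ?_) hV0.le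
    · exact fun i _ => div_nonneg (sum_nonneg fun _ _ => sq_nonneg _) (hX' i).le
    · intro i _
      rw [div_le_iff₀ (hX' i)]
      exact h2 i
  have hexp : Real.exp s ≤ 1 + 2 * s := by
    have := Real.abs_exp_sub_one_le (x := s) (by rwa [abs_of_nonneg hs0])
    rw [abs_of_nonneg hs0] at this
    linarith [le_abs_self (Real.exp s - 1)]
  have hvar : ∑ x : ∀ i, X i, (∏ i, g i (x i) - 1) ^ 2 ≤ 4 * s * V := by
    have : ∑ x : ∀ i, X i, (∏ i, g i (x i) - 1) ^ 2 = ∑ x : ∀ i, X i, (∏ i, g i (x i)) ^ 2 -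
        2 * ∑ x : ∀ i, X i, ∏ i, g i (x i) + V := by
      have hcard : V = ∑ _x : ∀ i, X i, (1 : ℝ) := by
        rw [sum_const, card_univ, Fintype.card_pi, nsmul_eq_mul, mul_one, Nat.cast_prod]
      rw [hcard, mul_sum, ← sum_sub_distrib, ← sum_add_distrib]
      exact sum_congr rfl fun x _ => by ring
    rw [this]
    nlinarith [mul_le_mul_of_nonneg_right hexp hV0.le]
  have hmarkov : (#{x : ∀ i, X i | ∏ i, g i (x i) < 1 / 2} : ℝ) * (1 / 4) ≤
      ∑ x : ∀ i, X i, (∏ i, g i (x i) - 1) ^ 2 := by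
    rw [← nsmul_eq_mul, ← sum_const]
    refine (sum_le_sum fun x hx => ?_).trans
      (sum_le_sum_of_subset_of_nonneg (filter_subset _ _) fun _ _ _ => sq_nonneg _)
    simp only [mem_filter, mem_univ, true_and] at hx
    nlinarith
  linarith

/-! ### Reduction modulo prime powers -/

section PrimePower

variable {p e : ℕ} [hp : Fact p.Prime] (he : e ≠ 0)

/-- Reduction from `ZMod (p ^ e)` to `ZMod p`. -/
def reduceMod : ZMod (p ^ e) →+* ZMod p := ZMod.castHom (dvd_pow_self p he) (ZMod p)

instance neZero_prime_pow : NeZero (p ^ e) := ⟨pow_ne_zero _ hp.out.ne_zero⟩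

lemma isUnit_of_reduceMod_ne_zero (x : ZMod (p ^ e)) (hx : reduceMod he x ≠ 0) : IsUnit x := by
  rw [← ZMod.natCast_zmod_val x] at hx ⊢
  rw [map_natCast, Ne, ZMod.natCast_eq_zero_iff] at hx
  rw [ZMod.isUnit_iff_coprime]
  exact (((Nat.Prime.coprime_iff_not_dvd hp.out).2 hx).symm).pow_right e

lemma reduceMod_surjective : Function.Surjective (reduceMod (p := p) he) := by
  intro s
  refine ⟨(s.val : ZMod (p ^ e)), ?_⟩
  rw [map_natCast, ZMod.natCast_zmod_val]

lemma card_fiber_reduceMod (s : ZMod p) :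
    #{x : ZMod (p ^ e) | reduceMod he x = s} = p ^ (e - 1) := by
  have hconst : ∀ t : ZMod p, #{x : ZMod (p ^ e) | reduceMod he x = t} =
      #{x : ZMod (p ^ e) | reduceMod he x = s} := fun t =>
    AddMonoidHom.card_fiber_eq_of_mem_range (reduceMod he) (reduceMod_surjective he t)
      (reduceMod_surjective he s)
  have htot := card_eq_sum_card_fiberwise (s := (univ : Finset (ZMod (p ^ e))))
    (t := (univ : Finset (ZMod p))) (f := reduceMod he) fun _ _ => mem_univ _
  rw [sum_congr rfl fun t _ => hconst t, sum_const, card_univ, card_univ, ZMod.card, ZMod.card,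
    smul_eq_mul] at htot
  refine Nat.eq_of_mul_eq_mul_left hp.out.pos (htot.symm.trans ?_)
  rw [mul_comm, ← pow_succ, Nat.sub_add_cancel (Nat.one_le_iff_ne_zero.2 he)]

lemma sum_comp_reduceMod (f : ZMod p → ℝ) :
    ∑ x : ZMod (p ^ e), f (reduceMod he x) = p ^ (e - 1) * ∑ s, f s := by
  rw [← sum_fiberwise_of_maps_to (s := univ) (t := univ) (g := reduceMod he) fun _ _ => mem_univ _,
    mul_sum]
  refine sum_congr rfl fun s _ => ?_
  rw [sum_congr rfl (g := fun _ => f s) fun x hx => by rw [(mem_filter.1 hx).2], sum_const,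
    card_fiber_reduceMod, nsmul_eq_mul, Nat.cast_pow]

lemma numNonsing_div_le (a b c : ℕ) (r : ZMod (p ^ e)) :
    (numNonsing a b c (reduceMod he r) : ℝ) / p ^ 2 * ((p ^ e : ℕ) : ℝ) ^ 2 ≤
      numSol a b c r := by
  have h := sq_mul_numNonsing_le_numSol (reduceMod he) (isUnit_of_reduceMod_ne_zero he)
    (card_fiber_reduceMod he) a b c r
  have hp0 : (p : ℝ) ≠ 0 := by exact_mod_cast hp.out.ne_zero
  have hpe : ((p ^ e : ℕ) : ℝ) = p * (p : ℝ) ^ (e - 1) := by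
    rw [Nat.cast_pow, ← pow_succ', Nat.sub_add_cancel (Nat.one_le_iff_ne_zero.2 he)]
  have h' : ((p : ℝ) ^ (e - 1)) ^ 2 * numNonsing a b c (reduceMod he r) ≤ numSol a b c r := by
    exact_mod_cast h
  refine le_of_eq_of_le ?_ h'
  rw [hpe]
  field_simp

end PrimePower

/-! ### Most residue classes have many representations -/

lemma sum_numNonsing_div_ge (a b c : ℕ) {p e : ℕ} [hp : Fact p.Prime] (he : e ≠ 0)
    (h2 : ¬ p ∣ 2) (ha : ¬ p ∣ a) (hb : ¬ p ∣ b) (hc : ¬ p ∣ c) :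
    (1 - 1 / (p : ℝ) ^ 2) * Fintype.card (ZMod (p ^ e)) ≤
      ∑ x : ZMod (p ^ e), (numNonsing a b c (reduceMod he x) : ℝ) / p ^ 2 := by
  rw [sum_comp_reduceMod he fun s => (numNonsing a b c s : ℝ) / p ^ 2, ← sum_div, ZMod.card]
  have hcast : ∀ m : ℕ, ¬ p ∣ m → (m : ZMod p) ≠ 0 := fun m hm => by
    rwa [Ne, ZMod.natCast_eq_zero_iff]
  have h := sum_numNonsing_ge (F := ZMod p) a b c (by exact_mod_cast hcast 2 h2) (hcast a ha)
    (hcast b hb) (hcast c hc)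
  rw [ZMod.card] at h
  have h' : (p : ℝ) ^ 3 ≤ ∑ s : ZMod p, (numNonsing a b c s : ℝ) + 1 := by exact_mod_cast h
  have hp1 : (1 : ℝ) ≤ p := by exact_mod_cast hp.out.one_le
  have hpe : ((p ^ e : ℕ) : ℝ) = p * (p : ℝ) ^ (e - 1) := by
    rw [Nat.cast_pow, ← pow_succ', Nat.sub_add_cancel (Nat.one_le_iff_ne_zero.2 he)]
  rw [hpe]
  have hq : (0 : ℝ) < (p : ℝ) ^ (e - 1) := by positivity
  have h3 : (1 - 1 / (p : ℝ) ^ 2) * p ≤ (∑ s : ZMod p, (numNonsing a b c s : ℝ)) / p ^ 2 := by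
    rw [le_div_iff₀ (by positivity)]
    have : (1 - 1 / (p : ℝ) ^ 2) * p * p ^ 2 = p ^ 3 - p := by field_simp
    rw [this]
    linarith
  calc _ = (p : ℝ) ^ (e - 1) * ((1 - 1 / (p : ℝ) ^ 2) * p) := by ring
    _ ≤ _ := mul_le_mul_of_nonneg_left h3 hq.le

lemma sum_numNonsing_div_sq_le (a b c : ℕ) {p e : ℕ} [hp : Fact p.Prime] (he : e ≠ 0)
    (h2 : ¬ p ∣ 2) (ha : ¬ p ∣ a) (hb : ¬ p ∣ b) (hc : ¬ p ∣ c) :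
    ∑ x : ZMod (p ^ e), ((numNonsing a b c (reduceMod he x) : ℝ) / p ^ 2) ^ 2 ≤
      (1 + 1 / (p : ℝ) ^ 2) * Fintype.card (ZMod (p ^ e)) := by
  rw [sum_comp_reduceMod he fun s => ((numNonsing a b c s : ℝ) / p ^ 2) ^ 2, ZMod.card]
  have hcast : ∀ m : ℕ, ¬ p ∣ m → (m : ZMod p) ≠ 0 := fun m hm => by
    rwa [Ne, ZMod.natCast_eq_zero_iff]
  have h := (sum_le_sum fun s _ => Nat.pow_le_pow_left (numNonsing_le_numSol a b c s) 2).trans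
    (sum_numSol_sq_le (F := ZMod p) a b c (by exact_mod_cast hcast 2 h2) (hcast a ha)
    (hcast b hb) (hcast c hc))
  rw [ZMod.card] at h
  have h' : ∑ s : ZMod p, (numNonsing a b c s : ℝ) ^ 2 ≤ (p : ℝ) ^ 5 + (p : ℝ) ^ 3 := by
    exact_mod_cast h
  have hp1 : (1 : ℝ) ≤ p := by exact_mod_cast hp.out.one_le
  have hpe : ((p ^ e : ℕ) : ℝ) = p * (p : ℝ) ^ (e - 1) := by
    rw [Nat.cast_pow, ← pow_succ', Nat.sub_add_cancel (Nat.one_le_iff_ne_zero.2 he)]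
  rw [hpe]
  have hq : (0 : ℝ) < (p : ℝ) ^ (e - 1) := by positivity
  have h3 : ∑ s : ZMod p, ((numNonsing a b c s : ℝ) / p ^ 2) ^ 2 ≤ (1 + 1 / (p : ℝ) ^ 2) * p := by
    simp_rw [div_pow]
    rw [← sum_div, div_le_iff₀ (by positivity)]
    have : (1 + 1 / (p : ℝ) ^ 2) * p * (p ^ 2) ^ 2 = p ^ 5 + p ^ 3 := by field_simp
    rw [this]
    exact h'
  calc _ ≤ (p : ℝ) ^ (e - 1) * ((1 + 1 / (p : ℝ) ^ 2) * p) := mul_le_mul_of_nonneg_left h3 hq.le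
    _ = _ := by ring

lemma prod_inv_sq_le_prod_ite {ι : Type*} [Fintype ι] (p : ι → ℕ) (hp : ∀ i, 0 < p i)
    (hinj : Function.Injective p) (w : ℕ) :
    ∏ n ∈ Icc 1 w, (1 / (n : ℝ) ^ 2) ≤ ∏ i, if p i ≤ w then 1 / (p i : ℝ) ^ 2 else 1 := by
  classical
  rw [← prod_filter]
  rw [← prod_image (s := ({i | p i ≤ w} : Finset ι)) (g := p) (f := fun n : ℕ => 1 / (n : ℝ) ^ 2)
    fun x _ y _ h => hinj h]
  have hsub : ({i | p i ≤ w} : Finset ι).image p ⊆ Icc 1 w := by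
    intro n hn
    obtain ⟨i, hi, rfl⟩ := mem_image.1 hn
    exact mem_Icc.2 ⟨hp i, (mem_filter.1 hi).2⟩
  rw [← prod_sdiff hsub]
  refine mul_le_of_le_one_left (prod_nonneg fun _ _ => by positivity) ?_
  refine prod_le_one (fun _ _ => by positivity) fun n hn => ?_
  have h1 : (1 : ℝ) ≤ n := by exact_mod_cast (mem_Icc.1 (mem_sdiff.1 hn).1).1
  rw [div_le_one (by positivity)]
  exact one_le_pow₀ h1

lemma sum_ite_inv_sq_le {ι : Type*} [Fintype ι] (p : ι → ℕ)
    (hinj : Function.Injective p) (w : ℕ) :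
    (∑ i, if p i ≤ w then 0 else 1 / (p i : ℝ) ^ 2) ≤ 2 / ((w : ℝ) + 1) := by
  classical
  have : (∑ i, if p i ≤ w then 0 else 1 / (p i : ℝ) ^ 2) =
      ∑ i, if w < p i then 1 / (p i : ℝ) ^ 2 else 0 :=
    sum_congr rfl fun i _ => by
      by_cases h : p i ≤ w
      · rw [if_pos h, if_neg (not_lt.2 h)]
      · rw [if_neg h, if_pos (not_le.1 h)]
  rw [this, ← sum_filter, ← sum_image (s := ({i | w < p i} : Finset ι)) (g := p)
    (f := fun n : ℕ => 1 / (n : ℝ) ^ 2) fun x _ y _ h => hinj h]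
  refine le_trans ?_ (sum_Ioo_inv_sq_le w (univ.sup p + 1))
  simp only [one_div]
  refine sum_le_sum_of_subset_of_nonneg ?_ fun _ _ _ => by positivity
  intro n hn
  obtain ⟨i, hi, rfl⟩ := mem_image.1 hn
  exact mem_Ioo.2 ⟨(mem_filter.1 hi).2, Nat.lt_succ_of_le (le_sup (mem_univ i))⟩

lemma card_numSol_lt_le {a b c : ℕ} (hloc : ∀ p : ℕ, p.Prime → LocallySolvable a b c p)
    (ha : 0 < a) (hb : 0 < b) (hc : 0 < c) {w : ℕ} (hw : 2 * a * b * c ≤ w)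
    {ι : Type*} [Fintype ι] [DecidableEq ι] (p e : ι → ℕ) (hp : ∀ i, (p i).Prime)
    (hinj : Function.Injective p) (he : ∀ i, e i ≠ 0) {W : ℕ} [NeZero W]
    (hW : ∏ i, p i ^ e i = W) :
    (#{r : ZMod W | (numSol a b c r : ℝ) <
      (1 / 2 * ∏ n ∈ Icc 1 w, (1 / (n : ℝ) ^ 2)) * W ^ 2} : ℝ) ≤ 16 * (2 / (w + 1)) * W := by
  subst hW
  have hfact : ∀ i, Fact (p i).Prime := fun i => ⟨hp i⟩
  have hbig : ∀ i, ¬ p i ≤ w → ∀ m, m ∣ 2 * a * b * c → ¬ p i ∣ m := by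
    intro i hi m hm hdvd
    exact hi ((Nat.le_of_dvd (by positivity) (hdvd.trans hm)).trans hw)
  have h2 : 2 ∣ 2 * a * b * c := ⟨a * b * c, by ring⟩
  have ha' : a ∣ 2 * a * b * c := ⟨2 * b * c, by ring⟩
  have hb' : b ∣ 2 * a * b * c := ⟨2 * a * c, by ring⟩
  have hc' : c ∣ 2 * a * b * c := ⟨2 * a * b, by ring⟩
  have hcop : Pairwise (Function.onFun Nat.Coprime fun i => p i ^ e i) := fun i j hij =>
    Nat.Coprime.pow _ _ ((Nat.coprime_primes (hp i) (hp j)).2 fun h => hij (hinj h))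
  set E := ZMod.prodEquivPi (fun i => p i ^ e i) hcop with hE
  set g : ∀ i, ZMod (p i ^ e i) → ℝ := fun i x =>
    if p i ≤ w then 1 else (numNonsing a b c (reduceMod (he i) x) : ℝ) / p i ^ 2 with hg
  set δ : ι → ℝ := fun i => if p i ≤ w then 0 else 1 / (p i : ℝ) ^ 2 with hδ
  set κ : ι → ℝ := fun i => if p i ≤ w then 1 / (p i : ℝ) ^ 2 else 1 with hκ
  have hp1 : ∀ i, (1 : ℝ) ≤ p i := fun i => by exact_mod_cast (hp i).one_le
  have hg0 : ∀ i x, 0 ≤ g i x := by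
    intro i x
    simp only [hg]
    split_ifs <;> positivity
  have hκ0 : ∀ i, 0 ≤ κ i := by
    intro i
    simp only [hκ]
    split_ifs <;> positivity
  have hpoint : ∀ i x, κ i * g i x * ((p i ^ e i : ℕ) : ℝ) ^ 2 ≤ numSol a b c x := by
    intro i x
    refine le_trans ?_ (numNonsing_div_le (he i) a b c x)
    refine mul_le_mul_of_nonneg_right ?_ (by positivity)
    simp only [hκ, hg]
    split_ifs
    · have h1 : (1 : ℝ) ≤ numNonsing a b c (reduceMod (he i) x) := by
        exact_mod_cast numNonsing_pos (hloc (p i) (hp i)) (reduceMod (he i) x)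
      rw [mul_one]
      gcongr
    · rw [one_mul]
  have hδs : ∑ i, δ i ≤ 2 / (w + 1) := sum_ite_inv_sq_le p hinj w
  have hw2 : 2 ≤ w := le_trans (Nat.le_of_dvd (by positivity) h2) hw
  have hw1 : (2 : ℝ) / (w + 1) ≤ 1 := by
    rw [div_le_one (by positivity)]
    have : (2 : ℝ) ≤ w := by exact_mod_cast hw2
    linarith
  have hcheb := card_prod_lt_half_le g δ ?_ ?_ ?_ (hδs.trans hw1)
  · have hcards : ∏ i, (Fintype.card (ZMod (p i ^ e i)) : ℝ) = ((∏ i, p i ^ e i : ℕ) : ℝ) := by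
      rw [Nat.cast_prod]
      exact prod_congr rfl fun i _ => by rw [ZMod.card]
    rw [hcards] at hcheb
    refine le_trans ?_ (hcheb.trans (by gcongr))
    refine Nat.cast_le.2 ?_
    refine card_le_card_of_injOn E ?_ E.injective.injOn
    intro r hr
    simp only [mem_coe, mem_filter, mem_univ, true_and] at hr ⊢
    by_contra hlt
    rw [not_lt] at hlt
    refine absurd hr (not_lt.2 ?_)
    rw [← numSol_ringEquiv E, numSol_pi, Nat.cast_prod (fun i => numSol a b c (E r i))]
    refine le_trans ?_ (prod_le_prod (fun i _ => ?_) fun i _ => hpoint i (E r i))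
    · rw [prod_mul_distrib, prod_mul_distrib, prod_pow, ← Nat.cast_prod]
      refine mul_le_mul_of_nonneg_right ?_ (sq_nonneg _)
      rw [mul_comm (1 / 2 : ℝ)]
      have hhalf : (0 : ℝ) ≤ 1 / 2 := by norm_num
      exact mul_le_mul (prod_inv_sq_le_prod_ite p (fun i => (hp i).pos) hinj w) hlt hhalf
        (prod_nonneg fun i _ => hκ0 i)
    · exact mul_nonneg (mul_nonneg (hκ0 i) (hg0 i _)) (by positivity)
  · intro i
    simp only [hδ]
    split_ifs
    · norm_num
    · refine ⟨by positivity, ?_⟩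
      rw [div_le_one (by have := hp1 i; positivity)]
      exact one_le_pow₀ (hp1 i)
  · intro i
    simp only [hδ, hg]
    split_ifs with h
    · simp
    · exact sum_numNonsing_div_ge a b c (he i) (hbig i h _ h2) (hbig i h _ ha') (hbig i h _ hb')
        (hbig i h _ hc')
  · intro i
    simp only [hδ, hg]
    split_ifs with h
    · simp
    · exact sum_numNonsing_div_sq_le a b c (he i) (hbig i h _ h2) (hbig i h _ ha') (hbig i h _ hb')
        (hbig i h _ hc')

/-- For every `η > 0` there is `c₀ > 0` such that, uniformly in `W`, all but `η W` of the residue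
classes `r` modulo `W` have at least `c₀ W²` representations modulo `W`. -/
lemma exists_local_density {a b c : ℕ} (hloc : ∀ p : ℕ, p.Prime → LocallySolvable a b c p)
    (ha : 0 < a) (hb : 0 < b) (hc : 0 < c) {η : ℝ} (hη : 0 < η) :
    ∃ c₀ > 0, ∀ (W : ℕ) [NeZero W],
      (#{r : ZMod W | (numSol a b c r : ℝ) < c₀ * W ^ 2} : ℝ) ≤ η * W := by
  obtain ⟨m, hm⟩ := exists_nat_gt (32 / η)
  set w := max m (2 * a * b * c) with hw
  refine ⟨1 / 2 * ∏ n ∈ Icc 1 w, (1 / (n : ℝ) ^ 2), ?_, ?_⟩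
  · refine mul_pos (by norm_num) (prod_pos fun n hn => ?_)
    have : (0 : ℝ) < n := by exact_mod_cast (mem_Icc.1 hn).1
    positivity
  · intro W _
    refine (card_numSol_lt_le hloc ha hb hc (w := w) (le_max_right _ _)
      (fun q : W.primeFactors => (q : ℕ)) (fun q => W.factorization q)
      (fun q => Nat.prime_of_mem_primeFactors q.2) Subtype.val_injective ?_ ?_).trans ?_
    · exact fun q => Finsupp.mem_support_iff.1 (by rw [Nat.support_factorization]; exact q.2)
    · rw [prod_coe_sort W.primeFactors fun q => q ^ W.factorization q,
        ← Nat.prod_factorization_eq_prod_primeFactors (fun q k => q ^ k),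
        Nat.prod_factorization_pow_eq_self (NeZero.ne W)]
    · refine mul_le_mul_of_nonneg_right ?_ (by positivity)
      have hmw : (m : ℝ) ≤ w := by exact_mod_cast le_max_left _ _
      rw [← mul_div_assoc, div_le_iff₀ (by positivity)]
      rw [div_lt_iff₀ hη] at hm
      nlinarith

/-! ### Small solutions of linear equations -/

lemma exists_short_congruence (x y : ℤ) {M : ℕ} (hM : 0 < M) :
    ∃ p q : ℤ, ¬ (p = 0 ∧ q = 0) ∧ p ^ 2 ≤ M ∧ q ^ 2 ≤ M ∧ (M : ℤ) ∣ x * p + y * q := by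
  have : NeZero M := ⟨hM.ne'⟩
  set s := Nat.sqrt M with hs
  have hcard : #(univ : Finset (ZMod M)) < #(range (s + 1) ×ˢ range (s + 1)) := by
    rw [card_univ, ZMod.card, card_product, card_range]
    exact Nat.lt_succ_sqrt M
  obtain ⟨⟨a, b⟩, hab, ⟨c, d⟩, hcd, hne, heq⟩ := exists_ne_map_eq_of_card_lt_of_maps_to hcard
    (f := fun v : ℕ × ℕ => ((x * v.1 + y * v.2 : ℤ) : ZMod M)) fun _ _ => mem_univ _
  simp only [mem_product, mem_range] at hab hcd
  have hsq : ∀ i j : ℕ, i < s + 1 → j < s + 1 → ((i : ℤ) - j) ^ 2 ≤ M := by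
    intro i j hi hj
    have h1 : (s : ℤ) * s ≤ M := by exact_mod_cast Nat.sqrt_le M
    have h2 : |(i : ℤ) - j| ≤ s := by
      rw [abs_le]; constructor <;> omega
    calc ((i : ℤ) - j) ^ 2 = |(i : ℤ) - j| ^ 2 := (sq_abs _).symm
      _ ≤ (s : ℤ) ^ 2 := pow_le_pow_left₀ (abs_nonneg _) h2 2
      _ ≤ M := by rw [pow_two]; exact h1
  refine ⟨(a : ℤ) - c, (b : ℤ) - d, ?_, hsq _ _ hab.1 hcd.1, hsq _ _ hab.2 hcd.2, ?_⟩
  · rintro ⟨h1, h2⟩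
    apply hne
    ext <;> simp only <;> omega
  · rw [← ZMod.intCast_zmod_eq_zero_iff_dvd]
    have := sub_eq_zero.2 heq
    rw [← Int.cast_sub] at this
    rw [← this]
    congr 1
    ring

lemma exists_bezout_three (x y z : ℤ) :
    ∃ p q r : ℤ, x * p + y * q + z * r = Int.gcd x (Int.gcd y z) := by
  have h1 := Int.gcd_eq_gcd_ab y z
  have h2 := Int.gcd_eq_gcd_ab x (Int.gcd y z)
  refine ⟨Int.gcdA x (Int.gcd y z), Int.gcdA y z * Int.gcdB x (Int.gcd y z),
    Int.gcdB y z * Int.gcdB x (Int.gcd y z), ?_⟩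
  rw [h2]
  linear_combination (-Int.gcdB x (Int.gcd y z)) * h1

lemma exists_primitive_multiple (x y z : ℤ) (hne : ¬ (x = 0 ∧ y = 0 ∧ z = 0)) :
    ∃ d x' y' z' p q r : ℤ, 0 < d ∧ x = d * x' ∧ y = d * y' ∧ z = d * z' ∧
      x' * p + y' * q + z' * r = 1 := by
  obtain ⟨p, q, r, h⟩ := exists_bezout_three x y z
  set g : ℤ := (Int.gcd x (Int.gcd y z) : ℤ) with hg
  have hgx : g ∣ x := Int.gcd_dvd_left ..
  have hgyz : g ∣ (Int.gcd y z : ℤ) := Int.gcd_dvd_right ..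
  have hgy : g ∣ y := hgyz.trans (Int.gcd_dvd_left ..)
  have hgz : g ∣ z := hgyz.trans (Int.gcd_dvd_right ..)
  have hg0 : g ≠ 0 := by
    intro h0
    rw [h0] at hgx hgy hgz
    exact hne ⟨zero_dvd_iff.1 hgx, zero_dvd_iff.1 hgy, zero_dvd_iff.1 hgz⟩
  obtain ⟨x', hx⟩ := hgx
  obtain ⟨y', hy⟩ := hgy
  obtain ⟨z', hz⟩ := hgz
  refine ⟨g, x', y', z', p, q, r, by positivity, hx, hy, hz, ?_⟩
  refine mul_left_cancel₀ hg0 ?_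
  rw [mul_one]
  linear_combination h - p * hx - q * hy - r * hz

/-- A primitive short vector orthogonal to a given one. -/
lemma exists_short_orthogonal (α₁ α₂ α₃ : ℤ) (h3 : α₃ ≠ 0) (h1 : |α₁| ≤ |α₃|) (h2 : |α₂| ≤ |α₃|) :
    ∃ e₁ e₂ e₃ p q r : ℤ, e₁ * p + e₂ * q + e₃ * r = 1 ∧ α₁ * e₁ + α₂ * e₂ + α₃ * e₃ = 0 ∧
      e₁ ^ 2 ≤ |α₃| ∧ e₂ ^ 2 ≤ |α₃| ∧ |e₃| ≤ |e₁| + |e₂| := by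
  obtain ⟨x, y, hne, hx, hy, z, hz⟩ := exists_short_congruence α₁ α₂ (Int.natAbs_pos.2 h3)
  rw [Int.natCast_natAbs] at hx hy hz
  obtain ⟨z, hz⟩ : ∃ z, α₁ * x + α₂ * y = α₃ * z :=
    (abs_dvd α₃ _).1 ⟨_, hz⟩
  obtain ⟨d, x', y', z', p, q, r, hd, rfl, rfl, hz', h⟩ := exists_primitive_multiple x y (-z)
    fun h => hne ⟨h.1, h.2.1⟩
  have hsq : ∀ t : ℤ, t ^ 2 ≤ (d * t) ^ 2 := fun t => by
    nlinarith [mul_nonneg (sq_nonneg t) (by nlinarith : (0 : ℤ) ≤ d ^ 2 - 1)]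
  have hort : α₁ * x' + α₂ * y' + α₃ * z' = 0 := by
    refine mul_left_cancel₀ hd.ne' ?_
    linear_combination hz - α₃ * hz'
  refine ⟨x', y', z', p, q, r, h, hort, (hsq _).trans hx, (hsq _).trans hy, ?_⟩
  refine le_of_mul_le_mul_left ?_ (abs_pos.2 h3)
  calc |α₃| * |z'| = |α₁ * x' + α₂ * y'| := by
        rw [← abs_mul, ← abs_neg (α₁ * x' + _)]
        congr 1
        linear_combination hort
    _ ≤ |α₁| * |x'| + |α₂| * |y'| := by
        rw [← abs_mul, ← abs_mul]; exact abs_add_le _ _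
    _ ≤ |α₃| * |x'| + |α₃| * |y'| := by gcongr
    _ = |α₃| * (|x'| + |y'|) := by ring

lemma exists_small_solution_of_le (α₁ α₂ α₃ h : ℤ) (h3 : α₃ ≠ 0) (h1 : |α₁| ≤ |α₃|)
    (h2 : |α₂| ≤ |α₃|) (hsol : ∃ s₁ s₂ s₃ : ℤ, α₁ * s₁ + α₂ * s₂ + α₃ * s₃ = h) {L : ℤ}
    (hL : ∀ e₁ e₂ e₃ : ℤ, α₁ * e₁ + α₂ * e₂ + α₃ * e₃ = 0 → |e₁| < L → |e₂| < L → |e₃| < L →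
      e₁ = 0 ∧ e₂ = 0 ∧ e₃ = 0) (hL0 : 0 ≤ L) :
    ∃ t₁ t₂ t₃ : ℤ, α₁ * t₁ + α₂ * t₂ + α₃ * t₃ = h ∧ L * |t₁| ≤ 4 * |α₃| ∧ L * |t₂| ≤ 4 * |α₃| ∧
      |α₃| * |t₃| ≤ |h| + |α₃| * (|t₁| + |t₂|) := by
  obtain ⟨e₁, e₂, e₃, p, q, r, he, hort, he1, he2, he3⟩ := exists_short_orthogonal _ _ _ h3 h1 h2
  obtain ⟨s₁, s₂, s₃, hs⟩ := hsol
  set M := |α₃| with hM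
  have hM0 : 0 < M := abs_pos.2 h3
  -- a translate of the solution along a second orthogonal vector
  obtain ⟨t₁, t₂, t₃, ht, hφ0, hφM⟩ : ∃ t₁ t₂ t₃ : ℤ, α₁ * t₁ + α₂ * t₂ + α₃ * t₃ = h ∧
      0 ≤ e₁ * t₂ - e₂ * t₁ ∧ e₁ * t₂ - e₂ * t₁ < M := by
    set l := -((e₁ * s₂ - e₂ * s₁) / α₃) with hl
    refine ⟨s₁ + l * (α₂ * r - α₃ * q), s₂ + l * (α₃ * p - α₁ * r), s₃ + l * (α₁ * q - α₂ * p),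
      by linear_combination hs, ?_⟩
    have : e₁ * (s₂ + l * (α₃ * p - α₁ * r)) - e₂ * (s₁ + l * (α₂ * r - α₃ * q)) =
        (e₁ * s₂ - e₂ * s₁) % α₃ := by
      rw [Int.emod_def]
      linear_combination (l * α₃) * he - l * r * hort
    rw [this]
    exact ⟨Int.emod_nonneg _ h3, Int.emod_lt_abs _ h3⟩
  have hE : L ≤ 2 * |e₁| ∨ L ≤ 2 * |e₂| := by
    by_contra! hcon
    obtain ⟨h1, h2, h3⟩ := hL e₁ e₂ e₃ hort (by linarith [abs_nonneg e₁])
      (by linarith [abs_nonneg e₂]) (by linarith)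
    simp [h1, h2, h3] at he
  have hend : ∀ t₁ t₂ t₃ : ℤ, α₁ * t₁ + α₂ * t₂ + α₃ * t₃ = h →
      M * |t₃| ≤ |h| + M * (|t₁| + |t₂|) := by
    intro t₁ t₂ t₃ ht
    calc M * |t₃| = |h + (-(α₁ * t₁) + -(α₂ * t₂))| := by
          rw [hM, ← abs_mul]
          congr 1
          linear_combination ht
      _ ≤ |h| + (|α₁| * |t₁| + |α₂| * |t₂|) := by
          rw [← abs_mul, ← abs_mul, ← abs_neg (α₁ * t₁), ← abs_neg (α₂ * t₂)]
          exact (abs_add_le _ _).trans (by gcongr; exact abs_add_le _ _)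
      _ ≤ |h| + (M * |t₁| + M * |t₂|) := by gcongr
      _ = _ := by ring
  -- reduction along the short vector
  have key : ∀ E F x y : ℤ, E ≠ 0 → |F| ≤ |E| → E ^ 2 ≤ M → L ≤ 2 * |E| → |E * y - F * x| < M →
      ∃ m : ℤ, L * |x + m * E| ≤ 4 * M ∧ L * |y + m * F| ≤ 4 * M := by
    intro E F x y hE0 hFE hEM hLE hφ
    have hEabs : 0 < |E| := abs_pos.2 hE0
    have hx : |x % E| < |E| := by
      rw [abs_of_nonneg (Int.emod_nonneg _ hE0)]
      exact Int.emod_lt_abs _ hE0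
    have hEE : |E| * |E| ≤ M := by rw [← abs_mul, ← pow_two, abs_of_nonneg (sq_nonneg E)]; exact hEM
    refine ⟨-(x / E), ?_, ?_⟩
    · have : x + -(x / E) * E = x % E := by rw [Int.emod_def]; ring
      rw [this]
      nlinarith [abs_nonneg (x % E)]
    · set y' := y + -(x / E) * F with hy'
      have h0 : E * y' = (E * y - F * x) + F * (x % E) := by rw [Int.emod_def, hy']; ring
      have h1 : |E| * |y'| ≤ 2 * M := by
        rw [← abs_mul, h0]
        refine (abs_add_le _ _).trans ?_
        rw [abs_mul F]
        nlinarith [abs_nonneg F, abs_nonneg (x % E), mul_le_mul hFE hx.le (abs_nonneg _) hEabs.le]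
      nlinarith [abs_nonneg y']
  rcases le_total |e₂| |e₁| with hle | hle
  · have hLe : L ≤ 2 * |e₁| := hE.elim id fun h => h.trans (by linarith)
    have he0 : e₁ ≠ 0 := by
      rintro rfl
      have : e₂ = 0 := by simpa using hle
      subst this
      have : e₃ = 0 := by simpa using he3
      subst this
      simp at he
    obtain ⟨m, hm1, hm2⟩ := key e₁ e₂ t₁ t₂ he0 hle he1 hLe (by rwa [abs_of_nonneg hφ0])
    have hnew : α₁ * (t₁ + m * e₁) + α₂ * (t₂ + m * e₂) + α₃ * (t₃ + m * e₃) = h := by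
      linear_combination ht + m * hort
    exact ⟨_, _, _, hnew, hm1, hm2, hend _ _ _ hnew⟩
  · have hLe : L ≤ 2 * |e₂| := hE.elim (fun h => h.trans (by linarith)) id
    have he0 : e₂ ≠ 0 := by
      rintro rfl
      have : e₁ = 0 := by simpa using hle
      subst this
      have : e₃ = 0 := by simpa using he3
      subst this
      simp at he
    obtain ⟨m, hm1, hm2⟩ := key e₂ e₁ t₂ t₁ he0 hle he2 hLe
      (by rw [abs_sub_comm, abs_of_nonneg hφ0]; exact hφM)
    have hnew : α₁ * (t₁ + m * e₁) + α₂ * (t₂ + m * e₂) + α₃ * (t₃ + m * e₃) = h := by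
      linear_combination ht + m * hort
    exact ⟨_, _, _, hnew, hm2, hm1, hend _ _ _ hnew⟩

/-- If no short vector is orthogonal to `α`, then `α · t = h` has a small solution as soon as it
has any. -/
lemma exists_small_solution (α₁ α₂ α₃ h M : ℤ) (hM : 0 < M) (h1 : |α₁| ≤ M)
    (h2 : |α₂| ≤ M) (h3 : |α₃| ≤ M) (hmax : |α₁| = M ∨ |α₂| = M ∨ |α₃| = M)
    (hsol : ∃ s₁ s₂ s₃ : ℤ, α₁ * s₁ + α₂ * s₂ + α₃ * s₃ = h) {L : ℤ}
    (hL : ∀ e₁ e₂ e₃ : ℤ, α₁ * e₁ + α₂ * e₂ + α₃ * e₃ = 0 → |e₁| < L → |e₂| < L → |e₃| < L →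
      e₁ = 0 ∧ e₂ = 0 ∧ e₃ = 0) (hL0 : 0 ≤ L) :
    ∃ t₁ t₂ t₃ : ℤ, α₁ * t₁ + α₂ * t₂ + α₃ * t₃ = h ∧ L * M * |t₁| ≤ L * |h| + 8 * M ^ 2 ∧
      L * M * |t₂| ≤ L * |h| + 8 * M ^ 2 ∧ L * M * |t₃| ≤ L * |h| + 8 * M ^ 2 := by
  have hab : ∀ {x y z : ℤ}, L * |x| ≤ 4 * M → L * |y| ≤ 4 * M → M * |z| ≤ |h| + M * (|x| + |y|) →
      L * M * |x| ≤ L * |h| + 8 * M ^ 2 ∧ L * M * |y| ≤ L * |h| + 8 * M ^ 2 ∧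
      L * M * |z| ≤ L * |h| + 8 * M ^ 2 := by
    intro x y z hx hy hz
    have hLh := mul_nonneg hL0 (abs_nonneg h)
    have hx' := mul_le_mul_of_nonneg_left hx hM.le
    have hy' := mul_le_mul_of_nonneg_left hy hM.le
    have hz' := mul_le_mul_of_nonneg_left hz hL0
    refine ⟨by nlinarith, by nlinarith, by nlinarith⟩
  obtain ⟨s₁, s₂, s₃, hs⟩ := hsol
  have hne : ∀ {x : ℤ}, |x| = M → x ≠ 0 := by
    rintro x hx rfl
    simp at hx; omega
  rcases hmax with hm | hm | hm
  · obtain ⟨x, y, z, ht, hx, hy, hz⟩ := exists_small_solution_of_le α₂ α₃ α₁ h (hne hm)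
      (by rwa [hm]) (by rwa [hm]) ⟨s₂, s₃, s₁, by linear_combination hs⟩ (L := L)
      (fun e₁ e₂ e₃ he h1 h2 h3 => by
        obtain ⟨a, b, c⟩ := hL e₃ e₁ e₂ (by linear_combination he) h3 h1 h2
        exact ⟨b, c, a⟩) hL0
    rw [hm] at hx hy hz
    obtain ⟨a, b, c⟩ := hab hx hy hz
    exact ⟨z, x, y, by linear_combination ht, c, a, b⟩
  · obtain ⟨x, y, z, ht, hx, hy, hz⟩ := exists_small_solution_of_le α₁ α₃ α₂ h (hne hm)
      (by rwa [hm]) (by rwa [hm]) ⟨s₁, s₃, s₂, by linear_combination hs⟩ (L := L)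
      (fun e₁ e₂ e₃ he h1 h2 h3 => by
        obtain ⟨a, b, c⟩ := hL e₁ e₃ e₂ (by linear_combination he) h1 h3 h2
        exact ⟨a, c, b⟩) hL0
    rw [hm] at hx hy hz
    obtain ⟨a, b, c⟩ := hab hx hy hz
    exact ⟨x, z, y, by linear_combination ht, a, c, b⟩
  · obtain ⟨x, y, z, ht, hx, hy, hz⟩ := exists_small_solution_of_le α₁ α₂ α₃ h (hne hm)
      (by rwa [hm]) (by rwa [hm]) ⟨s₁, s₂, s₃, hs⟩ hL hL0
    rw [hm] at hx hy hz
    obtain ⟨a, b, c⟩ := hab hx hy hz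
    exact ⟨x, y, z, ht, a, b, c⟩

/-! ### Counting solutions of linear equations in a box -/

/-- The integer points of the cube `[-R, R]³`. -/
noncomputable def cube (R : ℤ) : Finset (ℤ × ℤ × ℤ) := Icc (-R) R ×ˢ Icc (-R) R ×ˢ Icc (-R) R

lemma mem_cube {R : ℤ} {v : ℤ × ℤ × ℤ} :
    v ∈ cube R ↔ |v.1| ≤ R ∧ |v.2.1| ≤ R ∧ |v.2.2| ≤ R := by
  simp only [cube, mem_product, mem_Icc, abs_le]

lemma mul_card_le_of_spaced {S : Finset ℤ} {R d g : ℤ} (hR : 0 ≤ R) (hd : 0 < d) (hg : 0 < g)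
    (hgd : g ∣ d) (hS : S ⊆ Icc (-R) R) (h : ∀ x ∈ S, ∀ y ∈ S, d ∣ g * (x - y)) :
    d * #S ≤ 2 * R * g + d := by
  obtain ⟨m, rfl⟩ := hgd
  have hm : 0 < m := pos_of_mul_pos_right hd hg.le
  have hcard : #S ≤ #(Icc 0 (2 * R / m)) := by
    refine card_le_card_of_injOn (fun x => (x + R) / m) ?_ ?_
    · intro x hx
      have := mem_Icc.1 (hS hx)
      exact mem_coe.2 (mem_Icc.2 ⟨Int.ediv_nonneg (by linarith) hm.le,
        Int.ediv_le_ediv hm (by linarith)⟩)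
    · intro x hx y hy hxy
      have hdvd : m ∣ (x + R) - (y + R) := by
        have := Int.dvd_of_mul_dvd_mul_left hg.ne' (h x hx y hy)
        rwa [add_sub_add_right_eq_sub]
      have hmod : (x + R) % m = (y + R) % m :=
        Int.emod_eq_emod_iff_emod_sub_eq_zero.2 (Int.emod_eq_zero_of_dvd hdvd)
      have h1 := Int.mul_ediv_add_emod (x + R) m
      have h2 := Int.mul_ediv_add_emod (y + R) m
      simp only at hxy
      rw [hxy, hmod] at h1
      linarith
  rw [Int.card_Icc, sub_zero] at hcard
  have h0 : 0 ≤ 2 * R / m := Int.ediv_nonneg (by linarith) hm.le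
  have hcard' : (#S : ℤ) ≤ 2 * R / m + 1 := by
    have : (#S : ℤ) ≤ ((2 * R / m + 1).toNat : ℤ) := by exact_mod_cast hcard
    rwa [Int.toNat_of_nonneg (by linarith)] at this
  have h3 : m * (2 * R / m) ≤ 2 * R := Int.mul_ediv_self_le hm.ne'
  nlinarith [mul_le_mul_of_nonneg_left hcard' hd.le]

lemma card_linear_le_of_le {α₁ α₂ α₃ g R B : ℤ} (h : ℤ) (hR : 0 < R) (h3 : α₃ ≠ 0)
    (h3B : |α₃| ≤ B * R) (hg : 0 < g) (hg2 : g ∣ α₂) (hg3 : g ∣ α₃)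
    (hbez : ∃ p q r : ℤ, α₁ * p + α₂ * q + α₃ * r = g) :
    |α₃| * #{v ∈ cube R | α₁ * v.1 + α₂ * v.2.1 + α₃ * v.2.2 = h} ≤ (4 + 5 * B) * R ^ 2 * g := by
  set P : Finset (ℤ × ℤ × ℤ) := {v ∈ cube R | α₁ * v.1 + α₂ * v.2.1 + α₃ * v.2.2 = h} with hP
  have hmem : ∀ v ∈ P, (|v.1| ≤ R ∧ |v.2.1| ≤ R ∧ |v.2.2| ≤ R) ∧
      α₁ * v.1 + α₂ * v.2.1 + α₃ * v.2.2 = h := fun v hv => by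
    rwa [hP, mem_filter, mem_cube] at hv
  set d : ℤ := (Int.gcd α₂ α₃ : ℤ) with hd
  set M := |α₃| with hM
  have hM0 : 0 < M := abs_pos.2 h3
  have hd2 : d ∣ α₂ := Int.gcd_dvd_left ..
  have hd3 : d ∣ α₃ := Int.gcd_dvd_right ..
  have hdbez : d = α₂ * Int.gcdA α₂ α₃ + α₃ * Int.gcdB α₂ α₃ := Int.gcd_eq_gcd_ab α₂ α₃
  have hd0 : 0 < d := by
    have : d ≠ 0 := fun h0 => h3 (zero_dvd_iff.1 (h0 ▸ hd3))
    have : 0 ≤ d := Int.natCast_nonneg _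
    omega
  have hgd : g ∣ d := Int.dvd_coe_gcd hg2 hg3
  have hdM : d ∣ M := (dvd_abs _ _).2 hd3
  obtain ⟨p, q, r, hpqr⟩ := hbez
  have hfst : d * #(P.image Prod.fst) ≤ 2 * R * g + d := by
    refine mul_card_le_of_spaced hR.le hd0 hg hgd ?_ ?_
    · intro x hx
      obtain ⟨v, hv, rfl⟩ := mem_image.1 hx
      exact mem_Icc.2 (abs_le.1 (hmem v hv).1.1)
    · intro x hx y hy
      obtain ⟨v, hv, rfl⟩ := mem_image.1 hx
      obtain ⟨w, hw, rfl⟩ := mem_image.1 hy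
      have hv' := (hmem v hv).2
      have hw' := (hmem w hw).2
      have : g * (v.1 - w.1) = α₂ * (q * (v.1 - w.1) - p * (v.2.1 - w.2.1)) +
          α₃ * (r * (v.1 - w.1) - p * (v.2.2 - w.2.2)) := by
        rw [← hpqr]
        linear_combination p * (hv' - hw')
      rw [this]
      exact dvd_add (hd2.mul_right _) (hd3.mul_right _)
  have hfib : ∀ a ∈ P.image Prod.fst, #{v ∈ P | v.1 = a} ≤ ((2 * R * d + M) / M).toNat := by
    intro a _
    have hinj : Set.InjOn (fun v : ℤ × ℤ × ℤ => v.2.1) ({v ∈ P | v.1 = a} : Finset _) := by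
      rintro ⟨x, y, z⟩ hv ⟨x', y', z'⟩ hv' hyy
      rw [mem_coe, mem_filter] at hv hv'
      have e1 := (hmem _ hv.1).2
      have e2 := (hmem _ hv'.1).2
      have e3 := hv.2.trans hv'.2.symm
      simp only at hyy e1 e2 e3
      subst hyy e3
      have : z = z' := mul_left_cancel₀ h3 (by linear_combination e1 - e2)
      rw [this]
    rw [← card_image_of_injOn hinj]
    have hsp : M * #(({v ∈ P | v.1 = a} : Finset _).image fun v => v.2.1) ≤ 2 * R * d + M := by
      refine mul_card_le_of_spaced hR.le hM0 hd0 hdM ?_ ?_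
      · intro x hx
        obtain ⟨v, hv, rfl⟩ := mem_image.1 hx
        exact mem_Icc.2 (abs_le.1 (hmem v (mem_filter.1 hv).1).1.2.1)
      · intro x hx y hy
        obtain ⟨v, hv, rfl⟩ := mem_image.1 hx
        obtain ⟨w, hw, rfl⟩ := mem_image.1 hy
        have hv' := (hmem v (mem_filter.1 hv).1).2
        have hw' := (hmem w (mem_filter.1 hw).1).2
        have hvw := (mem_filter.1 hv).2.trans (mem_filter.1 hw).2.symm
        rw [hM, abs_dvd, hdbez]
        refine ⟨Int.gcdB α₂ α₃ * (v.2.1 - w.2.1) - Int.gcdA α₂ α₃ * (v.2.2 - w.2.2), ?_⟩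
        linear_combination Int.gcdA α₂ α₃ * (hv' - hw') - Int.gcdA α₂ α₃ * α₁ * hvw
    rw [← Int.ofNat_le, Int.toNat_of_nonneg (Int.ediv_nonneg (by positivity) hM0.le),
      Int.le_ediv_iff_mul_le hM0, mul_comm]
    exact hsp
  have hcard := card_le_mul_card_image P _ hfib
  have hn : M * ((2 * R * d + M) / M).toNat ≤ 2 * R * d + M := by
    rw [Int.toNat_of_nonneg (Int.ediv_nonneg (by positivity) hM0.le)]
    exact Int.mul_ediv_self_le hM0.ne'
  have hcard' : (#P : ℤ) ≤ ((2 * R * d + M) / M).toNat * #(P.image Prod.fst) := by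
    exact_mod_cast hcard
  have hprod : d * (M * #P) ≤ (2 * R * d + M) * (2 * R * g + d) := by
    calc d * (M * #P) ≤ d * (M * (((2 * R * d + M) / M).toNat * #(P.image Prod.fst))) := by gcongr
      _ = (M * ((2 * R * d + M) / M).toNat) * (d * #(P.image Prod.fst)) := by ring
      _ ≤ _ := mul_le_mul hn hfst (by positivity) (by positivity)
  refine le_of_mul_le_mul_left (hprod.trans ?_) hd0
  have hdleM : d ≤ M := Int.le_of_dvd hM0 hdM
  have hB : 0 ≤ B := by
    by_contra hB
    nlinarith
  have hRg : R ≤ R * g := le_mul_of_one_le_right hR.le hg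
  have hRd : R ≤ R * d := le_mul_of_one_le_right hR.le hd0
  have e1 : R * g * M ≤ B * R ^ 2 * g * d := by
    calc R * g * M ≤ R * g * (B * R) := by gcongr
      _ = B * R ^ 2 * g * 1 := by ring
      _ ≤ B * R ^ 2 * g * d := by gcongr; exact hd0
  have e2 : R * d * d ≤ B * R ^ 2 * g * d := by
    calc R * d * d ≤ R * d * (B * R) := by gcongr; exact hdleM.trans h3B
      _ = B * R ^ 2 * 1 * d := by ring
      _ ≤ B * R ^ 2 * g * d := by gcongr; exact hg
  have e3 : d * M ≤ B * R ^ 2 * g * d := by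
    calc d * M ≤ d * (B * R) := by gcongr
      _ = B * R * 1 * d := by ring
      _ ≤ B * (R * R) * g * d := by
        have : R ≤ R * R := le_mul_of_one_le_right hR.le hR
        have h1g : (1 : ℤ) ≤ g := hg
        have : B * R * 1 ≤ B * (R * R) * g :=
          mul_le_mul (by gcongr) h1g (by norm_num) (by positivity)
        exact mul_le_mul_of_nonneg_right this hd0.le
      _ = _ := by ring
  linarith

lemma card_linear_le {α₁ α₂ α₃ g R B M : ℤ} (h : ℤ) (hR : 0 < R) (hM : 0 < M)
    (hmax : |α₁| = M ∨ |α₂| = M ∨ |α₃| = M)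
    (hB : M ≤ B * R) (hg : 0 < g) (hg1 : g ∣ α₁) (hg2 : g ∣ α₂) (hg3 : g ∣ α₃)
    (hbez : ∃ p q r : ℤ, α₁ * p + α₂ * q + α₃ * r = g) :
    M * #{v ∈ cube R | α₁ * v.1 + α₂ * v.2.1 + α₃ * v.2.2 = h} ≤ (4 + 5 * B) * R ^ 2 * g := by
  have hne : ∀ {x : ℤ}, |x| = M → x ≠ 0 := by
    rintro x hx rfl
    simp at hx; omega
  obtain ⟨p, q, r, hpqr⟩ := hbez
  rcases hmax with hm | hm | hm
  · refine le_trans ?_ (card_linear_le_of_le (α₁ := α₂) (α₂ := α₃) (α₃ := α₁) h hR (hne hm)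
      (by rwa [hm]) hg hg3 hg1 ⟨q, r, p, by linear_combination hpqr⟩)
    rw [hm]
    refine mul_le_mul_of_nonneg_left (Int.ofNat_le.2 ?_) hM.le
    refine card_le_card_of_injOn (fun v => (v.2.1, v.2.2, v.1)) ?_ ?_
    · intro v hv
      simp only [mem_coe, mem_filter, mem_cube] at hv ⊢
      exact ⟨⟨hv.1.2.1, hv.1.2.2, hv.1.1⟩, by linear_combination hv.2⟩
    · rintro ⟨x, y, z⟩ - ⟨x', y', z'⟩ - h
      simp only [Prod.mk.injEq] at h ⊢
      tauto
  · refine le_trans ?_ (card_linear_le_of_le (α₁ := α₁) (α₂ := α₃) (α₃ := α₂) h hR (hne hm)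
      (by rwa [hm]) hg hg3 hg2 ⟨p, r, q, by linear_combination hpqr⟩)
    rw [hm]
    refine mul_le_mul_of_nonneg_left (Int.ofNat_le.2 ?_) hM.le
    refine card_le_card_of_injOn (fun v => (v.1, v.2.2, v.2.1)) ?_ ?_
    · intro v hv
      simp only [mem_coe, mem_filter, mem_cube] at hv ⊢
      exact ⟨⟨hv.1.1, hv.1.2.2, hv.1.2.1⟩, by linear_combination hv.2⟩
    · rintro ⟨x, y, z⟩ - ⟨x', y', z'⟩ - h
      simp only [Prod.mk.injEq] at h ⊢
      tauto
  · have := card_linear_le_of_le h hR (hne hm) (by rwa [hm]) hg hg2 hg3 ⟨p, q, r, hpqr⟩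
    rwa [hm] at this

/-! ### The sum of `gcd(u) / ‖u‖` over a cube -/

/-- The sup norm of an integer vector. -/
def supNorm (u : ℤ × ℤ × ℤ) : ℕ := max u.1.natAbs (max u.2.1.natAbs u.2.2.natAbs)

/-- The greatest common divisor of the coordinates of an integer vector. -/
def content (u : ℤ × ℤ × ℤ) : ℕ := Int.gcd u.1 (Int.gcd u.2.1 u.2.2)

lemma mem_cube_iff_supNorm_le {n : ℕ} {u : ℤ × ℤ × ℤ} : u ∈ cube n ↔ supNorm u ≤ n := by
  rw [mem_cube, supNorm, max_le_iff, max_le_iff, Int.abs_eq_natAbs, Int.abs_eq_natAbs,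
    Int.abs_eq_natAbs, Nat.cast_le, Nat.cast_le, Nat.cast_le]

lemma supNorm_eq_zero {u : ℤ × ℤ × ℤ} : supNorm u = 0 ↔ u = 0 := by
  obtain ⟨x, y, z⟩ := u
  simp only [supNorm, Prod.mk_eq_zero]
  omega

lemma card_cube (n : ℕ) : #(cube n) = (2 * n + 1) ^ 3 := by
  have : #(Icc (-(n : ℤ)) n) = 2 * n + 1 := by
    rw [Int.card_Icc]; omega
  rw [cube, card_product, card_product, this]
  ring

lemma cube_mono {m n : ℤ} (h : m ≤ n) : cube m ⊆ cube n := by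
  intro v hv
  rw [mem_cube] at hv ⊢
  exact ⟨hv.1.trans h, hv.2.1.trans h, hv.2.2.trans h⟩

lemma card_supNorm_eq_le (n : ℕ) {j : ℕ} (hj : 0 < j) :
    #{u ∈ cube n | supNorm u = j} ≤ 26 * j ^ 2 := by
  obtain ⟨i, rfl⟩ := Nat.exists_eq_add_of_lt hj
  rw [zero_add]
  have hsub : ({u ∈ cube n | supNorm u = i + 1} : Finset _) ⊆ cube (i + 1 : ℕ) \ cube i := by
    intro u hu
    have := (mem_filter.1 hu).2
    rw [mem_sdiff, mem_cube_iff_supNorm_le, mem_cube_iff_supNorm_le]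
    omega
  refine (card_le_card hsub).trans ?_
  rw [card_sdiff_of_subset (cube_mono (by simp)), card_cube, card_cube, Nat.sub_le_iff_le_add]
  nlinarith

lemma sum_inv_supNorm_le (n : ℕ) :
    ∑ u ∈ cube n with u ≠ 0, (1 : ℝ) / supNorm u ≤ 26 * (n : ℝ) ^ 2 := by
  have hmaps : ∀ u ∈ ({u ∈ cube n | u ≠ 0} : Finset _), supNorm u ∈ Icc 1 n := by
    intro u hu
    rw [mem_filter, mem_cube_iff_supNorm_le, Ne, ← supNorm_eq_zero] at hu
    rw [mem_Icc]
    omega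
  rw [← sum_fiberwise_of_maps_to hmaps]
  have hj : ∀ j ∈ Icc 1 n, ∑ u ∈ cube n with u ≠ 0 ∧ supNorm u = j, (1 : ℝ) / supNorm u ≤
      26 * n := by
    intro j hj
    rw [mem_Icc] at hj
    have hj0 : (0 : ℝ) < j := by exact_mod_cast hj.1
    calc ∑ u ∈ cube n with u ≠ 0 ∧ supNorm u = j, (1 : ℝ) / supNorm u
        = ∑ u ∈ cube n with u ≠ 0 ∧ supNorm u = j, (1 : ℝ) / j :=
          sum_congr rfl fun u hu => by rw [(mem_filter.1 hu).2.2]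
      _ = #{u ∈ cube n | u ≠ 0 ∧ supNorm u = j} * ((1 : ℝ) / j) := by
          rw [sum_const, nsmul_eq_mul]
      _ ≤ (26 * (j : ℝ) ^ 2) * (1 / j) := by
          gcongr
          have h1 : #{u ∈ cube n | u ≠ 0 ∧ supNorm u = j} ≤ #{u ∈ cube n | supNorm u = j} :=
            card_le_card fun u hu => by
              rw [mem_filter] at hu ⊢
              exact ⟨hu.1, hu.2.2⟩
          exact_mod_cast h1.trans (card_supNorm_eq_le n hj.1)
      _ = 26 * j := by field_simp
      _ ≤ 26 * n := by
          have : (j : ℝ) ≤ n := by exact_mod_cast hj.2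
          gcongr
  simp_rw [filter_filter]
  refine (sum_le_sum hj).trans ?_
  rw [sum_const, Nat.card_Icc, nsmul_eq_mul, Nat.add_sub_cancel]
  exact le_of_eq (by ring)

lemma content_dvd (u : ℤ × ℤ × ℤ) :
    (content u : ℤ) ∣ u.1 ∧ (content u : ℤ) ∣ u.2.1 ∧ (content u : ℤ) ∣ u.2.2 := by
  have h : (content u : ℤ) ∣ (Int.gcd u.2.1 u.2.2 : ℤ) := Int.gcd_dvd_right ..
  exact ⟨Int.gcd_dvd_left .., h.trans (Int.gcd_dvd_left ..), h.trans (Int.gcd_dvd_right ..)⟩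

lemma content_pos {u : ℤ × ℤ × ℤ} (hu : u ≠ 0) : 0 < content u := by
  rw [Nat.pos_iff_ne_zero]
  intro h
  obtain ⟨h1, h2, h3⟩ := content_dvd u
  rw [h, Nat.cast_zero, zero_dvd_iff] at h1 h2 h3
  exact hu (by ext <;> simp [h1, h2, h3])

lemma supNorm_smul (d : ℕ) (u : ℤ × ℤ × ℤ) :
    supNorm ((d : ℤ) * u.1, (d : ℤ) * u.2.1, (d : ℤ) * u.2.2) = d * supNorm u := by
  simp only [supNorm, Int.natAbs_mul, Int.natAbs_natCast]
  rw [Nat.mul_max_mul_left, Nat.mul_max_mul_left]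

lemma sum_content_div_supNorm_le (n : ℕ) {d₀ : ℕ} (hd₀ : 0 < d₀) :
    ∑ u ∈ cube n with u ≠ 0 ∧ d₀ ≤ content u, (content u : ℝ) / supNorm u ≤
      52 * (n : ℝ) ^ 2 / d₀ := by
  set S : Finset (ℤ × ℤ × ℤ) := {u ∈ cube n | u ≠ 0 ∧ d₀ ≤ content u} with hS
  have hmem : ∀ u ∈ S, supNorm u ≤ n ∧ u ≠ 0 ∧ d₀ ≤ content u := fun u hu => by
    rwa [hS, mem_filter, mem_cube_iff_supNorm_le] at hu
  have hcontle : ∀ u ∈ S, content u ≤ n := by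
    intro u hu
    obtain ⟨h1, h2, -⟩ := hmem u hu
    obtain ⟨⟨x, hx⟩, ⟨y, hy⟩, ⟨z, hz⟩⟩ := content_dvd u
    have h3 : supNorm u = content u * supNorm (x, y, z) := by
      rw [← supNorm_smul, ← hx, ← hy, ← hz]
    have h4 : supNorm u ≠ 0 := by rwa [Ne, supNorm_eq_zero]
    refine le_trans ?_ h1
    rw [h3] at h4 ⊢
    exact Nat.le_mul_of_pos_right _ (Nat.pos_of_ne_zero (right_ne_zero_of_mul h4))
  have hmaps : ∀ u ∈ S, content u ∈ Icc d₀ n := fun u hu =>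
    mem_Icc.2 ⟨(hmem u hu).2.2, hcontle u hu⟩
  rw [← sum_fiberwise_of_maps_to hmaps]
  have hfib : ∀ d ∈ Icc d₀ n, ∑ u ∈ S with content u = d, (content u : ℝ) / supNorm u ≤
      26 * (n : ℝ) ^ 2 * ((d : ℝ) ^ 2)⁻¹ := by
    intro d hd
    have hd0 : 0 < d := hd₀.trans_le (mem_Icc.1 hd).1
    have hd0' : (0 : ℝ) < d := by exact_mod_cast hd0
    have hdiv : ∀ u ∈ ({u ∈ S | content u = d} : Finset _),
        u = ((d : ℤ) * (u.1 / d), (d : ℤ) * (u.2.1 / d), (d : ℤ) * (u.2.2 / d)) := by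
      intro u hu
      obtain ⟨h1, h2, h3⟩ := content_dvd u
      rw [(mem_filter.1 hu).2] at h1 h2 h3
      ext
      · exact (Int.mul_ediv_cancel' h1).symm
      · exact (Int.mul_ediv_cancel' h2).symm
      · exact (Int.mul_ediv_cancel' h3).symm
    have hnorm : ∀ u ∈ ({u ∈ S | content u = d} : Finset _),
        supNorm u = d * supNorm (u.1 / d, u.2.1 / d, u.2.2 / d) := by
      intro u hu
      rw [← supNorm_smul d (u.1 / d, u.2.1 / d, u.2.2 / d), ← hdiv u hu]
    have hinj : Set.InjOn (fun u : ℤ × ℤ × ℤ => (u.1 / (d : ℤ), u.2.1 / (d : ℤ), u.2.2 / (d : ℤ)))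
        ({u ∈ S | content u = d} : Finset _) := by
      intro u hu v hv huv
      simp only [Prod.mk.injEq] at huv
      rw [hdiv u hu, hdiv v hv, huv.1, huv.2.1, huv.2.2]
    calc ∑ u ∈ S with content u = d, (content u : ℝ) / supNorm u
        = ∑ u ∈ S with content u = d, (1 : ℝ) / supNorm (u.1 / d, u.2.1 / d, u.2.2 / d) := by
          refine sum_congr rfl fun u hu => ?_
          rw [hnorm u hu, (mem_filter.1 hu).2, Nat.cast_mul]
          field_simp
      _ = ∑ w ∈ ({u ∈ S | content u = d} : Finset _).image
            (fun u => (u.1 / (d : ℤ), u.2.1 / (d : ℤ), u.2.2 / (d : ℤ))), (1 : ℝ) / supNorm w :=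
          by rw [sum_image hinj]
      _ ≤ ∑ w ∈ cube (n / d : ℕ) with w ≠ 0, (1 : ℝ) / supNorm w := by
          refine sum_le_sum_of_subset_of_nonneg ?_ fun _ _ _ => by positivity
          intro w hw
          obtain ⟨u, hu, huw⟩ := mem_image.1 hw
          have h1 := hnorm u hu
          rw [huw] at h1
          obtain ⟨h2, h3, -⟩ := hmem u (mem_filter.1 hu).1
          have h4 : w ∈ cube (n / d : ℕ) := by
            rw [mem_cube_iff_supNorm_le, Nat.le_div_iff_mul_le hd0]
            linarith
          have h5 : w ≠ 0 := by
            intro h0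
            rw [supNorm_eq_zero.2 h0, mul_zero] at h1
            exact h3 (supNorm_eq_zero.1 h1)
          exact mem_filter.2 ⟨h4, h5⟩
      _ ≤ 26 * ((n / d : ℕ) : ℝ) ^ 2 := sum_inv_supNorm_le _
      _ ≤ 26 * ((n : ℝ) / d) ^ 2 := by
          gcongr
          exact Nat.cast_div_le
      _ = 26 * (n : ℝ) ^ 2 * ((d : ℝ) ^ 2)⁻¹ := by field_simp
  refine (sum_le_sum hfib).trans ?_
  rw [← mul_sum]
  obtain ⟨k, rfl⟩ := Nat.exists_eq_add_of_lt hd₀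
  have hset : Icc (0 + k + 1) n = Ioo k (n + 1) := by
    ext x
    rw [mem_Icc, mem_Ioo]
    omega
  rw [hset]
  have h := sum_Ioo_inv_sq_le (α := ℝ) k (n + 1)
  calc 26 * (n : ℝ) ^ 2 * ∑ i ∈ Ioo k (n + 1), ((i : ℝ) ^ 2)⁻¹
      ≤ 26 * (n : ℝ) ^ 2 * (2 / (k + 1)) := by gcongr
    _ = 52 * (n : ℝ) ^ 2 / ((0 + k + 1 : ℕ) : ℝ) := by
      push_cast
      ring

/-! ### Pairs of integer points with prescribed difference of values -/

/-- The coefficient vector of the linear form `x ↦ f(x + u) - f(x)`, up to a factor `4`. -/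
def scaled (a b c : ℕ) (u : ℤ × ℤ × ℤ) : ℤ × ℤ × ℤ := (a * u.1, b * u.2.1, c * u.2.2)

/-- The standard bilinear form on `ℤ³`. -/
def dot (u v : ℤ × ℤ × ℤ) : ℤ := u.1 * v.1 + u.2.1 * v.2.1 + u.2.2 * v.2.2

/-- The number of pairs of points of a cube at which the values of `f` differ by `j`. -/
noncomputable def pairCount (a b c R : ℕ) (j : ℤ) : ℕ :=
  #{p ∈ cube R ×ˢ cube R | ternaryForm a b c p.1 - ternaryForm a b c p.2 = j}

lemma ternaryForm_sub_add (a b c : ℕ) (v w t : ℤ × ℤ × ℤ) :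
    ternaryForm a b c (v + t) - ternaryForm a b c (w + t) =
      ternaryForm a b c v - ternaryForm a b c w + 4 * dot (scaled a b c (v - w)) t := by
  simp only [ternaryForm, hexagonal, dot, scaled, Prod.fst_add, Prod.snd_add, Prod.fst_sub,
    Prod.snd_sub]
  ring

/-- The vectors `u` such that the linear form of `u` takes all values `0, W, …, (K - 1) * W`
on the cube of radius `T`. -/
def Reaches (a b c T W K : ℕ) (u : ℤ × ℤ × ℤ) : Prop :=
  ∀ k < K, ∃ t ∈ cube T, 4 * dot (scaled a b c u) t = W * k

lemma add_mem_cube {R T : ℕ} {v t : ℤ × ℤ × ℤ} (hv : v ∈ cube R) (ht : t ∈ cube T) :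
    v + t ∈ cube (R + T : ℕ) := by
  rw [mem_cube] at *
  push_cast
  exact ⟨(abs_add_le _ _).trans (add_le_add hv.1 ht.1),
    (abs_add_le _ _).trans (add_le_add hv.2.1 ht.2.1),
    (abs_add_le _ _).trans (add_le_add hv.2.2 ht.2.2)⟩

open scoped Classical in
lemma pairCount_zero_le (a b c R T W K : ℕ) {k : ℕ} (hk : k < K) :
    pairCount a b c R 0 ≤ pairCount a b c (R + T) (W * k) +
      #{p ∈ cube R ×ˢ cube R | ternaryForm a b c p.1 = ternaryForm a b c p.2 ∧
        ¬ Reaches a b c T W K (p.1 - p.2)} := by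
  rw [pairCount, ← card_filter_add_card_filter_not (fun p : (ℤ × ℤ × ℤ) × (ℤ × ℤ × ℤ) =>
    Reaches a b c T W K (p.1 - p.2)), filter_filter, filter_filter]
  simp_rw [sub_eq_zero]
  refine Nat.add_le_add_right ?_ _
  choose! t ht using fun (u : ℤ × ℤ × ℤ) (hu : Reaches a b c T W K u) => hu k hk
  refine card_le_card_of_injOn (fun p => (p.1 + t (p.1 - p.2), p.2 + t (p.1 - p.2))) ?_ ?_
  · intro p hp
    rw [mem_coe, mem_filter, mem_product] at hp ⊢
    obtain ⟨⟨h1, h2⟩, h3, h4⟩ := hp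
    obtain ⟨h5, h6⟩ := ht _ h4
    refine ⟨⟨add_mem_cube h1 h5, add_mem_cube h2 h5⟩, ?_⟩
    dsimp only
    rw [ternaryForm_sub_add, h6, h3, sub_self, zero_add]
  · intro p _ q _ hpq
    simp only [Prod.mk.injEq] at hpq
    obtain ⟨h1, h2⟩ := hpq
    have h3 : p.1 - p.2 = q.1 - q.2 := by
      have := congrArg₂ (· - ·) h1 h2
      simpa using this
    rw [h3] at h1 h2
    exact Prod.ext (add_right_cancel h1) (add_right_cancel h2)

/-! ### Thin shells -/

lemma card_le_of_sub_le {S : Finset ℤ} {s : ℕ} (h : ∀ x ∈ S, ∀ y ∈ S, x ≤ y → y - x ≤ s) :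
    #S ≤ s + 1 := by
  rcases S.eq_empty_or_nonempty with rfl | hS
  · simp
  have hsub : S ⊆ Icc (S.min' hS) (S.min' hS + s) := by
    intro x hx
    have h1 := S.min'_le x hx
    have h2 := h _ (S.min'_mem hS) x hx h1
    rw [mem_Icc]
    omega
  refine (card_le_card hsub).trans ?_
  rw [Int.card_Icc]
  omega

lemma card_hexagonal_mem_Ico_le {a : ℕ} (ha : 0 < a) (S : Finset ℤ) (m : ℤ) (H : ℕ) :
    #{x ∈ S | m ≤ a * hexagonal x ∧ a * hexagonal x < m + H} ≤ 2 * (Nat.sqrt H + 1) := by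
  have ha' : (1 : ℤ) ≤ a := by exact_mod_cast ha
  have key : ∀ x y : ℤ, x ≤ y → (0 ≤ x ∨ y < 0) → m ≤ a * hexagonal x →
      a * hexagonal x < m + H → m ≤ a * hexagonal y → a * hexagonal y < m + H →
      y - x ≤ (Nat.sqrt H : ℕ) := by
    intro x y hxy hs h1 h2 h3 h4
    have h5 : (y - x) * (y - x) ≤ |hexagonal y - hexagonal x| := by
      rcases hs with hs | hs
      · refine le_trans ?_ (le_abs_self _)
        simp only [hexagonal]
        nlinarith
      · refine le_trans ?_ (neg_le_abs _)
        simp only [hexagonal]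
        nlinarith
    have h6 : |hexagonal y - hexagonal x| ≤ H := by
      have : (a : ℤ) * |hexagonal y - hexagonal x| < H := by
        rw [← abs_of_pos (show (0 : ℤ) < a by omega), ← abs_mul, abs_lt, mul_sub]
        constructor <;> linarith
      nlinarith [abs_nonneg (hexagonal y - hexagonal x)]
    obtain ⟨j, hj⟩ := Int.eq_ofNat_of_zero_le (sub_nonneg.2 hxy)
    rw [hj] at h5 ⊢
    have h7 : j * j ≤ H := by exact_mod_cast h5.trans h6
    exact_mod_cast Nat.le_sqrt.2 h7
  rw [← card_filter_add_card_filter_not (fun x : ℤ => 0 ≤ x), two_mul]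
  refine add_le_add (card_le_of_sub_le fun x hx y hy hxy => ?_)
    (card_le_of_sub_le fun x hx y hy hxy => ?_)
  · simp only [mem_filter] at hx hy
    exact key x y hxy (Or.inl hx.2) hx.1.2.1 hx.1.2.2 hy.1.2.1 hy.1.2.2
  · simp only [mem_filter, not_le] at hx hy
    exact key x y hxy (Or.inr hy.2) hx.1.2.1 hx.1.2.2 hy.1.2.1 hy.1.2.2

lemma card_ternaryForm_mem_Ico_le {a b c : ℕ} (ha : 0 < a) (R : ℕ) (m : ℤ) (H : ℕ) :
    #{v ∈ cube R | m ≤ ternaryForm a b c v ∧ ternaryForm a b c v < m + H} ≤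
      (2 * R + 1) ^ 2 * (2 * (Nat.sqrt H + 1)) := by
  have hc : #(Icc (-(R : ℤ)) R) = 2 * R + 1 := by
    rw [Int.card_Icc]; omega
  have hc2 : #(Icc (-(R : ℤ)) R ×ˢ Icc (-(R : ℤ)) R) = (2 * R + 1) ^ 2 := by
    rw [card_product, hc]; ring
  rw [← hc2, mul_comm]
  refine card_le_mul_card_image_of_maps_to (f := Prod.snd) ?_ _ ?_
  · intro v hv
    exact (mem_product.1 (mem_filter.1 hv).1).2
  · intro w _
    refine le_trans ?_ (card_hexagonal_mem_Ico_le ha (Icc (-(R : ℤ)) R)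
      (m - b * hexagonal w.1 - c * hexagonal w.2) H)
    refine card_le_card_of_injOn Prod.fst ?_ ?_
    · intro v hv
      rw [mem_coe, mem_filter, mem_filter] at hv
      obtain ⟨⟨h1, h2, h3⟩, rfl⟩ := hv
      rw [mem_coe, mem_filter]
      simp only [ternaryForm] at h2 h3
      exact ⟨(mem_product.1 h1).1, by linarith, by linarith⟩
    · intro v hv w' hw h
      rw [mem_coe, mem_filter] at hv hw
      exact Prod.ext h (hv.2.trans hw.2.symm)

lemma ternaryForm_sub_symm_Ico {x y : ℤ} {H : ℕ} (h0 : 0 ≤ x - y) (h1 : x - y < H) :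
    x - H + 1 ≤ y ∧ y < x - H + 1 + H := by
  constructor <;> linarith

/-- Pairs with at least one coordinate in a shell. -/
lemma card_pairs_shell_le {a b c : ℕ} (ha : 0 < a) {R S : ℕ} (hRS : R ≤ S) (H : ℕ) :
    #{p ∈ cube S ×ˢ cube S | ¬ (p.1 ∈ cube R ∧ p.2 ∈ cube R) ∧
      (0 : ℤ) ≤ ternaryForm a b c p.1 - ternaryForm a b c p.2 ∧
      ternaryForm a b c p.1 - ternaryForm a b c p.2 < (H : ℤ)} ≤
    2 * (((2 * S + 1) ^ 3 - (2 * R + 1) ^ 3) * ((2 * S + 1) ^ 2 * (2 * (Nat.sqrt H + 1)))) := by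
  have hshell : #(cube S \ cube R) = (2 * S + 1) ^ 3 - (2 * R + 1) ^ 3 := by
    rw [card_sdiff_of_subset (cube_mono (by exact_mod_cast hRS)), card_cube, card_cube]
  rw [← hshell]
  have hsub : ({p ∈ cube S ×ˢ cube S | ¬ (p.1 ∈ cube R ∧ p.2 ∈ cube R) ∧
      (0 : ℤ) ≤ ternaryForm a b c p.1 - ternaryForm a b c p.2 ∧
      ternaryForm a b c p.1 - ternaryForm a b c p.2 < (H : ℤ)} : Finset _) ⊆
      {p ∈ (cube S \ cube R) ×ˢ cube S | (0 : ℤ) ≤ ternaryForm a b c p.1 - ternaryForm a b c p.2 ∧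
        ternaryForm a b c p.1 - ternaryForm a b c p.2 < (H : ℤ)} ∪
      {p ∈ cube S ×ˢ (cube S \ cube R) | (0 : ℤ) ≤ ternaryForm a b c p.1 - ternaryForm a b c p.2 ∧
        ternaryForm a b c p.1 - ternaryForm a b c p.2 < (H : ℤ)} := by
    intro p hp
    simp only [mem_filter, mem_product, mem_union, mem_sdiff] at hp ⊢
    tauto
  refine (card_le_card hsub).trans ((card_union_le _ _).trans ?_)
  rw [two_mul]
  refine add_le_add ?_ ?_ <;> rw [mul_comm]
  · refine card_le_mul_card_image_of_maps_to (f := Prod.fst) ?_ _ ?_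
    · intro p hp
      exact (mem_product.1 (mem_filter.1 hp).1).1
    · intro v _
      refine le_trans ?_ (card_ternaryForm_mem_Ico_le (b := b) (c := c) ha S
        (ternaryForm a b c v - H + 1) H)
      refine card_le_card_of_injOn Prod.snd ?_ ?_
      · intro p hp
        rw [mem_coe, mem_filter, mem_filter] at hp
        obtain ⟨⟨h1, h2, h3⟩, rfl⟩ := hp
        exact mem_filter.2 ⟨(mem_product.1 h1).2, ternaryForm_sub_symm_Ico h2 h3⟩
      · intro p hp q hq h
        rw [mem_coe, mem_filter] at hp hq
        exact Prod.ext (hp.2.trans hq.2.symm) h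
  · refine card_le_mul_card_image_of_maps_to (f := Prod.snd) ?_ _ ?_
    · intro p hp
      exact (mem_product.1 (mem_filter.1 hp).1).2
    · intro v _
      refine le_trans ?_ (card_ternaryForm_mem_Ico_le (b := b) (c := c) ha S
        (ternaryForm a b c v) H)
      refine card_le_card_of_injOn Prod.fst ?_ ?_
      · intro p hp
        rw [mem_coe, mem_filter, mem_filter] at hp
        obtain ⟨⟨h1, h2, h3⟩, rfl⟩ := hp
        exact mem_filter.2 ⟨(mem_product.1 h1).1, sub_nonneg.1 h2, by linarith⟩
      · intro p hp q hq h
        rw [mem_coe, mem_filter] at hp hq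
        exact Prod.ext h (hp.2.trans hq.2.symm)

lemma sum_pairCount_add_le {a b c : ℕ} (ha : 0 < a) {R T W K : ℕ} (hW : 0 < W) :
    ∑ k ∈ range K, pairCount a b c (R + T) (W * k) ≤ ∑ k ∈ range K, pairCount a b c R (W * k) +
      2 * (((2 * (R + T) + 1) ^ 3 - (2 * R + 1) ^ 3) *
        ((2 * (R + T) + 1) ^ 2 * (2 * (Nat.sqrt (W * K) + 1)))) := by
  refine le_trans ?_ (Nat.add_le_add_left
    (card_pairs_shell_le (b := b) (c := c) ha (Nat.le_add_right R T) (W * K)) _)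
  have hk : ∀ k ∈ range K, pairCount a b c (R + T) (W * k) ≤ pairCount a b c R (W * k) +
      #{p ∈ cube (R + T : ℕ) ×ˢ cube (R + T : ℕ) | ¬ (p.1 ∈ cube R ∧ p.2 ∈ cube R) ∧
        ternaryForm a b c p.1 - ternaryForm a b c p.2 = (W * k : ℤ)} := by
    intro k _
    rw [pairCount, ← card_filter_add_card_filter_not (fun p : (ℤ × ℤ × ℤ) × (ℤ × ℤ × ℤ) =>
      p.1 ∈ cube R ∧ p.2 ∈ cube R), filter_filter, filter_filter]
    refine add_le_add (card_le_card fun p hp => ?_) (card_le_card fun p hp => ?_)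
    · rw [mem_filter] at hp ⊢
      exact ⟨mem_product.2 hp.2.2, hp.2.1⟩
    · rw [mem_filter] at hp ⊢
      exact ⟨hp.1, hp.2.2, hp.2.1⟩
  refine (sum_le_sum hk).trans ?_
  rw [sum_add_distrib]
  refine Nat.add_le_add_left ?_ _
  rw [← card_biUnion]
  · refine card_le_card fun p hp => ?_
    rw [mem_biUnion] at hp
    obtain ⟨k, hk, hp⟩ := hp
    rw [mem_filter] at hp ⊢
    refine ⟨hp.1, hp.2.1, ?_⟩
    rw [hp.2.2]
    refine ⟨by positivity, ?_⟩
    exact_mod_cast Nat.mul_lt_mul_of_pos_left (mem_range.1 hk) hW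
  · intro k _ l _ hkl
    refine disjoint_left.2 fun p hp hq => hkl ?_
    rw [mem_filter] at hp hq
    have h1 := hp.2.2.symm.trans hq.2.2
    have h2 : W * k = W * l := by exact_mod_cast h1
    exact Nat.eq_of_mul_eq_mul_left hW h2

/-! ### Counting pairs with a fixed difference vector -/

lemma supNorm_spec (u : ℤ × ℤ × ℤ) :
    (|u.1| ≤ supNorm u ∧ |u.2.1| ≤ supNorm u ∧ |u.2.2| ≤ supNorm u) ∧
      (|u.1| = supNorm u ∨ |u.2.1| = supNorm u ∨ |u.2.2| = supNorm u) := by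
  simp only [Int.abs_eq_natAbs, Nat.cast_le, Nat.cast_inj, supNorm]
  omega

lemma supNorm_le_supNorm_scaled {a b c : ℕ} (ha : 0 < a) (hb : 0 < b) (hc : 0 < c)
    (u : ℤ × ℤ × ℤ) : supNorm u ≤ supNorm (scaled a b c u) := by
  simp only [supNorm, scaled, Int.natAbs_mul, Int.natAbs_natCast]
  exact max_le_max (Nat.le_mul_of_pos_left _ ha)
    (max_le_max (Nat.le_mul_of_pos_left _ hb) (Nat.le_mul_of_pos_left _ hc))

lemma supNorm_scaled_le (a b c : ℕ) (u : ℤ × ℤ × ℤ) :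
    supNorm (scaled a b c u) ≤ (a + b + c) * supNorm u := by
  simp only [supNorm, scaled, Int.natAbs_mul, Int.natAbs_natCast]
  refine max_le ?_ (max_le ?_ ?_) <;> refine Nat.mul_le_mul (by omega) ?_
  · exact le_max_left _ _
  · exact (le_max_left _ _).trans (le_max_right _ _)
  · exact (le_max_right _ _).trans (le_max_right _ _)

lemma scaled_ne_zero {a b c : ℕ} (ha : 0 < a) (hb : 0 < b) (hc : 0 < c) {u : ℤ × ℤ × ℤ}
    (hu : u ≠ 0) : scaled a b c u ≠ 0 := by
  have h := supNorm_le_supNorm_scaled ha hb hc u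
  rw [Ne, ← supNorm_eq_zero] at hu ⊢
  omega

lemma content_scaled_le {a b c : ℕ} (ha : 0 < a) (hb : 0 < b) (hc : 0 < c) {u : ℤ × ℤ × ℤ}
    (hu : u ≠ 0) : content (scaled a b c u) ≤ a * b * c * content u := by
  obtain ⟨p, q, r, h⟩ := exists_bezout_three u.1 u.2.1 u.2.2
  obtain ⟨h1, h2, h3⟩ := content_dvd (scaled a b c u)
  refine Nat.le_of_dvd (by have := content_pos hu; positivity) ?_
  rw [← Int.natCast_dvd_natCast]
  have h4 : ((a * b * c * content u : ℕ) : ℤ) = (scaled a b c u).1 * (b * c * p) +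
      (scaled a b c u).2.1 * (a * c * q) + (scaled a b c u).2.2 * (a * b * r) := by
    have h5 : (content u : ℤ) = u.1 * p + u.2.1 * q + u.2.2 * r := h.symm
    simp only [scaled]
    push_cast
    rw [h5]
    ring
  rw [h4]
  exact dvd_add (dvd_add (h1.mul_right _) (h2.mul_right _)) (h3.mul_right _)

/-- The number of pairs of points of a cube with difference `u` and equal values. -/
noncomputable def diffCount (a b c R : ℕ) (u : ℤ × ℤ × ℤ) : ℕ :=
  #{v ∈ cube R | ternaryForm a b c (v + u) = ternaryForm a b c v}

lemma dot_scaled_eq_of_eq {a b c : ℕ} {u v w : ℤ × ℤ × ℤ}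
    (hv : ternaryForm a b c (v + u) = ternaryForm a b c v)
    (hw : ternaryForm a b c (w + u) = ternaryForm a b c w) :
    dot (scaled a b c u) v = dot (scaled a b c u) w := by
  simp only [ternaryForm, hexagonal, dot, scaled, Prod.fst_add, Prod.snd_add] at *
  linarith

lemma supNorm_mul_diffCount_le {a b c R : ℕ} (ha : 0 < a) (hb : 0 < b) (hc : 0 < c) (hR : 0 < R)
    {u : ℤ × ℤ × ℤ} (hu : u ≠ 0) (huR : supNorm u ≤ 2 * R) :
    supNorm u * diffCount a b c R u ≤
      (4 + 10 * (a + b + c)) * (a * b * c) * R ^ 2 * content u := by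
  rcases eq_or_ne (diffCount a b c R u) 0 with h0 | h0
  · rw [h0]; simp
  obtain ⟨v₀, hv₀⟩ := card_ne_zero.1 h0
  set β := scaled a b c u with hβ
  have hβ0 : β ≠ 0 := scaled_ne_zero ha hb hc hu
  have hle : diffCount a b c R u ≤
      #{v ∈ cube R | β.1 * v.1 + β.2.1 * v.2.1 + β.2.2 * v.2.2 = dot β v₀} := by
    refine card_le_card fun v hv => ?_
    rw [mem_filter] at hv hv₀ ⊢
    exact ⟨hv.1, dot_scaled_eq_of_eq hv.2 hv₀.2⟩
  obtain ⟨h1, h2, h3⟩ := content_dvd β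
  have hnorm : supNorm β ≤ 2 * (a + b + c) * R :=
    (supNorm_scaled_le a b c u).trans (by nlinarith)
  have hpos : 0 < supNorm β := Nat.pos_of_ne_zero fun h => hβ0 (supNorm_eq_zero.1 h)
  have key := card_linear_le (α₁ := β.1) (α₂ := β.2.1) (α₃ := β.2.2) (g := content β)
    (R := R) (B := (2 * (a + b + c) : ℕ)) (M := supNorm β) (dot β v₀) (by exact_mod_cast hR)
    (by exact_mod_cast hpos) (supNorm_spec β).2 (by exact_mod_cast hnorm)
    (by exact_mod_cast content_pos hβ0) h1 h2 h3 (exists_bezout_three _ _ _)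
  have key' : supNorm β * #{v ∈ cube R | β.1 * v.1 + β.2.1 * v.2.1 + β.2.2 * v.2.2 = dot β v₀} ≤
      (4 + 5 * (2 * (a + b + c))) * R ^ 2 * content β := by exact_mod_cast key
  calc supNorm u * diffCount a b c R u
      ≤ supNorm β * #{v ∈ cube R | β.1 * v.1 + β.2.1 * v.2.1 + β.2.2 * v.2.2 = dot β v₀} :=
        Nat.mul_le_mul (supNorm_le_supNorm_scaled ha hb hc u) hle
    _ ≤ (4 + 5 * (2 * (a + b + c))) * R ^ 2 * content β := key'
    _ ≤ (4 + 5 * (2 * (a + b + c))) * R ^ 2 * (a * b * c * content u) :=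
        Nat.mul_le_mul_left _ (content_scaled_le ha hb hc hu)
    _ = (4 + 10 * (a + b + c)) * (a * b * c) * R ^ 2 * content u := by ring

lemma diffCount_le {a b c R : ℕ} (ha : 0 < a) (hb : 0 < b) (hc : 0 < c) (hR : 0 < R)
    {u : ℤ × ℤ × ℤ} (hu : u ≠ 0) (huR : u ∈ cube (2 * R : ℕ)) :
    (diffCount a b c R u : ℝ) ≤
      ((4 + 10 * (a + b + c)) * (a * b * c) : ℕ) * R ^ 2 * ((content u : ℝ) / supNorm u) := by
  have hpos : 0 < supNorm u := Nat.pos_of_ne_zero fun h => hu (supNorm_eq_zero.1 h)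
  rw [← mul_div_assoc, le_div_iff₀ (by exact_mod_cast hpos), mul_comm]
  exact_mod_cast supNorm_mul_diffCount_le ha hb hc hR hu (mem_cube_iff_supNorm_le.1 huR)

open scoped Classical in
lemma card_pairs_le_sum (a b c R : ℕ) (P : ℤ × ℤ × ℤ → Prop) :
    #{p ∈ cube R ×ˢ cube R | ternaryForm a b c p.1 = ternaryForm a b c p.2 ∧ P (p.1 - p.2)} ≤
      ∑ u ∈ cube (2 * R : ℕ) with P u, diffCount a b c R u := by
  have hmaps : ∀ p ∈ ({p ∈ cube R ×ˢ cube R | ternaryForm a b c p.1 = ternaryForm a b c p.2 ∧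
      P (p.1 - p.2)} : Finset _), p.1 - p.2 ∈ ({u ∈ cube (2 * R : ℕ) | P u} : Finset _) := by
    intro p hp
    rw [mem_filter, mem_product, mem_cube, mem_cube] at hp
    obtain ⟨⟨⟨h1, h2, h3⟩, h4, h5, h6⟩, -, h7⟩ := hp
    rw [mem_filter, mem_cube]
    refine ⟨?_, h7⟩
    simp only [Prod.fst_sub, Prod.snd_sub, abs_le] at *
    push_cast
    refine ⟨⟨?_, ?_⟩, ⟨?_, ?_⟩, ?_, ?_⟩ <;> linarith
  rw [card_eq_sum_card_fiberwise hmaps]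
  refine sum_le_sum fun u _ => ?_
  refine card_le_card_of_injOn Prod.snd ?_ ?_
  · intro p hp
    rw [mem_coe, mem_filter, mem_filter] at hp
    obtain ⟨⟨h1, h2, -⟩, rfl⟩ := hp
    rw [mem_coe, mem_filter, add_sub_cancel]
    exact ⟨(mem_product.1 h1).2, h2⟩
  · intro p hp q hq h
    rw [mem_coe, mem_filter] at hp hq
    have h1 := hp.2.trans hq.2.symm
    rw [h] at h1
    exact Prod.ext (sub_left_injective h1) h

lemma diffCount_le_card (a b c R : ℕ) (u : ℤ × ℤ × ℤ) :
    diffCount a b c R u ≤ (2 * R + 1) ^ 3 :=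
  (card_filter_le _ _).trans (card_cube R).le

/-- The number of vectors of a cube on a plane through the origin. -/
lemma card_plane_le {β : ℤ × ℤ × ℤ} (hβ : β ≠ 0) (n : ℕ) :
    #{u ∈ cube n | dot β u = 0} ≤ (2 * n + 1) ^ 2 := by
  have hc : #(Icc (-(n : ℤ)) n) = 2 * n + 1 := by
    rw [Int.card_Icc]; omega
  have hc2 : #(Icc (-(n : ℤ)) n ×ˢ Icc (-(n : ℤ)) n) = (2 * n + 1) ^ 2 := by
    rw [card_product, hc]; ring
  rw [← hc2]
  have hmem : ∀ u ∈ ({u ∈ cube n | dot β u = 0} : Finset _), (u.1 ∈ Icc (-(n : ℤ)) n ∧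
      u.2.1 ∈ Icc (-(n : ℤ)) n ∧ u.2.2 ∈ Icc (-(n : ℤ)) n) ∧
      β.1 * u.1 + β.2.1 * u.2.1 + β.2.2 * u.2.2 = 0 := by
    intro u hu
    rwa [mem_filter, cube, mem_product, mem_product] at hu
  by_cases h1 : β.1 = 0
  · by_cases h2 : β.2.1 = 0
    · have h3 : β.2.2 ≠ 0 := fun h3 => hβ (by ext <;> simp [h1, h2, h3])
      refine card_le_card_of_injOn (fun u => (u.1, u.2.1)) ?_ ?_
      · exact fun u hu => mem_product.2 ⟨(hmem u hu).1.1, (hmem u hu).1.2.1⟩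
      · intro u hu v hv h
        obtain ⟨e1, e2⟩ := Prod.mk.inj h
        have e3 := (hmem u hu).2.trans (hmem v hv).2.symm
        rw [e1, e2] at e3
        exact Prod.ext e1 (Prod.ext e2 (mul_left_cancel₀ h3 (by linarith)))
    · refine card_le_card_of_injOn (fun u => (u.1, u.2.2)) ?_ ?_
      · exact fun u hu => mem_product.2 ⟨(hmem u hu).1.1, (hmem u hu).1.2.2⟩
      · intro u hu v hv h
        obtain ⟨e1, e2⟩ := Prod.mk.inj h
        have e3 := (hmem u hu).2.trans (hmem v hv).2.symm
        rw [e1, e2] at e3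
        exact Prod.ext e1 (Prod.ext (mul_left_cancel₀ h2 (by linarith)) e2)
  · refine card_le_card_of_injOn (fun u => (u.2.1, u.2.2)) ?_ ?_
    · exact fun u hu => mem_product.2 ⟨(hmem u hu).1.2.1, (hmem u hu).1.2.2⟩
    · intro u hu v hv h
      obtain ⟨e1, e2⟩ := Prod.mk.inj h
      have e3 := (hmem u hu).2.trans (hmem v hv).2.symm
      rw [e1, e2] at e3
      exact Prod.ext (mul_left_cancel₀ h1 (by linarith)) (Prod.ext e1 e2)

/-! ### Pairs whose difference does not reach -/

lemma reaches_of_no_relation {a b c : ℕ} (ha : 0 < a) (hb : 0 < b) (hc : 0 < c) {T W K L : ℕ}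
    {u : ℤ × ℤ × ℤ} (hu : u ≠ 0) (hW : 4 * content (scaled a b c u) ∣ W)
    (hL0 : 0 < L) (hL : ∀ e ∈ cube L, dot (scaled a b c u) e = 0 → e = 0)
    (h1 : W * K ≤ 2 * supNorm u * T) (h2 : 16 * ((a + b + c) * supNorm u) ≤ L * T) :
    Reaches a b c T W K u := by
  intro k hk
  set β := scaled a b c u with hβ
  have hβ0 : β ≠ 0 := scaled_ne_zero ha hb hc hu
  have hpos : 0 < supNorm β := Nat.pos_of_ne_zero fun h => hβ0 (supNorm_eq_zero.1 h)
  obtain ⟨w, hw⟩ := hW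
  obtain ⟨p, q, r, hpqr⟩ := exists_bezout_three β.1 β.2.1 β.2.2
  have hpqr' : β.1 * p + β.2.1 * q + β.2.2 * r = (content β : ℤ) := hpqr
  obtain ⟨⟨hb1, hb2, hb3⟩, hmax⟩ := supNorm_spec β
  obtain ⟨t₁, t₂, t₃, ht, ht1, ht2, ht3⟩ := exists_small_solution β.1 β.2.1 β.2.2
    (content β * w * k) (supNorm β) (by exact_mod_cast hpos) hb1 hb2 hb3 hmax
    ⟨p * (w * k), q * (w * k), r * (w * k), by rw [mul_assoc, ← hpqr']; ring⟩ (L := L)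
    (fun e₁ e₂ e₃ he l1 l2 l3 => by
      have := hL (e₁, e₂, e₃) (mem_cube.2 ⟨l1.le, l2.le, l3.le⟩) he
      simpa using this) (by positivity)
  have hM1 := supNorm_le_supNorm_scaled ha hb hc u
  have hM2 := supNorm_scaled_le a b c u
  rw [← hβ] at hM1 hM2
  have habs : |(content β : ℤ) * w * k| = content β * w * k := abs_of_nonneg (by positivity)
  rw [habs] at ht1 ht2 ht3
  have h3 : 4 * (content β * w * k) ≤ 2 * supNorm β * T := by
    calc 4 * (content β * w * k) = W * k := by rw [hw]; ring
      _ ≤ W * K := Nat.mul_le_mul_left _ hk.le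
      _ ≤ 2 * supNorm u * T := h1
      _ ≤ 2 * supNorm β * T := by gcongr
  have h4 : 16 * supNorm β ≤ L * T := (Nat.mul_le_mul_left 16 hM2).trans h2
  have h5 : L * (content β * w * k) + 8 * supNorm β ^ 2 ≤ L * supNorm β * T := by
    nlinarith [Nat.mul_le_mul_left L h3, Nat.mul_le_mul_left (supNorm β) h4]
  have h5' : (L : ℤ) * (content β * w * k) + 8 * supNorm β ^ 2 ≤ L * supNorm β * T := by
    exact_mod_cast h5
  have hLM : (0 : ℤ) < L * supNorm β := by positivity
  refine ⟨(t₁, t₂, t₃), mem_cube.2 ⟨le_of_mul_le_mul_left (ht1.trans h5') hLM,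
    le_of_mul_le_mul_left (ht2.trans h5') hLM, le_of_mul_le_mul_left (ht3.trans h5') hLM⟩, ?_⟩
  have h6 : dot β (t₁, t₂, t₃) = content β * w * k := ht
  rw [h6, hw]
  push_cast
  ring

lemma dot_scaled_comm (a b c : ℕ) (u v : ℤ × ℤ × ℤ) :
    dot (scaled a b c u) v = dot (scaled a b c v) u := by
  simp only [dot, scaled]
  ring

open scoped Classical in
lemma sum_diffCount_relation_le {a b c R : ℕ} (ha : 0 < a) (hb : 0 < b) (hc : 0 < c) (hR : 0 < R)
    (L : ℕ) {n d₀ : ℕ} (hn : 0 < n) :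
    (∑ u ∈ cube (2 * R : ℕ) with u ≠ 0 ∧ content u < d₀ ∧ n < supNorm u ∧
      ∃ e ∈ cube L, e ≠ 0 ∧ dot (scaled a b c u) e = 0, (diffCount a b c R u : ℝ)) ≤
    (2 * L + 1) ^ 3 * (4 * R + 1) ^ 2 *
      (((4 + 10 * (a + b + c)) * (a * b * c) : ℕ) * R ^ 2 * (d₀ / n)) := by
  set S : Finset (ℤ × ℤ × ℤ) := {u ∈ cube (2 * R : ℕ) | u ≠ 0 ∧ content u < d₀ ∧
    n < supNorm u ∧ ∃ e ∈ cube L, e ≠ 0 ∧ dot (scaled a b c u) e = 0} with hS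
  have hcard : #S ≤ (2 * L + 1) ^ 3 * (4 * R + 1) ^ 2 := by
    have hsub : S ⊆ (cube L \ {0}).biUnion fun e =>
        {u ∈ cube (2 * R : ℕ) | dot (scaled a b c e) u = 0} := by
      intro u hu
      obtain ⟨h1, -, -, -, e, he, he0, hd⟩ := mem_filter.1 hu
      refine mem_biUnion.2 ⟨e, mem_sdiff.2 ⟨he, by simpa using he0⟩, mem_filter.2 ⟨h1, ?_⟩⟩
      rw [dot_scaled_comm, hd]
    refine (card_le_card hsub).trans (card_biUnion_le.trans ?_)
    calc ∑ e ∈ cube L \ {0}, #{u ∈ cube (2 * R : ℕ) | dot (scaled a b c e) u = 0}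
        ≤ ∑ e ∈ cube L \ {0}, (2 * (2 * R) + 1) ^ 2 := by
          refine sum_le_sum fun e he => card_plane_le (scaled_ne_zero ha hb hc ?_) _
          simpa using (mem_sdiff.1 he).2
      _ ≤ (2 * L + 1) ^ 3 * (4 * R + 1) ^ 2 := by
          rw [sum_const, smul_eq_mul, ← card_cube L]
          exact Nat.mul_le_mul (card_le_card sdiff_subset) (le_of_eq (by ring))
  have hterm : ∀ u ∈ S, (diffCount a b c R u : ℝ) ≤
      ((4 + 10 * (a + b + c)) * (a * b * c) : ℕ) * R ^ 2 * (d₀ / n) := by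
    intro u hu
    obtain ⟨h1, h2, h3, h4, -⟩ := mem_filter.1 hu
    refine (diffCount_le ha hb hc hR h2 h1).trans ?_
    have hn' : (0 : ℝ) < n := by exact_mod_cast hn
    have h3' : (content u : ℝ) ≤ d₀ := by exact_mod_cast h3.le
    have h4' : (n : ℝ) ≤ supNorm u := by exact_mod_cast h4.le
    gcongr
  refine (sum_le_card_nsmul S _ _ hterm).trans ?_
  rw [nsmul_eq_mul]
  have hcard' : (#S : ℝ) ≤ (2 * L + 1) ^ 3 * (4 * R + 1) ^ 2 := by exact_mod_cast hcard
  gcongr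

open scoped Classical in
lemma card_not_reaches_le {a b c : ℕ} (ha : 0 < a) (hb : 0 < b) (hc : 0 < c)
    {R T W K L n d₀ : ℕ} (hR : 0 < R) (hL : 0 < L) (hn : 0 < n) (hd₀ : 0 < d₀)
    (hW : ∀ g, 0 < g → g ≤ a * b * c * d₀ → 4 * g ∣ W)
    (h1 : W * K ≤ 2 * n * T) (h2 : 32 * ((a + b + c) * R) ≤ L * T) :
    (#{p ∈ cube R ×ˢ cube R | ternaryForm a b c p.1 = ternaryForm a b c p.2 ∧
        ¬ Reaches a b c T W K (p.1 - p.2)} : ℝ) ≤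
      (2 * R + 1) ^ 3 + ((4 + 10 * (a + b + c)) * (a * b * c) : ℕ) * R ^ 2 *
        (208 * R ^ 2 / d₀ + 52 * n ^ 2 + (2 * L + 1) ^ 3 * (4 * R + 1) ^ 2 * (d₀ / n)) := by
  set C : ℕ := (4 + 10 * (a + b + c)) * (a * b * c) with hC
  set U := cube (2 * R : ℕ) with hU
  have hcases : ({u ∈ U | ¬ Reaches a b c T W K u} : Finset _) ⊆
      {0} ∪ ({u ∈ U | u ≠ 0 ∧ d₀ ≤ content u} ∪ ({u ∈ U | u ≠ 0 ∧ supNorm u ≤ n} ∪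
        {u ∈ U | u ≠ 0 ∧ content u < d₀ ∧ n < supNorm u ∧
          ∃ e ∈ cube L, e ≠ 0 ∧ dot (scaled a b c u) e = 0})) := by
    intro u hu
    obtain ⟨huU, hr⟩ := mem_filter.1 hu
    simp only [mem_union, mem_singleton, mem_filter]
    by_contra! hcon
    obtain ⟨hu0, hcont, hnorm, hrel⟩ := hcon
    have hcont' := hcont huU hu0
    have hnorm' := hnorm huU hu0
    refine hr (reaches_of_no_relation ha hb hc hu0 (hW _ (content_pos (scaled_ne_zero ha hb hc hu0))
      ((content_scaled_le ha hb hc hu0).trans (Nat.mul_le_mul_left _ hcont'.le))) hL ?_ ?_ ?_)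
    · intro e he hd
      by_contra he0
      exact hrel huU hu0 hcont' hnorm' e he he0 hd
    · exact h1.trans (by gcongr)
    · refine le_trans ?_ h2
      have := mem_cube_iff_supNorm_le.1 huU
      nlinarith [Nat.mul_le_mul_left (a + b + c) this]
  have hbound : ∀ u ∈ U, u ≠ 0 → (diffCount a b c R u : ℝ) ≤
      C * R ^ 2 * ((content u : ℝ) / supNorm u) := fun u hu hu0 => diffCount_le ha hb hc hR hu0 hu
  have e1 : (∑ u ∈ ({0} : Finset (ℤ × ℤ × ℤ)), (diffCount a b c R u : ℝ)) ≤ (2 * R + 1) ^ 3 := by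
    rw [sum_singleton]
    exact_mod_cast diffCount_le_card a b c R 0
  have e2 : (∑ u ∈ U with u ≠ 0 ∧ d₀ ≤ content u, (diffCount a b c R u : ℝ)) ≤
      C * R ^ 2 * (208 * R ^ 2 / d₀) := by
    refine (sum_le_sum fun u hu => hbound u (mem_filter.1 hu).1 (mem_filter.1 hu).2.1).trans ?_
    rw [← mul_sum]
    refine mul_le_mul_of_nonneg_left ((sum_content_div_supNorm_le (2 * R) hd₀).trans ?_)
      (by positivity)
    refine le_of_eq ?_
    push_cast
    ring
  have e3 : (∑ u ∈ U with u ≠ 0 ∧ supNorm u ≤ n, (diffCount a b c R u : ℝ)) ≤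
      C * R ^ 2 * (52 * n ^ 2) := by
    refine (sum_le_sum fun u hu => hbound u (mem_filter.1 hu).1 (mem_filter.1 hu).2.1).trans ?_
    rw [← mul_sum]
    refine mul_le_mul_of_nonneg_left ?_ (by positivity)
    have := sum_content_div_supNorm_le n one_pos
    rw [Nat.cast_one, div_one] at this
    refine le_trans (sum_le_sum_of_subset_of_nonneg ?_ fun _ _ _ => by positivity) this
    intro u hu
    obtain ⟨-, h3, h4⟩ := mem_filter.1 hu
    exact mem_filter.2 ⟨mem_cube_iff_supNorm_le.2 h4, h3, content_pos h3⟩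
  have e4 := sum_diffCount_relation_le ha hb hc hR L (d₀ := d₀) hn
  rw [← hC, ← hU] at e4
  have hunion : ∀ A B : Finset (ℤ × ℤ × ℤ), (∑ u ∈ A ∪ B, (diffCount a b c R u : ℝ)) ≤
      ∑ u ∈ A, (diffCount a b c R u : ℝ) + ∑ u ∈ B, (diffCount a b c R u : ℝ) := by
    intro A B
    rw [← sum_union_inter]
    exact le_add_of_nonneg_right (sum_nonneg fun _ _ => by positivity)
  have e0 : (#{p ∈ cube R ×ˢ cube R | ternaryForm a b c p.1 = ternaryForm a b c p.2 ∧
      ¬ Reaches a b c T W K (p.1 - p.2)} : ℝ) ≤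
      ∑ u ∈ U with ¬ Reaches a b c T W K u, (diffCount a b c R u : ℝ) := by
    rw [hU, ← Nat.cast_sum, Nat.cast_le]
    convert card_pairs_le_sum a b c R fun u => ¬ Reaches a b c T W K u
  calc _ ≤ _ := e0
    _ ≤ _ := sum_le_sum_of_subset_of_nonneg hcases fun _ _ _ => by positivity
    _ ≤ _ := (hunion _ _).trans (add_le_add e1 ((hunion _ _).trans (add_le_add e2
        ((hunion _ _).trans (add_le_add e3 e4)))))
    _ = _ := by ring

open Filter

/-! ### Comparison of the pair counts -/

open scoped Classical in
lemma sum_pairCount_sub_le_of_bounds {a b c : ℕ} (ha : 0 < a) {R T W K : ℕ} (hW : 0 < W)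
    (hR : 0 < R) (hT : T ≤ R) {B : ℝ}
    (hB : (#{p ∈ cube R ×ˢ cube R | ternaryForm a b c p.1 = ternaryForm a b c p.2 ∧
        ¬ Reaches a b c T W K (p.1 - p.2)} : ℝ) ≤ B) :
    ∑ k ∈ range K, ((pairCount a b c R 0 : ℝ) - pairCount a b c R (W * k)) ≤
      K * B + 15000 * T * R ^ 4 * (Nat.sqrt (W * K) + 1) := by
  have h1 : ∑ k ∈ range K, (pairCount a b c R 0 : ℝ) ≤
      ∑ k ∈ range K, ((pairCount a b c (R + T) (W * k) : ℝ) + B) := by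
    refine sum_le_sum fun k hk => ?_
    have := pairCount_zero_le a b c R T W K (mem_range.1 hk)
    have h : (pairCount a b c R 0 : ℝ) ≤ pairCount a b c (R + T) (W * k) +
      #{p ∈ cube R ×ˢ cube R | ternaryForm a b c p.1 = ternaryForm a b c p.2 ∧
        ¬ Reaches a b c T W K (p.1 - p.2)} := by exact_mod_cast this
    linarith
  have h2 := sum_pairCount_add_le (b := b) (c := c) ha (R := R) (T := T) (K := K) hW
  have h3 : 2 * (((2 * (R + T) + 1) ^ 3 - (2 * R + 1) ^ 3) *
        ((2 * (R + T) + 1) ^ 2 * (2 * (Nat.sqrt (W * K) + 1)))) ≤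
      15000 * T * R ^ 4 * (Nat.sqrt (W * K) + 1) := by
    have h4 : 2 * (R + T) + 1 ≤ 5 * R := by omega
    have h5 : (2 * (R + T) + 1) ^ 3 - (2 * R + 1) ^ 3 ≤ 150 * T * R ^ 2 := by
      rw [Nat.sub_le_iff_le_add]
      calc (2 * (R + T) + 1) ^ 3 = 2 * T * ((2 * (R + T) + 1) ^ 2 +
            (2 * (R + T) + 1) * (2 * R + 1) + (2 * R + 1) ^ 2) + (2 * R + 1) ^ 3 := by ring
        _ ≤ 2 * T * ((5 * R) ^ 2 + 5 * R * (5 * R) + (5 * R) ^ 2) + (2 * R + 1) ^ 3 := by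
            gcongr <;> omega
        _ = 150 * T * R ^ 2 + (2 * R + 1) ^ 3 := by ring
    calc _ ≤ 2 * ((150 * T * R ^ 2) * ((5 * R) ^ 2 * (2 * (Nat.sqrt (W * K) + 1)))) := by gcongr
      _ = _ := by ring
  have h4 : ∑ k ∈ range K, (pairCount a b c (R + T) (W * k) : ℝ) ≤
      ∑ k ∈ range K, (pairCount a b c R (W * k) : ℝ) +
        15000 * T * R ^ 4 * (Nat.sqrt (W * K) + 1) := by
    exact_mod_cast h2.trans (Nat.add_le_add_left h3 _)
  rw [sum_add_distrib, sum_const (B), card_range, nsmul_eq_mul] at h1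
  rw [sum_sub_distrib]
  linarith

lemma half_le_floor {x : ℝ} (hx : 1 ≤ x) : x / 2 ≤ (⌊x⌋₊ : ℝ) := by
  have h1 := Nat.lt_floor_add_one x
  have h2 : (1 : ℝ) ≤ ⌊x⌋₊ := by exact_mod_cast Nat.one_le_floor_iff x |>.2 hx
  linarith

lemma exceptional_bound_le {C d₀ L n R σ ε : ℝ} (hε : 0 < ε) (hσ0 : 0 < σ) (hσ1 : σ ≤ 1)
    (hn : 0 < n) (hn1 : n ≤ σ * R) (hn2 : σ * R / 2 ≤ n) (hR1 : 1 ≤ R) (hC : 0 < C) (hd₀' : 0 < d₀)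
    (hL : 0 ≤ L) (hd₀ : 1664 * C ≤ d₀ * ε) (hRε : 216 ≤ R * ε)
    (hRL : 400 * C * (2 * L + 1) ^ 3 * d₀ ≤ R * (σ * ε)) (hσ : 416 * C * σ = ε) :
    (2 * R + 1) ^ 3 + C * R ^ 2 *
      (208 * R ^ 2 / d₀ + 52 * n ^ 2 + (2 * L + 1) ^ 3 * (4 * R + 1) ^ 2 * (d₀ / n)) ≤
      ε / 2 * R ^ 4 := by
  have hR0' : 0 < R := by linarith
  have t1 : (2 * R + 1) ^ 3 ≤ ε / 8 * R ^ 4 := by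
    calc (2 * R + 1) ^ 3 ≤ (3 * R) ^ 3 := by gcongr; linarith
      _ = 216 / 8 * R ^ 3 := by ring
      _ ≤ R * ε / 8 * R ^ 3 := by gcongr
      _ = ε / 8 * R ^ 4 := by ring
  have t2 : C * R ^ 2 * (208 * R ^ 2 / d₀) ≤ ε / 8 * R ^ 4 := by
    calc C * R ^ 2 * (208 * R ^ 2 / d₀) = 1664 * C / (8 * d₀) * R ^ 4 := by
          field_simp; ring
      _ ≤ d₀ * ε / (8 * d₀) * R ^ 4 := by gcongr
      _ = ε / 8 * R ^ 4 := by field_simp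
  have t3 : C * R ^ 2 * (52 * n ^ 2) ≤ ε / 8 * R ^ 4 := by
    calc C * R ^ 2 * (52 * n ^ 2) ≤ C * R ^ 2 * (52 * (σ * R) ^ 2) := by gcongr
      _ = (416 * C * σ) * σ / 8 * R ^ 4 := by ring
      _ = ε * σ / 8 * R ^ 4 := by
          rw [hσ]
      _ ≤ ε * 1 / 8 * R ^ 4 := by gcongr
      _ = ε / 8 * R ^ 4 := by ring
  have t4 : C * R ^ 2 * ((2 * L + 1) ^ 3 * (4 * R + 1) ^ 2 * (d₀ / n)) ≤
      ε / 8 * R ^ 4 := by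
    calc C * R ^ 2 * ((2 * L + 1) ^ 3 * (4 * R + 1) ^ 2 * (d₀ / n))
        ≤ C * R ^ 2 * ((2 * L + 1) ^ 3 * (5 * R) ^ 2 * (d₀ / (σ * R / 2))) := by
          gcongr
          linarith
      _ = 400 * C * (2 * L + 1) ^ 3 * d₀ * R ^ 3 / (8 * σ) := by
          field_simp
          ring
      _ ≤ (R * (σ * ε)) * R ^ 3 / (8 * σ) := by gcongr
      _ = ε / 8 * R ^ 4 := by field_simp
  linarith

set_option maxHeartbeats 1000000 in
theorem exists_sum_pairCount_sub_le {a b c : ℕ} (ha : 0 < a) (hb : 0 < b) (hc : 0 < c)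
    {ε : ℝ} (hε : 0 < ε) (hε1 : ε ≤ 1) : ∃ Q : ℕ, ∀ W : ℕ, 0 < W →
      (∀ g, 0 < g → g ≤ Q → 4 * g ∣ W) → ∃ δ : ℝ, 0 < δ ∧ W * δ ≤ 1 / 1000 ∧
        ∀ᶠ R : ℕ in atTop, ∑ k ∈ range ⌊δ * (R : ℝ) ^ 2⌋₊,
          ((pairCount a b c R 0 : ℝ) - pairCount a b c R (W * k)) ≤
            ⌊δ * (R : ℝ) ^ 2⌋₊ * (ε * (R : ℝ) ^ 4) := by
  classical
  set C : ℕ := (4 + 10 * (a + b + c)) * (a * b * c) with hC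
  have hC1 : 1 ≤ C := Nat.succ_le_of_lt (by positivity)
  have hC1' : (1 : ℝ) ≤ C := by exact_mod_cast hC1
  obtain ⟨d₀, hd₀⟩ := exists_nat_ge (1664 * C / ε)
  have hd₀' : (0 : ℝ) < d₀ := lt_of_lt_of_le (by positivity) hd₀
  have hd₀0 : 0 < d₀ := by exact_mod_cast hd₀'
  set σ : ℝ := ε / (416 * C) with hσ
  have hσ0 : 0 < σ := by positivity
  have hσ1 : σ ≤ 1 := by
    rw [hσ, div_le_one (by positivity)]
    linarith
  refine ⟨a * b * c * d₀, fun W hW hdvd => ?_⟩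
  have hW1 : (1 : ℝ) ≤ W := by exact_mod_cast hW
  have hW0 : (0 : ℝ) < W := by linarith
  set θ : ℝ := σ * ε / (240000 * W ^ 2) with hθ
  have hθ0 : 0 < θ := by positivity
  have hθW : W * θ ≤ 1 / 240000 := by
    have h1 : W * θ = σ * ε / (240000 * W) := by
      rw [hθ]; field_simp
    have h2 : σ * ε ≤ 1 := mul_le_one₀ hσ1 hε.le hε1
    rw [h1, div_le_div_iff₀ (by positivity) (by positivity)]
    linarith
  have hθ1 : θ ≤ 1 / 240000 := le_trans (by nlinarith) hθW
  set τ : ℝ := ε * θ / (120000 * W) with hτ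
  have hτ0 : 0 < τ := by positivity
  have hτ1 : τ ≤ 1 := by
    have : ε * θ ≤ 1 := mul_le_one₀ hε1 hθ0.le (by linarith)
    rw [hτ, div_le_one (by positivity)]
    linarith
  obtain ⟨L, hL⟩ := exists_nat_ge (64 * (a + b + c) / τ)
  have hL' : (0 : ℝ) < L := by
    refine lt_of_lt_of_le ?_ hL
    have : (0 : ℝ) < a := by exact_mod_cast ha
    positivity
  have hL0 : 0 < L := by exact_mod_cast hL'
  refine ⟨θ ^ 2, by positivity, by nlinarith, ?_⟩
  have hev : ∀ X : ℝ, ∀ᶠ R : ℕ in atTop, X ≤ R := fun X =>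
    tendsto_natCast_atTop_atTop.eventually_ge_atTop X
  filter_upwards [hev 1, hev (1 / σ), hev (1 / τ), hev (1 / θ), hev (216 / ε),
    hev (400 * C * (2 * L + 1) ^ 3 * d₀ / (σ * ε))] with R hR1 hRσ hRτ hRθ hRε hRL
  have hR0' : (0 : ℝ) < R := by linarith
  have hR0 : 0 < R := by exact_mod_cast hR0'
  rw [div_le_iff₀ hσ0, mul_comm] at hRσ
  rw [div_le_iff₀ hτ0, mul_comm] at hRτ
  rw [div_le_iff₀ hθ0, mul_comm] at hRθ
  rw [div_le_iff₀ hε] at hRε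
  rw [div_le_iff₀ (by positivity)] at hRL
  rw [div_le_iff₀ hε] at hd₀
  rw [div_le_iff₀ hτ0] at hL
  set n : ℕ := ⌊σ * R⌋₊ with hn
  set T : ℕ := ⌊τ * R⌋₊ with hT
  set K : ℕ := ⌊θ ^ 2 * (R : ℝ) ^ 2⌋₊ with hK
  have hn1 : (n : ℝ) ≤ σ * R := Nat.floor_le (by positivity)
  have hn2 : σ * R / 2 ≤ n := half_le_floor hRσ
  have hT1 : (T : ℝ) ≤ τ * R := Nat.floor_le (by positivity)
  have hT2 : τ * R / 2 ≤ T := half_le_floor hRτ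
  have hK1 : (K : ℝ) ≤ θ ^ 2 * (R : ℝ) ^ 2 := Nat.floor_le (by positivity)
  have hK2 : θ ^ 2 * (R : ℝ) ^ 2 / 2 ≤ K := half_le_floor (by nlinarith)
  have hn0' : (0 : ℝ) < n := lt_of_lt_of_le (by positivity) hn2
  have hTR : T ≤ R := by
    have : (T : ℝ) ≤ R := hT1.trans (by nlinarith)
    exact_mod_cast this
  have hWK : W * K ≤ 2 * n * T := by
    have h1 : (W : ℝ) * K ≤ 2 * n * T := by
      calc (W : ℝ) * K ≤ W * (θ ^ 2 * (R : ℝ) ^ 2) := by gcongr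
        _ = 2 * (σ * R / 2) * (τ * R / 2) := by
            rw [hτ, pow_two θ]
            nth_rewrite 2 [hθ]
            field_simp
            ring
        _ ≤ 2 * n * T := by gcongr
    exact_mod_cast h1
  have hLT : 32 * ((a + b + c) * R) ≤ L * T := by
    have h1 : (32 : ℝ) * ((a + b + c) * R) ≤ L * T := by
      calc (32 : ℝ) * ((a + b + c) * R) = 64 * (a + b + c) * (R / 2) := by ring
        _ ≤ L * τ * (R / 2) := by gcongr
        _ = L * (τ * R / 2) := by ring
        _ ≤ L * T := by gcongr
    exact_mod_cast h1
  have hbad := card_not_reaches_le ha hb hc hR0 hL0 (by exact_mod_cast hn0') hd₀0 hdvd hWK hLT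
  rw [← hC] at hbad
  have hbad' := hbad.trans (show _ ≤ ε / 2 * (R : ℝ) ^ 4 from ?_)
  · refine (sum_pairCount_sub_le_of_bounds ha hW hR0 hTR hbad').trans ?_
    have hs : (Nat.sqrt (W * K) : ℝ) ≤ W * θ * R := by
      refine le_of_sq_le_sq ?_ (by positivity)
      have h1 : ((Nat.sqrt (W * K) : ℝ)) ^ 2 ≤ W * K := by
        exact_mod_cast Nat.sqrt_le' (W * K)
      refine h1.trans ?_
      calc (W : ℝ) * K ≤ W * W * (θ ^ 2 * (R : ℝ) ^ 2) := by
            gcongr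
            nlinarith
        _ = (W * θ * R) ^ 2 := by ring
    have hs' : (Nat.sqrt (W * K) : ℝ) + 1 ≤ 2 * (W * θ * R) := by nlinarith
    have h2 : 15000 * (T : ℝ) * (R : ℝ) ^ 4 * (Nat.sqrt (W * K) + 1) ≤
        K * (ε / 2 * (R : ℝ) ^ 4) := by
      calc 15000 * (T : ℝ) * (R : ℝ) ^ 4 * (Nat.sqrt (W * K) + 1)
          ≤ 15000 * (τ * R) * (R : ℝ) ^ 4 * (2 * (W * θ * R)) := by gcongr
        _ = (θ ^ 2 * (R : ℝ) ^ 2 / 2) * (ε / 2 * (R : ℝ) ^ 4) := by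
            rw [hτ]
            field_simp
            ring
        _ ≤ K * (ε / 2 * (R : ℝ) ^ 4) := by gcongr
    linarith
  · exact exceptional_bound_le hε hσ0 hσ1 hn0' hn1 hn2 hR1 (by positivity) hd₀' hL'.le hd₀ hRε hRL
      (by rw [hσ]; field_simp)

/-! ### Representations in a short progression -/

/-- The number of representations of `j` in a cube. -/
noncomputable def repCount (a b c R : ℕ) (j : ℤ) : ℕ := #{v ∈ cube R | ternaryForm a b c v = j}

lemma div_le_card_residue (W : ℕ) [NeZero W] (m : ℤ) (J : ℕ) (r : ZMod W) :
    J / W ≤ #{x ∈ Ico m (m + J) | ((x : ℤ) : ZMod W) = r} := by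
  have hW : 0 < W := Nat.pos_of_ne_zero (NeZero.ne W)
  set s : ℕ := (r - m).val with hs
  have hsW : s < W := ZMod.val_lt _
  have hcast : ((m + s : ℤ) : ZMod W) = r := by
    push_cast
    rw [hs, ZMod.natCast_zmod_val]
    ring
  rw [← card_range (J / W)]
  refine card_le_card_of_injOn (fun i : ℕ => m + s + W * i) ?_ ?_
  · intro i hi
    have hi' : i + 1 ≤ J / W := mem_range.1 hi
    have h1 : (i + 1) * W ≤ J := (Nat.le_div_iff_mul_le hW).1 hi'
    have h2 : s + W * i < J := by nlinarith
    refine mem_filter.2 ⟨mem_Ico.2 ⟨?_, ?_⟩, ?_⟩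
    · dsimp only
      rw [add_assoc]
      exact le_add_of_nonneg_right (by positivity)
    · dsimp only
      rw [add_assoc]
      have : ((s : ℤ) + W * i) < J := by exact_mod_cast h2
      linarith
    · dsimp only
      rw [Int.cast_add, hcast]
      simp
  · intro i _ j _ hij
    have h1 : (W : ℤ) * i = W * j := add_left_cancel hij
    have h2 : W * i = W * j := by exact_mod_cast h1
    exact Nat.eq_of_mul_eq_mul_left hW h2

lemma exists_interval_hexagonal {a : ℕ} (ha : 0 < a) {R J H : ℕ} {n : ℤ} (hn : 0 < n)
    (hnR : 8 * n ≤ (R : ℤ) ^ 2) (hR : 8 ≤ R) (hJ : 4 * J ≤ R) (hJH : 2 * a * J * R ≤ H) :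
    ∃ x₁ : ℤ, ∀ x ∈ Ico x₁ (x₁ + J), |x| ≤ R ∧ n ≤ a * hexagonal x ∧ a * hexagonal x < n + H := by
  have ha' : (1 : ℤ) ≤ a := by exact_mod_cast ha
  have hex : ∃ m : ℕ, n ≤ a * hexagonal (m : ℤ) := by
    refine ⟨n.toNat, ?_⟩
    rw [Int.toNat_of_nonneg hn.le]
    simp only [hexagonal]
    nlinarith [sq_nonneg n]
  classical
  set m := Nat.find hex with hm
  have hm1 : n ≤ a * hexagonal (m : ℤ) := Nat.find_spec hex
  have hm0 : m ≠ 0 := by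
    intro h0
    rw [h0] at hm1
    simp [hexagonal] at hm1
    omega
  obtain ⟨l, hl⟩ := Nat.exists_eq_succ_of_ne_zero hm0
  have hm2 : a * hexagonal (l : ℤ) < n := not_le.1 (Nat.find_min hex (by omega : l < m))
  have hml : (m : ℤ) = l + 1 := by rw [hl]; push_cast; ring
  have hl0 : (0 : ℤ) ≤ l := by positivity
  have hlR : 4 * (l : ℤ) ≤ R := by
    have h1 : (a : ℤ) * (2 * (l : ℤ) ^ 2) ≤ a * hexagonal (l : ℤ) := by
      simp only [hexagonal]
      gcongr
      linarith
    have h2 : 2 * (l : ℤ) ^ 2 ≤ a * (2 * (l : ℤ) ^ 2) := le_mul_of_one_le_left (by positivity) ha'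
    have h3 : (4 * (l : ℤ)) ^ 2 ≤ (R : ℤ) ^ 2 := by linarith
    exact le_of_sq_le_sq h3 (by positivity)
  refine ⟨m, fun x hx => ?_⟩
  rw [mem_Ico] at hx
  have hJ' : 4 * (J : ℤ) ≤ R := by exact_mod_cast hJ
  have hR' : (8 : ℤ) ≤ R := by exact_mod_cast hR
  have hx0 : (0 : ℤ) ≤ x := by linarith
  have hxl : x - l ≤ J := by linarith
  refine ⟨?_, ?_, ?_⟩
  · rw [abs_of_nonneg hx0]
    linarith
  · refine hm1.trans ?_
    gcongr
    simp only [hexagonal]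
    nlinarith
  · have h1 : hexagonal x - hexagonal (l : ℤ) ≤ J * (2 * R) := by
      have h2 : hexagonal x - hexagonal (l : ℤ) = (x - l) * (2 * x + 2 * l + 1) := by
        simp only [hexagonal]; ring
      rw [h2]
      refine mul_le_mul hxl (by linarith) (by linarith) (by positivity)
    have h3 : (a : ℤ) * (J * (2 * R)) ≤ H := by
      have : a * (J * (2 * R)) ≤ H := le_trans (le_of_eq (by ring)) hJH
      exact_mod_cast this
    have h4 := mul_le_mul_of_nonneg_left h1 (show (0 : ℤ) ≤ a by positivity)
    linarith

/-- The reduction of an integer vector modulo `W`. -/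
def castZMod (W : ℕ) (v : ℤ × ℤ × ℤ) : ZMod W × ZMod W × ZMod W := (v.1, v.2.1, v.2.2)

lemma ternaryForm_castZMod (a b c W : ℕ) (v : ℤ × ℤ × ℤ) :
    ternaryForm a b c (castZMod W v) = ((ternaryForm a b c v : ℤ) : ZMod W) :=
  (map_ternaryForm (Int.castRingHom (ZMod W)) a b c v).symm

lemma le_card_residue_class {a : ℕ} (ha : 0 < a) (b c : ℕ) {R J H Y : ℕ} {n : ℤ}
    (hnR : 8 * n ≤ (R : ℤ) ^ 2) (hR : 8 ≤ R) (hJ : 4 * J ≤ R) (hJH : 2 * a * J * R ≤ H)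
    (hY : Y ≤ R) (hYn : 3 * ((b : ℤ) + c) * Y ^ 2 < n) (W : ℕ) [NeZero W]
    (ω : ZMod W × ZMod W × ZMod W) :
    J / W * ((Y / W) * (Y / W)) ≤ #{v ∈ cube R | castZMod W v = ω ∧
      n ≤ ternaryForm a b c v ∧ ternaryForm a b c v < n + (H : ℤ)} := by
  have hhex : ∀ y ∈ Ico (0 : ℤ) (0 + Y), 0 ≤ hexagonal y ∧ hexagonal y ≤ 3 * (Y : ℤ) ^ 2 := by
    intro y hy
    rw [mem_Ico] at hy
    simp only [hexagonal]
    constructor <;> nlinarith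
  set G : Finset (ℤ × ℤ) := {y ∈ Ico (0 : ℤ) (0 + Y) | ((y : ℤ) : ZMod W) = ω.2.1} ×ˢ
    {z ∈ Ico (0 : ℤ) (0 + Y) | ((z : ℤ) : ZMod W) = ω.2.2} with hG
  have hGcard : Y / W * (Y / W) ≤ #G := by
    rw [hG, card_product]
    exact Nat.mul_le_mul (div_le_card_residue W 0 Y _) (div_le_card_residue W 0 Y _)
  have hx : ∀ w ∈ G, ∃ x₁ : ℤ, ∀ x ∈ Ico x₁ (x₁ + J), |x| ≤ R ∧
      n - b * hexagonal w.1 - c * hexagonal w.2 ≤ a * hexagonal x ∧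
      a * hexagonal x < n - b * hexagonal w.1 - c * hexagonal w.2 + H := by
    intro w hw
    obtain ⟨hw1, hw2⟩ := mem_product.1 hw
    obtain ⟨h1, h2⟩ := hhex _ (mem_filter.1 hw1).1
    obtain ⟨h3, h4⟩ := hhex _ (mem_filter.1 hw2).1
    have h5 := mul_le_mul_of_nonneg_left h2 (show (0 : ℤ) ≤ b by positivity)
    have h6 := mul_le_mul_of_nonneg_left h4 (show (0 : ℤ) ≤ c by positivity)
    have h7 : (0 : ℤ) ≤ b * hexagonal w.1 := mul_nonneg (by positivity) h1
    have h8 : (0 : ℤ) ≤ c * hexagonal w.2 := mul_nonneg (by positivity) h3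
    exact exists_interval_hexagonal ha (by linarith) (by linarith) hR hJ hJH
  choose! X hX using hx
  calc J / W * ((Y / W) * (Y / W)) ≤ J / W * #G := Nat.mul_le_mul_left _ hGcard
    _ = ∑ _w ∈ G, J / W := by rw [sum_const, smul_eq_mul, mul_comm]
    _ ≤ ∑ w ∈ G, #{x ∈ Ico (X w) (X w + J) | ((x : ℤ) : ZMod W) = ω.1} :=
        sum_le_sum fun w _ => div_le_card_residue W _ J _
    _ = #(G.sigma fun w => {x ∈ Ico (X w) (X w + J) | ((x : ℤ) : ZMod W) = ω.1}) :=
        (card_sigma _ _).symm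
    _ ≤ _ := by
      refine card_le_card_of_injOn (fun s => (s.2, s.1)) ?_ ?_
      · rintro ⟨w, x⟩ hs
        obtain ⟨hw, hx⟩ := mem_sigma.1 hs
        obtain ⟨hx1, hx2⟩ := mem_filter.1 hx
        dsimp only at hw hx1 hx2
        obtain ⟨hr, h1, h2⟩ := hX w hw x hx1
        obtain ⟨hw1, hw2⟩ := mem_product.1 hw
        obtain ⟨hy, hy'⟩ := mem_filter.1 hw1
        obtain ⟨hz, hz'⟩ := mem_filter.1 hw2
        have hYR : (Y : ℤ) ≤ R := by exact_mod_cast hY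
        rw [mem_Ico] at hy hz
        refine mem_filter.2 ⟨mem_cube.2 ⟨hr, ?_, ?_⟩, ?_, ?_, ?_⟩
        · dsimp only
          rw [abs_of_nonneg hy.1]
          linarith
        · dsimp only
          rw [abs_of_nonneg hz.1]
          linarith
        · simp only [castZMod, hx2, hy', hz']
        · simp only [ternaryForm]
          linarith
        · simp only [ternaryForm]
          linarith
      · rintro ⟨w, x⟩ _ ⟨w', x'⟩ _ h
        obtain ⟨h1, h2⟩ := Prod.mk.inj h
        dsimp only at h1 h2
        subst h1 h2
        rfl

lemma le_sum_repCount {a : ℕ} (ha : 0 < a) (b c : ℕ) {R J K Y : ℕ} {n : ℤ}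
    (hnR : 8 * n ≤ (R : ℤ) ^ 2) (hR : 8 ≤ R) (hJ : 4 * J ≤ R) (W : ℕ) [NeZero W]
    (hJH : 2 * a * J * R ≤ W * K) (hY : Y ≤ R) (hYn : 3 * ((b : ℤ) + c) * Y ^ 2 < n) :
    numSol a b c (n : ZMod W) * (J / W * ((Y / W) * (Y / W))) ≤
      ∑ k ∈ range K, repCount a b c R (n + W * k) := by
  have hW : 0 < W := Nat.pos_of_ne_zero (NeZero.ne W)
  set V : Finset (ℤ × ℤ × ℤ) := {v ∈ cube R | (n : ZMod W) = (ternaryForm a b c v : ℤ) ∧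
    n ≤ ternaryForm a b c v ∧ ternaryForm a b c v < n + ((W * K : ℕ) : ℤ)} with hV
  have h1 : numSol a b c (n : ZMod W) * (J / W * ((Y / W) * (Y / W))) ≤ #V := by
    rw [numSol, mul_comm]
    refine mul_card_image_le_card_of_maps_to (f := castZMod W) ?_ _ ?_
    · intro v hv
      refine mem_filter.2 ⟨mem_univ _, ?_⟩
      rw [ternaryForm_castZMod, (mem_filter.1 hv).2.1]
    · intro ω hω
      refine (le_card_residue_class ha b c hnR hR hJ hJH hY hYn W ω).trans (card_le_card ?_)
      intro v hv
      obtain ⟨hv1, hv2, hv3, hv4⟩ := mem_filter.1 hv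
      refine mem_filter.2 ⟨mem_filter.2 ⟨hv1, ?_, hv3, hv4⟩, hv2⟩
      rw [← ternaryForm_castZMod, hv2, (mem_filter.1 hω).2]
  have h2 : #V ≤ ∑ k ∈ range K, repCount a b c R (n + W * k) := by
    refine le_trans (card_le_card fun v hv => ?_) card_biUnion_le
    obtain ⟨hv1, hv2, hv3, hv4⟩ := mem_filter.1 hv
    obtain ⟨d, hd⟩ := (ZMod.intCast_eq_intCast_iff_dvd_sub _ _ _).1 hv2
    have hW' : (0 : ℤ) < W := by exact_mod_cast hW
    have hd0 : 0 ≤ d := by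
      by_contra! hd0
      nlinarith
    obtain ⟨k, rfl⟩ := Int.eq_ofNat_of_zero_le hd0
    have hk : (k : ℤ) < K := by
      by_contra! hk
      push_cast at hv4
      nlinarith
    exact mem_biUnion.2 ⟨k, mem_range.2 (by exact_mod_cast hk),
      mem_filter.2 ⟨hv1, by linarith⟩⟩
  exact h1.trans h2

lemma half_le_nat_div {m d : ℕ} (hd : 0 < d) (h : d ≤ m) :
    (m : ℝ) / (2 * d) ≤ ((m / d : ℕ) : ℝ) := by
  have hd' : (0 : ℝ) < d := by exact_mod_cast hd
  have h1 : (1 : ℝ) ≤ (m : ℝ) / d := by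
    rw [le_div_iff₀ hd', one_mul]
    exact_mod_cast h
  have h2 := half_le_floor h1
  rw [Nat.floor_div_eq_div] at h2
  refine le_trans (le_of_eq ?_) h2
  field_simp

theorem exists_le_sum_repCount {a b c : ℕ} (ha : 0 < a) (hb : 0 < b) {η c₀ : ℝ}
    (hη : 0 < η) (hη1 : η ≤ 1) (hc₀ : 0 < c₀) : ∃ κ : ℝ, 0 < κ ∧ ∀ (W : ℕ) [NeZero W] (δ : ℝ),
      0 < δ → W * δ ≤ 1 / 1000 → ∀ᶠ R : ℕ in atTop, ∀ n : ℤ, η * (R : ℝ) ^ 2 ≤ n →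
        8 * n ≤ (R : ℤ) ^ 2 → c₀ * (W : ℝ) ^ 2 ≤ numSol a b c (n : ZMod W) →
          κ * R * ⌊δ * (R : ℝ) ^ 2⌋₊ ≤
            ∑ k ∈ range ⌊δ * (R : ℝ) ^ 2⌋₊, (repCount a b c R (n + W * k) : ℝ) := by
  have ha' : (1 : ℝ) ≤ a := by exact_mod_cast ha
  have hb' : (1 : ℝ) ≤ b := by exact_mod_cast hb
  have hc' : (0 : ℝ) ≤ c := by positivity
  set ρ : ℝ := η / (6 * (b + c)) with hρ
  have hρ0 : 0 < ρ := by positivity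
  have hρη : 6 * (b + c) * ρ = η := by rw [hρ]; field_simp
  have hρ1 : ρ ≤ 1 := by nlinarith
  refine ⟨c₀ * ρ ^ 2 / (16 * a), by positivity, fun W _ δ hδ hWδ => ?_⟩
  have hW : 0 < W := Nat.pos_of_ne_zero (NeZero.ne W)
  have hW' : (1 : ℝ) ≤ W := by exact_mod_cast hW
  have hev : ∀ X : ℝ, ∀ᶠ R : ℕ in atTop, X ≤ R := fun X =>
    tendsto_natCast_atTop_atTop.eventually_ge_atTop X
  filter_upwards [hev 8, hev (W / ρ), hev (4 * a / δ), hev (1 / δ)] with R hR hRρ hRa hRδ n hn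
    hnR hsol
  have hR0 : (0 : ℝ) < R := by linarith
  have hR0' : 0 < R := by exact_mod_cast hR0
  rw [div_le_iff₀ hρ0, mul_comm] at hRρ
  rw [div_le_iff₀ hδ] at hRa hRδ
  set K : ℕ := ⌊δ * (R : ℝ) ^ 2⌋₊ with hK
  set Y : ℕ := ⌊ρ * R⌋₊ with hY
  have hK1 : (K : ℝ) ≤ δ * (R : ℝ) ^ 2 := Nat.floor_le (by positivity)
  have hK2 : δ * (R : ℝ) ^ 2 / 2 ≤ K := half_le_floor (by nlinarith)
  have hY1 : (Y : ℝ) ≤ ρ * R := Nat.floor_le (by positivity)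
  have hYW : ρ * R / (2 * W) ≤ ((Y / W : ℕ) : ℝ) := by
    rw [hY, ← Nat.floor_div_natCast]
    refine le_trans (le_of_eq ?_) (half_le_floor ((one_le_div (by positivity)).2 hRρ))
    field_simp
  have hJW : W * K / (2 * a * R) / W = K / (2 * a * R) := by
    rw [Nat.div_div_eq_div_mul, mul_comm (2 * a * R) W, Nat.mul_div_mul_left _ _ hW]
  have hKR : (K : ℝ) / (4 * a * R) ≤ ((K / (2 * a * R) : ℕ) : ℝ) := by
    refine le_trans (le_of_eq ?_) (half_le_nat_div (by positivity) ?_)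
    · push_cast
      ring
    · have : (2 : ℝ) * a * R ≤ K := by
        refine le_trans ?_ hK2
        nlinarith
      exact_mod_cast this
  have hJR : 4 * (W * K / (2 * a * R)) ≤ R := by
    have h1 : ((W * K / (2 * a * R) : ℕ) : ℝ) ≤ W * K / (2 * a * R) := by
      exact_mod_cast Nat.cast_div_le (α := ℝ) (m := W * K) (n := 2 * a * R)
    have h2 : (W : ℝ) * K / (2 * a * R) ≤ R / 4 := by
      rw [div_le_div_iff₀ (by positivity) (by norm_num)]
      have h3 : (W : ℝ) * K ≤ 1 / 1000 * (R : ℝ) ^ 2 := by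
        calc (W : ℝ) * K ≤ W * (δ * (R : ℝ) ^ 2) := by gcongr
          _ = (W * δ) * (R : ℝ) ^ 2 := by ring
          _ ≤ _ := by gcongr
      nlinarith
    have h3 : (4 : ℝ) * ((W * K / (2 * a * R) : ℕ) : ℝ) ≤ R := by linarith
    exact_mod_cast h3
  have hYR : Y ≤ R := by
    have : (Y : ℝ) ≤ R := hY1.trans (mul_le_of_le_one_left hR0.le hρ1)
    exact_mod_cast this
  have hYn : 3 * ((b : ℤ) + c) * Y ^ 2 < n := by
    have h1 : 3 * ((b : ℝ) + c) * (Y : ℝ) ^ 2 < n := by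
      calc 3 * ((b : ℝ) + c) * (Y : ℝ) ^ 2 ≤ 3 * ((b : ℝ) + c) * (ρ * R) ^ 2 := by gcongr
        _ = (6 * (b + c) * ρ) * ρ / 2 * (R : ℝ) ^ 2 := by ring
        _ = η * ρ / 2 * (R : ℝ) ^ 2 := by rw [hρη]
        _ < η * (R : ℝ) ^ 2 := by
          gcongr
          nlinarith
        _ ≤ n := hn
    exact_mod_cast h1
  have key := le_sum_repCount ha b c hnR (by exact_mod_cast hR) hJR W
    (J := W * K / (2 * a * R)) (K := K) (by
      calc 2 * a * (W * K / (2 * a * R)) * R = (W * K / (2 * a * R)) * (2 * a * R) := by ring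
        _ ≤ W * K := Nat.div_mul_le_self _ _) hYR hYn
  rw [hJW] at key
  have key' : (numSol a b c (n : ZMod W) : ℝ) * (((K / (2 * a * R) : ℕ) : ℝ) *
      (((Y / W : ℕ) : ℝ) * ((Y / W : ℕ) : ℝ))) ≤
        ∑ k ∈ range K, (repCount a b c R (n + W * k) : ℝ) := by exact_mod_cast key
  refine le_trans ?_ key'
  calc c₀ * ρ ^ 2 / (16 * a) * R * K
      = c₀ * (W : ℝ) ^ 2 * (K / (4 * a * R) * (ρ * R / (2 * W) * (ρ * R / (2 * W)))) := by
        field_simp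
        ring
    _ ≤ _ := by gcongr

/-! ### The second moment -/

lemma pairCount_eq_sum (a b c R : ℕ) (j : ℤ) {I : Finset ℤ}
    (hI : ∀ v ∈ cube R, ternaryForm a b c v ∈ I) :
    pairCount a b c R j = ∑ n ∈ I, repCount a b c R n * repCount a b c R (n + j) := by
  have hmaps : ∀ p ∈ ({p ∈ cube R ×ˢ cube R |
      ternaryForm a b c p.1 - ternaryForm a b c p.2 = j} : Finset _),
      ternaryForm a b c p.2 ∈ I := fun p hp => hI _ (mem_product.1 (mem_filter.1 hp).1).2
  rw [pairCount, card_eq_sum_card_fiberwise hmaps]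
  refine sum_congr rfl fun n _ => ?_
  rw [repCount, repCount, mul_comm, ← card_product]
  congr 1
  ext p
  simp only [mem_filter, mem_product]
  constructor
  · rintro ⟨⟨⟨h1, h2⟩, h3⟩, h4⟩
    exact ⟨⟨h1, by linarith⟩, h2, h4⟩
  · rintro ⟨⟨h1, h3⟩, h2, h4⟩
    exact ⟨⟨⟨h1, h2⟩, by linarith⟩, h4⟩

lemma sum_repCount_sq_le (a b c R : ℕ) (j : ℤ) {S : Finset ℤ}
    (hS : ∀ n ∈ S, repCount a b c R n = 0) :
    ∑ n ∈ S, (repCount a b c R (n + j) : ℝ) ^ 2 ≤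
      2 * ((pairCount a b c R 0 : ℝ) - pairCount a b c R j) := by
  set A : Finset ℤ := (cube R).image (ternaryForm a b c) with hA
  have hAmem : ∀ v ∈ cube R, ternaryForm a b c v ∈ A := fun v hv => mem_image_of_mem _ hv
  set I : Finset ℤ := S ∪ (A ∪ A.image (· - j)) with hI
  have hIA : ∀ v ∈ cube R, ternaryForm a b c v ∈ I := fun v hv =>
    mem_union_right _ (mem_union_left _ (hAmem v hv))
  have hIA' : ∀ v ∈ cube R, ternaryForm a b c v ∈ I.image (· + j) := fun v hv =>
    mem_image.2 ⟨ternaryForm a b c v - j,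
      mem_union_right _ (mem_union_right _ (mem_image_of_mem _ (hAmem v hv))), by ring⟩
  have h0 : (pairCount a b c R 0 : ℝ) = ∑ n ∈ I, (repCount a b c R n : ℝ) ^ 2 := by
    rw [pairCount_eq_sum a b c R 0 hIA]
    push_cast
    exact sum_congr rfl fun n _ => by rw [add_zero, pow_two]
  have h0' : (pairCount a b c R 0 : ℝ) = ∑ n ∈ I, (repCount a b c R (n + j) : ℝ) ^ 2 := by
    rw [pairCount_eq_sum a b c R 0 hIA', sum_image fun x _ y _ h => add_right_cancel h]
    push_cast
    exact sum_congr rfl fun n _ => by rw [add_zero, pow_two]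
  have hj : (pairCount a b c R j : ℝ) =
      ∑ n ∈ I, (repCount a b c R n : ℝ) * repCount a b c R (n + j) := by
    rw [pairCount_eq_sum a b c R j hIA]
    push_cast
    rfl
  calc ∑ n ∈ S, (repCount a b c R (n + j) : ℝ) ^ 2
      = ∑ n ∈ S, ((repCount a b c R n : ℝ) - repCount a b c R (n + j)) ^ 2 :=
        sum_congr rfl fun n hn => by rw [hS n hn]; push_cast; ring
    _ ≤ ∑ n ∈ I, ((repCount a b c R n : ℝ) - repCount a b c R (n + j)) ^ 2 :=
        sum_le_sum_of_subset_of_nonneg subset_union_left fun _ _ _ => by positivity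
    _ = ∑ n ∈ I, ((repCount a b c R n : ℝ) ^ 2 + (repCount a b c R (n + j) : ℝ) ^ 2 -
          2 * ((repCount a b c R n : ℝ) * repCount a b c R (n + j))) :=
        sum_congr rfl fun n _ => by ring
    _ = 2 * ((pairCount a b c R 0 : ℝ) - pairCount a b c R j) := by
        rw [sum_sub_distrib, sum_add_distrib, ← mul_sum, ← hj, ← h0, ← h0']
        ring

lemma card_mul_sq_le {a b c R W K : ℕ} {B m : ℝ} (hm : 0 ≤ m) {S : Finset ℤ}
    (hS : ∀ n ∈ S, repCount a b c R n = 0)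
    (hlow : ∀ n ∈ S, m ≤ ∑ k ∈ range K, (repCount a b c R (n + W * k) : ℝ))
    (hB : ∑ k ∈ range K, ((pairCount a b c R 0 : ℝ) - pairCount a b c R (W * k)) ≤ B) :
    #S * m ^ 2 ≤ 2 * K * B := by
  calc #S * m ^ 2 = ∑ _n ∈ S, m ^ 2 := by rw [sum_const, nsmul_eq_mul]
    _ ≤ ∑ n ∈ S, K * ∑ k ∈ range K, (repCount a b c R (n + W * k) : ℝ) ^ 2 := by
        refine sum_le_sum fun n hn => ?_
        refine (pow_le_pow_left₀ hm (hlow n hn) 2).trans ?_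
        have := sq_sum_le_card_mul_sum_sq (s := range K)
          (f := fun k : ℕ => (repCount a b c R (n + W * k) : ℝ))
        rwa [card_range] at this
    _ = K * ∑ k ∈ range K, ∑ n ∈ S, (repCount a b c R (n + W * k) : ℝ) ^ 2 := by
        rw [← mul_sum, sum_comm]
    _ ≤ K * ∑ k ∈ range K, 2 * ((pairCount a b c R 0 : ℝ) - pairCount a b c R (W * k)) := by
        gcongr with k _
        exact sum_repCount_sq_le a b c R _ hS
    _ ≤ 2 * K * B := by
        rw [← mul_sum]
        calc (K : ℝ) * (2 * ∑ k ∈ range K, ((pairCount a b c R 0 : ℝ) - pairCount a b c R (W * k)))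
            ≤ K * (2 * B) := by gcongr
          _ = 2 * K * B := by ring

/-! ### Density of the exceptional set -/

lemma exists_triangular_eq_hexagonal (x : ℤ) : ∃ k : ℕ, (triangular k : ℤ) = hexagonal x := by
  obtain ⟨m, rfl | rfl⟩ := x.eq_nat_or_neg
  · refine ⟨2 * m, ?_⟩
    have h := eight_mul_triangular_add_one (2 * m)
    push_cast at h
    simp only [hexagonal]
    linarith
  · rcases Nat.eq_zero_or_pos m with rfl | hm
    · exact ⟨0, by simp [hexagonal, triangular]⟩
    · refine ⟨2 * m - 1, ?_⟩
      have h := eight_mul_triangular_add_one (2 * m - 1)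
      rw [Nat.cast_sub (by omega)] at h
      push_cast at h
      simp only [hexagonal]
      linarith

lemma exists_triangular_of_repCount_ne_zero {a b c R n : ℕ} (h : repCount a b c R n ≠ 0) :
    ∃ x y z : ℕ, a * triangular x + b * triangular y + c * triangular z = n := by
  obtain ⟨v, hv⟩ := card_ne_zero.1 h
  obtain ⟨x, hx⟩ := exists_triangular_eq_hexagonal v.1
  obtain ⟨y, hy⟩ := exists_triangular_eq_hexagonal v.2.1
  obtain ⟨z, hz⟩ := exists_triangular_eq_hexagonal v.2.2
  refine ⟨x, y, z, ?_⟩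
  have h1 := (mem_filter.1 hv).2
  rw [ternaryForm, ← hx, ← hy, ← hz] at h1
  exact_mod_cast h1

lemma card_range_residue_le (W : ℕ) [NeZero W] (N : ℕ) (B : Finset (ZMod W)) :
    #{n ∈ range N | ((n : ℕ) : ZMod W) ∈ B} ≤ (N / W + 1) * #B := by
  refine card_le_mul_card_image_of_maps_to (f := fun n : ℕ => (n : ZMod W)) ?_ _ ?_
  · exact fun n hn => (mem_filter.1 hn).2
  · intro r _
    rw [← card_range (N / W + 1)]
    refine card_le_card_of_injOn (fun n => n / W) ?_ ?_
    · intro n hn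
      have := mem_range.1 (mem_filter.1 (mem_filter.1 hn).1).1
      exact mem_range.2 (Nat.lt_succ_of_le (Nat.div_le_div_right this.le))
    · intro m hm n hn h
      have h1 : ((m : ℕ) : ZMod W) = n := (mem_filter.1 hm).2.trans (mem_filter.1 hn).2.symm
      have h2 : m % W = n % W := (ZMod.natCast_eq_natCast_iff' m n W).1 h1
      have h3 : m / W = n / W := h
      rw [← Nat.div_add_mod m W, ← Nat.div_add_mod n W, h2, h3]

lemma tendsto_sqrt_eight_mul_add_one :
    Tendsto (fun N : ℕ => Nat.sqrt (8 * N) + 1) atTop atTop := by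
  refine tendsto_atTop.2 fun m => ?_
  filter_upwards [eventually_ge_atTop (m * m)] with N hN
  exact (Nat.le_sqrt.2 (by omega)).trans (Nat.le_succ _)

lemma card_exceptional_le {a b c R N W K : ℕ} [NeZero W] {η c₀ κ ε : ℝ} (hη : 0 ≤ η) (hκ : 0 < κ)
    (hR : 0 < R) (hK : 0 < K) (hRN : 8 * N ≤ R ^ 2)
    (hB : ∑ k ∈ range K, ((pairCount a b c R 0 : ℝ) - pairCount a b c R (W * k)) ≤
      K * (ε * (R : ℝ) ^ 4))
    (hlow : ∀ n : ℤ, η * (R : ℝ) ^ 2 ≤ n → 8 * n ≤ (R : ℤ) ^ 2 →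
      c₀ * (W : ℝ) ^ 2 ≤ numSol a b c (n : ZMod W) →
        κ * R * K ≤ ∑ k ∈ range K, (repCount a b c R (n + W * k) : ℝ))
    (hloc : (#{r : ZMod W | (numSol a b c r : ℝ) < c₀ * W ^ 2} : ℝ) ≤ η * W) :
    ({n : ℕ | n < N ∧ ¬ ∃ x y z : ℕ,
        a * triangular x + b * triangular y + c * triangular z = n}.ncard : ℝ) ≤
      (η * (R : ℝ) ^ 2 + 1) + (N + W) * η + 2 * ε * (R : ℝ) ^ 2 / κ ^ 2 := by
  classical
  have hW : 0 < W := Nat.pos_of_ne_zero (NeZero.ne W)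
  set B : Finset (ZMod W) := {r : ZMod W | (numSol a b c r : ℝ) < c₀ * W ^ 2} with hBdef
  set E₁ : Finset ℕ := range (⌊η * (R : ℝ) ^ 2⌋₊ + 1) with hE₁
  set E₂ : Finset ℕ := {n ∈ range N | ((n : ℕ) : ZMod W) ∈ B} with hE₂
  set E₃ : Finset ℕ := {n ∈ range N | η * (R : ℝ) ^ 2 ≤ n ∧
    c₀ * (W : ℝ) ^ 2 ≤ numSol a b c ((n : ℕ) : ZMod W) ∧ repCount a b c R n = 0} with hE₃
  have hsub : {n : ℕ | n < N ∧ ¬ ∃ x y z : ℕ,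
      a * triangular x + b * triangular y + c * triangular z = n} ⊆
      ((E₁ ∪ (E₂ ∪ E₃) : Finset ℕ) : Set ℕ) := by
    rintro n ⟨hnN, hn⟩
    rw [mem_coe, mem_union, mem_union]
    by_cases h1 : η * (R : ℝ) ^ 2 ≤ n
    · right
      by_cases h2 : (numSol a b c ((n : ℕ) : ZMod W) : ℝ) < c₀ * W ^ 2
      · exact Or.inl (mem_filter.2 ⟨mem_range.2 hnN, mem_filter.2 ⟨mem_univ _, h2⟩⟩)
      · refine Or.inr (mem_filter.2 ⟨mem_range.2 hnN, h1, not_lt.1 h2, ?_⟩)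
        by_contra h3
        exact hn (exists_triangular_of_repCount_ne_zero h3)
    · left
      exact mem_range.2 (Nat.lt_succ_of_le (Nat.le_floor (not_le.1 h1).le))
  have hcard : ({n : ℕ | n < N ∧ ¬ ∃ x y z : ℕ,
      a * triangular x + b * triangular y + c * triangular z = n}.ncard : ℝ) ≤
      #E₁ + (#E₂ + #E₃) := by
    have h := Set.ncard_le_ncard hsub (finite_toSet _)
    rw [Set.ncard_coe_finset] at h
    exact_mod_cast h.trans ((card_union_le _ _).trans (Nat.add_le_add_left (card_union_le _ _) _))
  have h1 : (#E₁ : ℝ) ≤ η * (R : ℝ) ^ 2 + 1 := by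
    rw [hE₁, card_range, Nat.cast_add, Nat.cast_one]
    gcongr
    exact Nat.floor_le (by positivity)
  have h2 : (#E₂ : ℝ) ≤ (N + W) * η := by
    have hW' : (0 : ℝ) < W := by exact_mod_cast hW
    have h : (#E₂ : ℝ) ≤ ((N / W : ℕ) + 1) * #B := by
      exact_mod_cast card_range_residue_le W N B
    calc (#E₂ : ℝ) ≤ ((N / W : ℕ) + 1) * #B := h
      _ ≤ ((N : ℝ) / W + 1) * (η * W) := by
          gcongr
          exact Nat.cast_div_le
      _ = (N + W) * η := by field_simp
  have h3 : (#E₃ : ℝ) ≤ 2 * ε * (R : ℝ) ^ 2 / κ ^ 2 := by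
    have hR' : (0 : ℝ) < R := by exact_mod_cast hR
    have hK' : (0 : ℝ) < K := by exact_mod_cast hK
    have h := card_mul_sq_le (a := a) (b := b) (c := c) (R := R) (W := W) (K := K)
      (m := κ * R * K) (S := E₃.image (fun n : ℕ => (n : ℤ))) (by positivity) ?_ ?_ hB
    · rw [card_image_of_injective _ Nat.cast_injective] at h
      rw [le_div_iff₀ (by positivity)]
      have h4 : (0 : ℝ) < (R : ℝ) ^ 2 * (K : ℝ) ^ 2 := by positivity
      refine le_of_mul_le_mul_right ?_ h4
      calc #E₃ * κ ^ 2 * ((R : ℝ) ^ 2 * (K : ℝ) ^ 2) = #E₃ * (κ * R * K) ^ 2 := by ring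
        _ ≤ _ := h
        _ = _ := by ring
    · intro n hn
      obtain ⟨m, hm, rfl⟩ := mem_image.1 hn
      exact (mem_filter.1 hm).2.2.2
    · intro n hn
      obtain ⟨m, hm, rfl⟩ := mem_image.1 hn
      obtain ⟨hm1, hm2, hm3, -⟩ := mem_filter.1 hm
      refine hlow m (by exact_mod_cast hm2) ?_ (by rwa [Int.cast_natCast])
      have := mem_range.1 hm1
      have h8 : 8 * m ≤ R ^ 2 := by omega
      exact_mod_cast h8
  linarith

theorem asympUniversal_of_locallySolvable {a b c : ℕ} (ha : 0 < a) (hb : 0 < b) (hc : 0 < c)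
    (hloc : ∀ p, p.Prime → LocallySolvable a b c p) :
    AsympUniversal (fun n => ∃ x y z : ℕ,
      a * triangular x + b * triangular y + c * triangular z = n) := by
  refine tendsto_order.2 ⟨fun x hx => Eventually.of_forall fun N =>
    hx.trans_le (by positivity), fun e he => ?_⟩
  set η : ℝ := min 1 (e / 200) with hη
  have hη0 : 0 < η := lt_min one_pos (by positivity)
  have hη1 : η ≤ 1 := min_le_left _ _
  have hηe : η ≤ e / 200 := min_le_right _ _
  obtain ⟨c₀, hc₀, hdens⟩ := exists_local_density hloc ha hb hc hη0
  obtain ⟨κ, hκ, hlow⟩ := exists_le_sum_repCount (c := c) ha hb hη0 hη1 hc₀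
  set ε : ℝ := min 1 (κ ^ 2 * e / 512) with hε
  have hε0 : 0 < ε := lt_min one_pos (by positivity)
  have hεe : ε ≤ κ ^ 2 * e / 512 := min_le_right _ _
  obtain ⟨Q, hQ⟩ := exists_sum_pairCount_sub_le ha hb hc hε0 (min_le_left _ _)
  set W : ℕ := 4 * Q.factorial with hW
  have hW0 : 0 < W := by positivity
  have : NeZero W := ⟨hW0.ne'⟩
  obtain ⟨δ, hδ, hWδ, hpair⟩ := hQ W hW0 fun g hg hgQ =>
    Nat.mul_dvd_mul_left 4 (Nat.dvd_factorial hg hgQ)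
  have hlow' := hlow W δ hδ hWδ
  have hRδ : ∀ᶠ R : ℕ in atTop, 1 / δ ≤ (R : ℝ) :=
    tendsto_natCast_atTop_atTop.eventually_ge_atTop _
  have hN : ∀ᶠ N : ℕ in atTop, 4 * (1 + W) / e ≤ (N : ℝ) :=
    tendsto_natCast_atTop_atTop.eventually_ge_atTop _
  filter_upwards [tendsto_sqrt_eight_mul_add_one.eventually (hpair.and (hlow'.and hRδ)), hN,
    eventually_gt_atTop 0] with N hev hNe hN0
  obtain ⟨hp, hl, hRδ'⟩ := hev
  set R : ℕ := Nat.sqrt (8 * N) + 1 with hR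
  have hN0' : (0 : ℝ) < N := by exact_mod_cast hN0
  rw [div_le_iff₀ he] at hNe
  rw [div_le_iff₀ hδ] at hRδ'
  have hR1 : (1 : ℝ) ≤ R := by
    have : 1 ≤ R := Nat.le_add_left 1 _
    exact_mod_cast this
  have hK : 0 < ⌊δ * (R : ℝ) ^ 2⌋₊ := Nat.floor_pos.2 (by nlinarith)
  have hRN : 8 * N ≤ R ^ 2 := (Nat.lt_succ_sqrt' (8 * N)).le
  have hRN' : (R : ℝ) ^ 2 ≤ 32 * N := by
    have h1 := Nat.sqrt_le' (8 * N)
    have h2 : 1 ≤ Nat.sqrt (8 * N) := Nat.le_sqrt.2 (by omega)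
    have h3 : R ^ 2 ≤ 32 * N := by
      rw [hR]
      nlinarith
    exact_mod_cast h3
  have hW' : (0 : ℝ) < W := by exact_mod_cast hW0
  have hbound := card_exceptional_le hη0.le hκ (Nat.succ_pos _) hK hRN hp hl (hdens W)
  rw [div_lt_iff₀ hN0']
  refine hbound.trans_lt ?_
  have t1 : η * (R : ℝ) ^ 2 ≤ e / 200 * (32 * N) := by gcongr
  have t2 : (N + W) * η ≤ N * (e / 200) + W := by
    have h1 : N * η ≤ N * (e / 200) := by gcongr
    have h2 : W * η ≤ W * 1 := by gcongr
    linarith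
  have t3 : 2 * ε * (R : ℝ) ^ 2 / κ ^ 2 ≤ e / 8 * N := by
    rw [div_le_iff₀ (by positivity)]
    calc 2 * ε * (R : ℝ) ^ 2 ≤ 2 * (κ ^ 2 * e / 512) * (32 * N) := by gcongr
      _ = e / 8 * N * κ ^ 2 := by ring
  have t4 : 0 < e * N := by positivity
  linarith

lemma isQR_of_asympUniversal {a b c : ℕ} (ha : 0 < a)
    (h : AsympUniversal (fun n => ∃ x y z : ℕ,
      a * triangular x + b * triangular y + c * triangular z = n)) :
    isQR (-((b : ℤ) * c)) (oddPart a) := by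
  intro p hp hdvd
  by_contra hleg
  obtain ⟨hp2, hpa⟩ := (prime_dvd_oddPart_iff ha hp).1 hdvd
  obtain ⟨q, hq, n₀, hn₀⟩ := exists_missed_residue_class hp hp2 hpa hleg
  exact not_asympUniversal_of_residue_class hq n₀ hn₀ h

end TernaryTriangular

/-- Kane–Sun: `a·t_x + b·t_y + c·t_z` is asymptotically universal iff
`-bc R a'`, `-ac R b'` and `-ab R c'`. -/
theorem asympUniversal_three_triangular_iff (a b c : ℕ)
    (ha : 0 < a) (hb : 0 < b) (hc : 0 < c)
    (hgcd : Nat.gcd a (Nat.gcd b c) = 1) :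
    AsympUniversal (fun n => ∃ x y z : ℕ,
        a * triangular x + b * triangular y + c * triangular z = n) ↔
      (isQR (-((b : ℤ) * c)) (oddPart a) ∧ isQR (-((a : ℤ) * c)) (oddPart b) ∧
        isQR (-((a : ℤ) * b)) (oddPart c)) := by
  open TernaryTriangular in
  constructor
  · refine fun h => ⟨isQR_of_asympUniversal ha h, isQR_of_asympUniversal hb ?_,
      isQR_of_asympUniversal hc ?_⟩
    · convert h using 2 with n
      exact ⟨fun ⟨x, y, z, e⟩ => ⟨y, x, z, by rw [← e]; ring⟩,
        fun ⟨x, y, z, e⟩ => ⟨y, x, z, by rw [← e]; ring⟩⟩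
    · convert h using 2 with n
      exact ⟨fun ⟨x, y, z, e⟩ => ⟨y, z, x, by rw [← e]; ring⟩,
        fun ⟨x, y, z, e⟩ => ⟨z, x, y, by rw [← e]; ring⟩⟩
  · rintro ⟨hA, hB, hC⟩
    exact asympUniversal_of_locallySolvable ha hb hc fun p hp =>
      locallySolvable_of_isQR ha hb hc hgcd hA hB hC hp
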